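/- Let u be a strong solution of ∂_t u = (1/2) u ∂_x² u on [0,T). Then u is continuously differentiable on (0,T) × ℝ (both partial derivatives ∂_t u and ∂_x u exist at every point of (0,T) × ℝ and are continuous there), and u satisfies the differential equation ∂_t u = (1/2) u ∂_x² u at almost every point of (0,T) × ℝ. -/

import Mathlib

open MeasureTheory Set Filter

noncomputable section

/-- Regularity requirements in the definition of a weak solution of
`∂ₜ u = (1/2) u ∂ₓ² u` on `[0,T) × ℝ`: continuity on `[0,T) × ℝ`, local Lipschitz
continuity of `u(t,·)`, and continuity of `t ↦ u(t,·)` into `W^{1,∞}_loc(ℝ)`. -/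
def RegWeak (T : ℝ) (u : ℝ → ℝ → ℝ) : Prop :=
  ContinuousOn (Function.uncurry u) (Ico 0 T ×ˢ (univ : Set ℝ)) ∧
  (∀ t ∈ Ico (0:ℝ) T, ∀ R : ℝ, 0 < R →
    ∃ L : NNReal, LipschitzOnWith L (u t) (Icc (-R) R)) ∧
  (∀ t₀ ∈ Ico (0:ℝ) T, ∀ R : ℝ, 0 < R →
    Tendsto (fun t => ⨆ x : Icc (-R) R,
        (|u t x.1 - u t₀ x.1| + |deriv (u t) x.1 - deriv (u t₀) x.1|))
      (nhdsWithin t₀ (Ico 0 T)) (nhds 0))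

/-- The weak (integral) formulation of `∂ₜ u = (1/2) u ∂ₓ² u` on `[0,T) × ℝ`,
tested against every `ψ ∈ C_c^∞([0,T) × ℝ)`. -/
def WeakForm (T : ℝ) (u : ℝ → ℝ → ℝ) : Prop :=
  ∀ ψ : ℝ → ℝ → ℝ,
    ContDiff ℝ (⊤ : ℕ∞) (Function.uncurry ψ) →
    HasCompactSupport (Function.uncurry ψ) →
    tsupport (Function.uncurry ψ) ⊆ Iio T ×ˢ (univ : Set ℝ) →
    (∫ x : ℝ, u 0 x * ψ 0 x) +
      (∫ t in Ico (0:ℝ) T, ∫ x : ℝ,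
        (u t x * deriv (fun s => ψ s x) t
          - (1/2) * deriv (fun y => ψ t y * u t y) x * deriv (u t) x)) = 0

/-- A weak solution of `∂ₜ u = (1/2) u ∂ₓ² u` on `[0,T) × ℝ`. -/
def IsWeakSolution (T : ℝ) (u : ℝ → ℝ → ℝ) : Prop :=
  (∀ t ∈ Ico (0:ℝ) T, ∀ x : ℝ, 0 ≤ u t x) ∧ RegWeak T u ∧ WeakForm T u

/-- `sup_{[0,T']×ℝ} ⟨x⟩⁻² u < ∞`, i.e. `u(t,x) ≤ M (x²+1)` on `[0,T'] × ℝ`. -/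
def QuadBoundOn (u : ℝ → ℝ → ℝ) (T' : ℝ) : Prop :=
  ∃ M : ℝ, ∀ t ∈ Icc (0:ℝ) T', ∀ x : ℝ, u t x ≤ M * (x ^ 2 + 1)

/-- For a.e. `t ∈ (0,T']` the function `u(t,·)` is twice differentiable, and
`t ↦ ess sup_x |∂ₓ² u(t,x)|` is integrable on `[0,T']` (expressed via an
integrable majorant `g`). -/
def SecondDerivIntegrableOn (u : ℝ → ℝ → ℝ) (T' : ℝ) : Prop :=
  ∃ g : ℝ → ℝ, IntegrableOn g (Icc (0:ℝ) T') ∧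
    ∀ᵐ t ∂(volume.restrict (Ioc (0:ℝ) T')),
      (∀ x : ℝ, DifferentiableAt ℝ (u t) x ∧ DifferentiableAt ℝ (deriv (u t)) x) ∧
      (∀ x : ℝ, |deriv (deriv (u t)) x| ≤ g t)

/-- A strong solution of `∂ₜ u = (1/2) u ∂ₓ² u` on `[0,T) × ℝ`. -/
def IsStrongSolution (T : ℝ) (u : ℝ → ℝ → ℝ) : Prop :=
  IsWeakSolution T u ∧
  ∀ T' : ℝ, 0 < T' → T' < T → QuadBoundOn u T' ∧ SecondDerivIntegrableOn u T'

open scoped Topology ContDiff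

/-- Unpacking of the `W^{1,∞}_loc` continuity: the spatial derivatives converge uniformly on
compact intervals. -/
lemma RegWeak.eventually_close {T : ℝ} {u : ℝ → ℝ → ℝ} (hu : RegWeak T u)
    {t₀ : ℝ} (ht₀ : t₀ ∈ Ico (0:ℝ) T) {R : ℝ} (hR : 0 < R) {ε : ℝ} (hε : 0 < ε) :
    ∀ᶠ t in 𝓝[Ico 0 T] t₀, ∀ x ∈ Icc (-R) R,
      |u t x - u t₀ x| < ε ∧ |deriv (u t) x - deriv (u t₀) x| < ε := by
  obtain ⟨-, hLip, hW⟩ := hu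
  have hbd : ∀ t ∈ Ico (0:ℝ) T, ∃ B : ℝ, ∀ x ∈ Icc (-R) R, |u t x| ≤ B ∧ |deriv (u t) x| ≤ B := by
    intro t ht
    obtain ⟨L, hL⟩ := hLip t ht (R + 1) (by linarith)
    obtain ⟨B, hB⟩ := isCompact_Icc.exists_bound_of_continuousOn hL.continuousOn
    refine ⟨max B L, fun x hx => ⟨?_, ?_⟩⟩
    · exact le_max_of_le_left (hB x ⟨by linarith [hx.1], by linarith [hx.2]⟩)
    · refine le_max_of_le_right ?_
      exact norm_deriv_le_of_lipschitzOn
        (Icc_mem_nhds (by linarith [hx.1]) (by linarith [hx.2])) hL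
  obtain ⟨B₀, hB₀⟩ := hbd t₀ ht₀
  filter_upwards [(hW t₀ ht₀ R hR).eventually (gt_mem_nhds hε), self_mem_nhdsWithin]
    with t ht htI x hx
  obtain ⟨B, hB⟩ := hbd t htI
  have hba : BddAbove (range fun x : Icc (-R) R =>
      (|u t x.1 - u t₀ x.1| + |deriv (u t) x.1 - deriv (u t₀) x.1|)) := by
    refine ⟨2 * (B + B₀), ?_⟩
    rintro _ ⟨y, rfl⟩
    have h1 := hB y.1 y.2
    have h2 := hB₀ y.1 y.2
    have h3 := abs_sub (u t y.1) (u t₀ y.1)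
    have h4 := abs_sub (deriv (u t) y.1) (deriv (u t₀) y.1)
    dsimp only
    linarith [h1.1, h1.2, h2.1, h2.2]
  have h := (le_ciSup hba ⟨x, hx⟩).trans_lt ht
  dsimp only at h
  have h1 := abs_nonneg (u t x - u t₀ x)
  have h2 := abs_nonneg (deriv (u t) x - deriv (u t₀) x)
  exact ⟨by linarith, by linarith⟩

lemma RegWeak.tendstoLocallyUniformlyOn_deriv {T : ℝ} {u : ℝ → ℝ → ℝ} (hu : RegWeak T u)
    {t₀ : ℝ} (ht₀ : t₀ ∈ Ico (0:ℝ) T) :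
    TendstoLocallyUniformlyOn (fun t => deriv (u t)) (deriv (u t₀)) (𝓝[Ico 0 T] t₀) univ := by
  rw [Metric.tendstoLocallyUniformlyOn_iff]
  intro ε hε x _
  refine ⟨Icc (-(|x| + 1)) (|x| + 1), ?_, ?_⟩
  · rw [nhdsWithin_univ]
    exact Icc_mem_nhds (by linarith [neg_abs_le x]) (by linarith [le_abs_self x])
  · filter_upwards [hu.eventually_close ht₀ (R := |x| + 1) (by positivity) hε] with t ht y hy
    rw [dist_comm, Real.dist_eq]
    exact (ht y hy).2

lemma RegWeak.tendsto {T : ℝ} {u : ℝ → ℝ → ℝ} (hu : RegWeak T u)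
    {t₀ : ℝ} (ht₀ : t₀ ∈ Ico (0:ℝ) T) (x : ℝ) :
    Tendsto (fun t => u t x) (𝓝[Ico 0 T] t₀) (𝓝 (u t₀ x)) := by
  rw [Metric.tendsto_nhds]
  intro ε hε
  filter_upwards [hu.eventually_close ht₀ (R := |x| + 1) (by positivity) hε] with t ht
  rw [Real.dist_eq]
  exact (ht x ⟨by linarith [neg_abs_le x], by linarith [le_abs_self x]⟩).1

/-- Times at which `u(t,·)` is twice differentiable accumulate at every time. -/
lemma IsStrongSolution.frequently_diff {T : ℝ} {u : ℝ → ℝ → ℝ} (hu : IsStrongSolution T u)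
    {t₀ : ℝ} (ht₀ : t₀ ∈ Ico (0:ℝ) T) :
    ∃ᶠ t in 𝓝[Ico 0 T] t₀,
      ∀ x : ℝ, DifferentiableAt ℝ (u t) x ∧ DifferentiableAt ℝ (deriv (u t)) x := by
  intro hcon
  rw [eventually_nhdsWithin_iff, Metric.eventually_nhds_iff] at hcon
  obtain ⟨ε, hε, hcon⟩ := hcon
  set b := min (t₀ + ε) ((t₀ + T) / 2) with hb
  have hb1 : t₀ < b := lt_min (by linarith) (by linarith [ht₀.2])
  have hb2 : b < T := (min_le_right _ _).trans_lt (by linarith [ht₀.2])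
  obtain ⟨-, g, -, hg⟩ := hu.2 b (ht₀.1.trans_lt hb1) hb2
  rw [ae_restrict_iff' measurableSet_Ioc] at hg
  have hpos : volume (Ioo t₀ b) ≠ 0 := by simp [hb1]
  have : ∃ t ∈ Ioo t₀ b, (t ∈ Ioc 0 b → 
      (∀ x : ℝ, DifferentiableAt ℝ (u t) x ∧ DifferentiableAt ℝ (deriv (u t)) x) ∧
      (∀ x : ℝ, |deriv (deriv (u t)) x| ≤ g t)) := by
    by_contra hne
    refine hpos (measure_mono_null (fun t ht => ?_) (ae_iff.1 hg))
    exact fun h => hne ⟨t, ht, h⟩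
  obtain ⟨t, ht, htg⟩ := this
  refine hcon (y := t) ?_ ⟨ht₀.1.trans ht.1.le, ht.2.trans hb2⟩
    (htg ⟨ht₀.1.trans_lt ht.1, ht.2.le⟩).1
  rw [Real.dist_eq, abs_of_pos (by linarith [ht.1])]
  have := ht.2.trans_le (min_le_left _ _)
  linarith

lemma IsStrongSolution.differentiable {T : ℝ} {u : ℝ → ℝ → ℝ} (hu : IsStrongSolution T u)
    {t₀ : ℝ} (ht₀ : t₀ ∈ Ico (0:ℝ) T) :
    Differentiable ℝ (u t₀) ∧ Continuous (deriv (u t₀)) := by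
  have hreg := hu.1.2.1
  set S : Set ℝ :=
    {t | ∀ x : ℝ, DifferentiableAt ℝ (u t) x ∧ DifferentiableAt ℝ (deriv (u t)) x} with hS
  have hne : (𝓝[Ico 0 T] t₀ ⊓ 𝓟 S).NeBot := by
    rw [← frequently_mem_iff_neBot]
    exact hu.frequently_diff ht₀
  have hle : 𝓝[Ico 0 T] t₀ ⊓ 𝓟 S ≤ 𝓝[Ico 0 T] t₀ := inf_le_left
  have hSev : ∀ᶠ t in 𝓝[Ico 0 T] t₀ ⊓ 𝓟 S, t ∈ S := mem_inf_of_right (mem_principal_self S)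
  have hunif : TendstoLocallyUniformlyOn (fun t => deriv (u t)) (deriv (u t₀))
      (𝓝[Ico 0 T] t₀ ⊓ 𝓟 S) univ := by
    intro v hv x hx
    obtain ⟨w, hw, h⟩ := hreg.tendstoLocallyUniformlyOn_deriv ht₀ v hv x hx
    exact ⟨w, hw, hle h⟩
  constructor
  · intro x
    refine (hasDerivAt_of_tendstoLocallyUniformlyOn (f := u) isOpen_univ hunif ?_ ?_
      (mem_univ x)).differentiableAt
    · filter_upwards [hSev] with t ht y _
      exact (ht y).1.hasDerivAt
    · intro y _
      exact (hreg.tendsto ht₀ y).mono_left hle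
  · rw [← continuousOn_univ]
    refine hunif.continuousOn ?_
    refine Eventually.frequently ?_
    filter_upwards [hSev] with t ht
    exact fun y _ => (ht y).2.continuousAt.continuousWithinAt

lemma IsStrongSolution.continuousOn_deriv {T : ℝ} {u : ℝ → ℝ → ℝ} (hu : IsStrongSolution T u) :
    ContinuousOn (fun p : ℝ × ℝ => deriv (u p.1) p.2) (Ico (0:ℝ) T ×ˢ (univ : Set ℝ)) := by
  rintro ⟨t₀, x₀⟩ ⟨ht₀, -⟩
  simp only at ht₀
  rw [ContinuousWithinAt, nhdsWithin_prod_eq, nhdsWithin_univ, Metric.tendsto_nhds]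
  intro ε hε
  have h1 := hu.1.2.1.eventually_close ht₀ (R := |x₀| + 1) (by positivity) (half_pos hε)
  have h2 : ∀ᶠ x in 𝓝 x₀, x ∈ Icc (-(|x₀| + 1)) (|x₀| + 1) :=
    Icc_mem_nhds (by linarith [neg_abs_le x₀]) (by linarith [le_abs_self x₀])
  have h3 := Metric.tendsto_nhds.1 ((hu.differentiable ht₀).2.tendsto x₀) _ (half_pos hε)
  filter_upwards [h1.prod_mk (h2.and h3)] with p hp
  have ha := (hp.1 p.2 hp.2.1).2
  have hb := hp.2.2
  rw [Real.dist_eq] at hb ⊢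
  have := abs_add_le (deriv (u p.1) p.2 - deriv (u t₀) p.2) (deriv (u t₀) p.2 - deriv (u t₀) x₀)
  rw [sub_add_sub_cancel] at this
  linarith

lemma exists_primitive_of_integral_eq_zero {τ : ℝ} (hτ : 0 < τ) {η : ℝ → ℝ}
    (hη : ContDiff ℝ ∞ η) (hc : HasCompactSupport η) (hs : tsupport η ⊆ Ioo 0 τ)
    (hint : ∫ t, η t = 0) :
    ∃ θ : ℝ → ℝ, ContDiff ℝ ∞ θ ∧ HasCompactSupport θ ∧ tsupport θ ⊆ Ioo 0 τ ∧
      ∀ t, HasDerivAt θ (η t) t := by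
  obtain ⟨α, β, hα, hαβ, hβ, hsub⟩ : ∃ α β, 0 < α ∧ α ≤ β ∧ β < τ ∧ tsupport η ⊆ Icc α β := by
    rcases (tsupport η).eq_empty_or_nonempty with h | h
    · exact ⟨τ / 2, τ / 2, by linarith, le_rfl, by linarith, by simp [h]⟩
    · have hcomp : IsCompact (tsupport η) := hc
      obtain ⟨α, hα, hα'⟩ := hcomp.exists_isLeast h
      obtain ⟨β, hβ, hβ'⟩ := hcomp.exists_isGreatest h
      exact ⟨α, β, (hs hα).1, hα' hβ, (hs hβ).2, fun x hx => ⟨hα' hx, hβ' hx⟩⟩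
  have hz : ∀ t, t ∉ Icc α β → η t = 0 := fun t ht =>
    image_eq_zero_of_notMem_tsupport fun h => ht (hsub h)
  have hder : ∀ t, HasDerivAt (fun t => ∫ r in (0:ℝ)..t, η r) (η t) t := fun t =>
    intervalIntegral.integral_hasDerivAt_right (hη.continuous.intervalIntegrable _ _)
      (hη.continuous.stronglyMeasurableAtFilter _ _) hη.continuous.continuousAt
  have hsupp : Function.support (fun t => ∫ r in (0:ℝ)..t, η r) ⊆ Icc α β := by
    intro t ht
    by_contra hcon
    apply ht
    simp only
    rcases lt_or_ge t α with h | h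
    · rw [intervalIntegral.integral_congr (g := fun _ => 0)]
      · simp
      · intro r hr
        refine hz r fun h' => ?_
        have : r < α := hr.2.trans_lt (max_lt hα h)
        linarith [h'.1]
    · have htβ : β < t := by
        by_contra h'
        exact hcon ⟨h, not_lt.1 h'⟩
      rw [intervalIntegral.integral_of_le (by linarith), ← hint]
      refine setIntegral_eq_integral_of_forall_compl_eq_zero fun r hr => hz r fun h' => hr ?_
      exact ⟨by linarith [h'.1], by linarith [h'.2]⟩
  have hts : tsupport (fun t => ∫ r in (0:ℝ)..t, η r) ⊆ Icc α β :=
    closure_minimal hsupp isClosed_Icc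
  refine ⟨fun t => ∫ r in (0:ℝ)..t, η r, ?_, ?_, ?_, hder⟩
  · rw [contDiff_infty_iff_deriv]
    refine ⟨fun t => (hder t).differentiableAt, ?_⟩
    rwa [show deriv (fun t => ∫ r in (0:ℝ)..t, η r) = η from funext fun t => (hder t).deriv]
  · exact HasCompactSupport.of_support_subset_isCompact isCompact_Icc hsupp
  · exact hts.trans fun t ht => ⟨hα.trans_le ht.1, ht.2.trans_lt hβ⟩

/-- The du Bois-Reymond lemma: if `a' = -c` in the sense of distributions on `(0,τ)`, then `a` is
a primitive of `-c`. -/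
lemma sub_eq_neg_integral_of_weak {τ : ℝ} (hτ : 0 < τ) {a c : ℝ → ℝ} (ha : Continuous a)
    (hcc : Continuous c)
    (h : ∀ θ : ℝ → ℝ, ContDiff ℝ ∞ θ → HasCompactSupport θ → tsupport θ ⊆ Ioo 0 τ →
      ∫ t, (deriv θ t * a t - θ t * c t) = 0) {t : ℝ} (ht : t ∈ Icc 0 τ) :
    a t - a 0 = - ∫ r in (0:ℝ)..t, c r := by
  set P : ℝ → ℝ := fun t => ∫ r in (0:ℝ)..t, c r with hP
  have hPd : ∀ t, HasDerivAt P (c t) t := fun t =>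
    intervalIntegral.integral_hasDerivAt_right (hcc.intervalIntegrable _ _)
      (hcc.stronglyMeasurableAtFilter _ _) hcc.continuousAt
  have hPc : Continuous P := continuous_iff_continuousAt.2 fun t => (hPd t).continuousAt
  set C : ℝ → ℝ := fun t => a t + P t with hC
  have hCc : Continuous C := ha.add hPc
  have h1 : ∀ θ : ℝ → ℝ, ContDiff ℝ ∞ θ → HasCompactSupport θ → tsupport θ ⊆ Ioo 0 τ →
      ∫ t, deriv θ t * C t = 0 := by
    intro θ hθ hθc hθs
    have hd : Continuous (deriv θ) := hθ.continuous_deriv (by simp)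
    have hdc : HasCompactSupport (deriv θ) := hθc.deriv
    have i1 : Integrable fun t => deriv θ t * a t :=
      (hd.mul ha).integrable_of_hasCompactSupport hdc.mul_right
    have i2 : Integrable fun t => deriv θ t * P t :=
      (hd.mul hPc).integrable_of_hasCompactSupport hdc.mul_right
    have i3 : Integrable fun t => θ t * c t :=
      (hθ.continuous.mul hcc).integrable_of_hasCompactSupport hθc.mul_right
    have i4 : Integrable fun t => θ t * P t :=
      (hθ.continuous.mul hPc).integrable_of_hasCompactSupport hθc.mul_right
    have hparts := integral_mul_deriv_eq_deriv_mul_of_integrable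
      (u := θ) (v := P) (u' := deriv θ) (v' := c)
      (fun t _ => (hθ.differentiable (by simp) t).hasDerivAt) (fun t _ => hPd t) i3 i2 i4
    have h0 := h θ hθ hθc hθs
    rw [integral_sub i1 i3, hparts] at h0
    simp only [hC, mul_add]
    rw [integral_add i1 i2]
    linarith
  have hbump : ∃ θ₀ : ℝ → ℝ, ContDiff ℝ ∞ θ₀ ∧ HasCompactSupport θ₀ ∧ tsupport θ₀ ⊆ Ioo 0 τ ∧
      ∫ t, θ₀ t = 1 := by
    let b : ContDiffBump (τ / 2) := ⟨τ / 8, τ / 4, by linarith, by linarith⟩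
    refine ⟨b.normed volume, b.contDiff_normed, b.hasCompactSupport_normed, ?_, b.integral_normed⟩
    rw [b.tsupport_normed_eq, Real.closedBall_eq_Icc]
    intro t ht
    change t ∈ Icc (τ / 2 - τ / 4) (τ / 2 + τ / 4) at ht
    exact ⟨by linarith [ht.1], by linarith [ht.2]⟩
  obtain ⟨θ₀, hθ₀, hθ₀c, hθ₀s, hθ₀i⟩ := hbump
  have h2 : ∀ᵐ t, t ∈ Ioo 0 τ → C t - (∫ t, θ₀ t * C t) = 0 := by
    refine isOpen_Ioo.ae_eq_zero_of_integral_contDiff_smul_eq_zero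
      ((hCc.sub continuous_const).locallyIntegrable.locallyIntegrableOn _) ?_
    intro ξ hξ hξc hξs
    have i1 : Integrable ξ := hξ.continuous.integrable_of_hasCompactSupport hξc
    have i0 : Integrable θ₀ := hθ₀.continuous.integrable_of_hasCompactSupport hθ₀c
    have i2 : Integrable fun t => ξ t * C t :=
      (hξ.continuous.mul hCc).integrable_of_hasCompactSupport hξc.mul_right
    have i3 : Integrable fun t => θ₀ t * C t :=
      (hθ₀.continuous.mul hCc).integrable_of_hasCompactSupport hθ₀c.mul_right
    obtain ⟨θ, hθ, hθc, hθs, hθd⟩ := exists_primitive_of_integral_eq_zero hτ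
      (η := fun t => ξ t - (∫ r, ξ r) * θ₀ t) (hξ.sub (contDiff_const.mul hθ₀))
      (hξc.sub hθ₀c.mul_left)
      ((tsupport_sub _ _).trans (union_subset hξs ((tsupport_mul_subset_right).trans hθ₀s)))
      (by rw [integral_sub i1 (i0.const_mul _), integral_const_mul, hθ₀i]; ring)
    have h3 := h1 θ hθ hθc hθs
    simp only [(hθd _).deriv] at h3
    have h4 : ∀ t, (ξ t - (∫ r, ξ r) * θ₀ t) * C t = ξ t * C t - (∫ r, ξ r) * (θ₀ t * C t) :=
      fun t => by ring
    simp only [h4] at h3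
    rw [integral_sub i2 (i3.const_mul _), integral_const_mul] at h3
    simp only [smul_eq_mul, mul_sub]
    rw [integral_sub i2 (i1.mul_const _), integral_mul_const]
    exact h3
  have h3 : EqOn C (fun _ => ∫ t, θ₀ t * C t) (Ioo 0 τ) := by
    refine Measure.eqOn_open_of_ae_eq (μ := volume) ?_ isOpen_Ioo hCc.continuousOn
      continuousOn_const
    rw [EventuallyEq, ae_restrict_iff' measurableSet_Ioo]
    filter_upwards [h2] with t ht htI
    linarith [ht htI]
  have h4 : EqOn C (fun _ => ∫ t, θ₀ t * C t) (Icc 0 τ) := by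
    rw [← closure_Ioo hτ.ne]
    exact h3.closure hCc continuous_const
  have e1 := h4 ht
  have e2 := h4 (left_mem_Icc.2 hτ.le)
  simp only [hC, hP, intervalIntegral.integral_same] at e1 e2
  linarith

/-- A regularized form of the notion of strong solution on `[0,τ]`: all functions are defined for
all times, and the equation is integrated in time. -/
structure IsIntegratedSolution (τ : ℝ) (g : ℝ → ℝ) (u : ℝ → ℝ → ℝ) : Prop where
  continuous : Continuous (Function.uncurry u)
  differentiable : ∀ t, Differentiable ℝ (u t)
  continuous_deriv : Continuous fun p : ℝ × ℝ => deriv (u p.1) p.2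
  nonneg : ∀ t x, 0 ≤ u t x
  quad : ∃ M : ℝ, 0 ≤ M ∧ ∀ t x, u t x ≤ M * (x ^ 2 + 1)
  integrable : Integrable g
  g_nonneg : ∀ t, 0 ≤ g t
  second : ∀ᵐ t, t ∈ Icc 0 τ → ∀ x, DifferentiableAt ℝ (deriv (u t)) x ∧
    |deriv (deriv (u t)) x| ≤ g t
  evol : ∀ᵐ x, ∀ t ∈ Icc 0 τ,
    u t x = u 0 x + ∫ r in (0:ℝ)..t, 1 / 2 * u r x * deriv (deriv (u r)) x

lemma measurable_deriv_deriv {u : ℝ → ℝ → ℝ}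
    (hu : Continuous fun p : ℝ × ℝ => deriv (u p.1) p.2) :
    Measurable fun p : ℝ × ℝ => deriv (deriv (u p.1)) p.2 :=
  measurable_deriv_with_param (f := fun t => deriv (u t)) hu

lemma integrable_prod_rhs {τ M : ℝ} {g : ℝ → ℝ} {u : ℝ → ℝ → ℝ} {ν : Measure ℝ} [SFinite ν]
    (hc : Continuous (Function.uncurry u))
    (hcd : Continuous fun p : ℝ × ℝ => deriv (u p.1) p.2)
    (hn : ∀ t x, 0 ≤ u t x) (hM : ∀ t x, u t x ≤ M * (x ^ 2 + 1)) (hg : Integrable g)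
    (hsec : ∀ᵐ t, t ∈ Icc 0 τ → ∀ x, |deriv (deriv (u t)) x| ≤ g t)
    {k : ℝ → ℝ} (hk : Measurable k) (hki : Integrable (fun x => k x * (x ^ 2 + 1)) ν)
    {s : Set ℝ} (hs : MeasurableSet s) (hsτ : s ⊆ Icc 0 τ) :
    Integrable (fun p : ℝ × ℝ => k p.2 * (1 / 2 * u p.1 p.2 * deriv (deriv (u p.1)) p.2))
      ((volume.restrict s).prod ν) := by
  have hb : Integrable (fun p : ℝ × ℝ => g p.1 * (M / 2 * (k p.2 * (p.2 ^ 2 + 1))))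
      ((volume.restrict s).prod ν) := hg.restrict.mul_prod (hki.const_mul _)
  refine hb.mono ?_ ?_
  · have hc' : Measurable fun p : ℝ × ℝ => u p.1 p.2 := hc.measurable
    exact ((hk.comp measurable_snd).mul ((hc'.const_mul _).mul
      (measurable_deriv_deriv hcd))).aestronglyMeasurable
  · have h1 : ∀ᵐ p : ℝ × ℝ ∂((volume.restrict s).prod ν),
        ∀ x, |deriv (deriv (u p.1)) x| ≤ g p.1 := by
      refine Measure.quasiMeasurePreserving_fst.ae (p := fun t => ∀ x,
        |deriv (deriv (u t)) x| ≤ g t) ?_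
      rw [ae_restrict_iff' hs]
      filter_upwards [hsec] with t ht hts using ht (hsτ hts)
    filter_upwards [h1] with p hp
    simp only [norm_mul, Real.norm_eq_abs]
    have h2 : |u p.1 p.2| ≤ |M| * |p.2 ^ 2 + 1| := by
      rw [abs_of_nonneg (hn _ _), ← abs_mul]
      exact (hM _ _).trans (le_abs_self _)
    have h3 : |deriv (deriv (u p.1)) p.2| ≤ |g p.1| := (hp p.2).trans (le_abs_self _)
    have h4 : |(1:ℝ) / 2| = 1 / 2 := abs_of_pos (by norm_num)
    have h5 : |M / 2| = |M| / 2 := by rw [abs_div]; norm_num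
    rw [h4, h5]
    calc |k p.2| * (1 / 2 * |u p.1 p.2| * |deriv (deriv (u p.1)) p.2|)
        ≤ |k p.2| * (1 / 2 * (|M| * |p.2 ^ 2 + 1|) * |g p.1|) := by gcongr
      _ = _ := by ring

/-- The integrated equation follows from its version tested against functions of `x`. -/
lemma evol_of_tested {τ M : ℝ} (hτ : 0 < τ) {g : ℝ → ℝ} {u : ℝ → ℝ → ℝ}
    (hc : Continuous (Function.uncurry u))
    (hcd : Continuous fun p : ℝ × ℝ => deriv (u p.1) p.2)
    (hn : ∀ t x, 0 ≤ u t x) (hM : ∀ t x, u t x ≤ M * (x ^ 2 + 1)) (hg : Integrable g)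
    (hsec : ∀ᵐ t, t ∈ Icc 0 τ → ∀ x, |deriv (deriv (u t)) x| ≤ g t)
    (htest : ∀ φ : ℝ → ℝ, ContDiff ℝ ∞ φ → HasCompactSupport φ → ∀ t ∈ Icc 0 τ,
      ∫ x, φ x * (u t x - u 0 x) =
        ∫ r in (0:ℝ)..t, ∫ x, φ x * (1 / 2 * u r x * deriv (deriv (u r)) x)) :
    ∀ᵐ x, ∀ t ∈ Icc 0 τ,
      u t x = u 0 x + ∫ r in (0:ℝ)..t, 1 / 2 * u r x * deriv (deriv (u r)) x := by
  have hcx : ∀ t, Continuous (u t) := fun t => hc.comp (Continuous.prodMk_right t)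
  have key : ∀ t ∈ Icc 0 τ, ∀ᵐ x,
      (u t x - u 0 x) - ∫ r in (0:ℝ)..t, 1 / 2 * u r x * deriv (deriv (u r)) x = 0 := by
    intro t ht
    have hsub : Ioc 0 t ⊆ Icc 0 τ := fun r hr => ⟨hr.1.le, hr.2.trans ht.2⟩
    simp only [intervalIntegral.integral_of_le ht.1]
    have hloc : LocallyIntegrable
        (fun x => ∫ r in Ioc 0 t, 1 / 2 * u r x * deriv (deriv (u r)) x) := by
      rw [locallyIntegrable_iff]
      intro K hK
      have := (integrable_prod_rhs (ν := volume.restrict K) hc hcd hn hM hg hsec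
        (k := fun _ => 1) measurable_const
        ((by fun_prop : Continuous fun x : ℝ => (1:ℝ) * (x ^ 2 + 1)).continuousOn.integrableOn_compact
          hK) measurableSet_Ioc hsub).integral_prod_right
      simpa only [one_mul, IntegrableOn] using this
    have hloc2 : LocallyIntegrable (fun x => u t x - u 0 x) :=
      ((hcx t).sub (hcx 0)).locallyIntegrable
    refine ae_eq_zero_of_integral_contDiff_smul_eq_zero (hloc2.sub hloc) ?_
    intro φ hφ hφc
    have i1 : Integrable fun x => φ x * (u t x - u 0 x) :=
      (hφ.continuous.mul ((hcx t).sub (hcx 0))).integrable_of_hasCompactSupport hφc.mul_right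
    have hp := integrable_prod_rhs (ν := volume) hc hcd hn hM hg hsec
        (k := φ) hφ.continuous.measurable
        ((hφ.continuous.mul (by fun_prop : Continuous fun x : ℝ =>
          (x ^ 2 + 1))).integrable_of_hasCompactSupport hφc.mul_right) measurableSet_Ioc hsub
    have i2 : Integrable fun x =>
        φ x * ∫ r in Ioc 0 t, 1 / 2 * u r x * deriv (deriv (u r)) x := by
      have := hp.integral_prod_right
      simpa only [integral_const_mul] using this
    simp only [smul_eq_mul, mul_sub (φ _) (u t _ - u 0 _)]
    rw [integral_sub i1 i2, htest φ hφ hφc t ht, intervalIntegral.integral_of_le ht.1,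
      integral_integral_swap hp]
    simp only [integral_const_mul, sub_self]
  have hproj : ∀ t, (projIcc 0 τ hτ.le t : ℝ) ∈ Icc 0 τ := fun t => (projIcc 0 τ hτ.le t).2
  have hall : ∀ᵐ x, ∀ s : ℚ, (u (projIcc 0 τ hτ.le s) x - u 0 x) -
      ∫ r in (0:ℝ)..(projIcc 0 τ hτ.le s), 1 / 2 * u r x * deriv (deriv (u r)) x = 0 :=
    ae_all_iff.2 fun s => key _ (hproj s)
  filter_upwards [hall] with x hx
  have hint : IntegrableOn (fun r => 1 / 2 * u r x * deriv (deriv (u r)) x) (uIcc 0 τ) := by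
    have := integrable_prod_rhs (ν := Measure.dirac x) hc hcd hn hM hg hsec
      (k := fun _ => 1) measurable_const (by
        refine (integrable_const ((1:ℝ) * (x ^ 2 + 1))).congr ?_
        rw [EventuallyEq, ae_dirac_iff]
        exact measurableSet_eq_fun (by fun_prop) (by fun_prop))
      measurableSet_Icc (subset_refl (Icc 0 τ))
    have h2 := this.integral_prod_left
    have hm : ∀ r, Measurable fun x => deriv (deriv (u r)) x := fun r =>
      (measurable_deriv_deriv hcd).comp measurable_prodMk_left
    rw [uIcc_of_le hτ.le]
    refine h2.congr (Eventually.of_forall fun r => ?_)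
    simp
  have hcont : Continuous fun s : ℝ => (u (projIcc 0 τ hτ.le s) x - u 0 x) -
      ∫ r in (0:ℝ)..(projIcc 0 τ hτ.le s), 1 / 2 * u r x * deriv (deriv (u r)) x := by
    have hpc : Continuous fun s : ℝ => (projIcc 0 τ hτ.le s : ℝ) :=
      continuous_subtype_val.comp continuous_projIcc
    refine ((hc.comp (hpc.prodMk continuous_const)).sub continuous_const).sub ?_
    have := intervalIntegral.continuousOn_primitive_interval hint
    rw [uIcc_of_le hτ.le] at this
    exact this.comp_continuous hpc hproj
  have h0 := Continuous.ext_on Rat.denseRange_cast hcont continuous_const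
    (g := fun _ => (0:ℝ)) (by rintro _ ⟨s, rfl⟩; exact hx s)
  intro t ht
  have := congrFun h0 t
  simp only [projIcc_of_mem hτ.le ht] at this
  linarith

lemma integral_deriv_mul_deriv_eq {w φ : ℝ → ℝ} {B : ℝ} (hφ : ContDiff ℝ ∞ φ)
    (hφc : HasCompactSupport φ) (hw : Differentiable ℝ w) (hw' : Differentiable ℝ (deriv w))
    (hB : ∀ x, |deriv (deriv w) x| ≤ B) :
    ∫ x, 1 / 2 * (deriv φ x * w x + φ x * deriv w x) * deriv w x =
      - ∫ x, φ x * (1 / 2 * w x * deriv (deriv w) x) := by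
  have hφd : ∀ x, HasDerivAt φ (deriv φ x) x := fun x =>
    (hφ.differentiable (by simp) x).hasDerivAt
  have hφ' : Continuous (deriv φ) := hφ.continuous_deriv (by simp)
  have hcw := hw.continuous
  have hcw' := hw'.continuous
  have hmeas : AEStronglyMeasurable (deriv (deriv w)) volume :=
    (measurable_deriv (deriv w)).aestronglyMeasurable
  have i1 : Integrable fun x => (1 / 2 * (φ x * w x)) * deriv (deriv w) x := by
    refine Integrable.mul_bdd (c := B) ?_ hmeas (Eventually.of_forall hB)
    exact (((hφ.continuous.mul hcw).const_mul _).integrable_of_hasCompactSupport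
      (hφc.mul_right.mul_left))
  have i2 : Integrable fun x => (1 / 2 * (deriv φ x * w x + φ x * deriv w x)) * deriv w x := by
    refine Continuous.integrable_of_hasCompactSupport (by fun_prop) ?_
    exact ((hφc.deriv.mul_right.add hφc.mul_right).mul_left).mul_right
  have i3 : Integrable fun x => (1 / 2 * (φ x * w x)) * deriv w x := by
    refine Continuous.integrable_of_hasCompactSupport (by fun_prop) ?_
    exact (hφc.mul_right.mul_left).mul_right
  have := integral_mul_deriv_eq_deriv_mul_of_integrable
    (u := fun x => 1 / 2 * (φ x * w x)) (v := deriv w)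
    (u' := fun x => 1 / 2 * (deriv φ x * w x + φ x * deriv w x)) (v' := deriv (deriv w))
    (fun x _ => ((hφd x).mul (hw x).hasDerivAt).const_mul _)
    (fun x _ => (hw' x).hasDerivAt) i1 i2 i3
  rw [eq_comm, neg_eq_iff_eq_neg, ← this]
  congr 1
  ext x
  ring

lemma IsStrongSolution.tested {T : ℝ} {u : ℝ → ℝ → ℝ} (hu : IsStrongSolution T u)
    {τ : ℝ} (hτ : 0 < τ) (hτT : τ < T) {w : ℝ → ℝ → ℝ} (hwu : ∀ t ∈ Icc 0 τ, w t = u t)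
    {g : ℝ → ℝ} (hc : Continuous (Function.uncurry w)) (hd : ∀ t, Differentiable ℝ (w t))
    (hcd : Continuous fun p : ℝ × ℝ => deriv (w p.1) p.2)
    (hsec : ∀ᵐ t, t ∈ Icc 0 τ → ∀ x, DifferentiableAt ℝ (deriv (w t)) x ∧
      |deriv (deriv (w t)) x| ≤ g t)
    {φ : ℝ → ℝ} (hφ : ContDiff ℝ ∞ φ) (hφc : HasCompactSupport φ) {t : ℝ} (ht : t ∈ Icc 0 τ) :
    ∫ x, φ x * (w t x - w 0 x) =
        ∫ r in (0:ℝ)..t, ∫ x, φ x * (1 / 2 * w r x * deriv (deriv (w r)) x) := by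
  have hφ' : Continuous (deriv φ) := hφ.continuous_deriv (by simp)
  have hcx : ∀ t, Continuous (w t) := fun t => hc.comp (Continuous.prodMk_right t)
  have hcd' : ∀ t, Continuous (deriv (w t)) := fun t => hcd.comp (Continuous.prodMk_right t)
  have hc2 : Continuous fun p : ℝ × ℝ => w p.1 p.2 := hc
  set a : ℝ → ℝ := fun t => ∫ x, φ x * w t x with ha
  set c : ℝ → ℝ := fun t =>
    ∫ x, 1 / 2 * (deriv φ x * w t x + φ x * deriv (w t) x) * deriv (w t) x with hcc
  have hφK : ∀ x, x ∉ tsupport φ → φ x = 0 := fun x hx => image_eq_zero_of_notMem_tsupport hx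
  have hφK' : ∀ x, x ∉ tsupport φ → deriv φ x = 0 := fun x hx =>
    image_eq_zero_of_notMem_tsupport fun h => hx (tsupport_deriv_subset h)
  have hac : Continuous a := by
    rw [← continuousOn_univ]
    refine continuousOn_integral_of_compact_support (k := tsupport φ) hφc ?_ ?_
    · exact (by fun_prop : Continuous fun p : ℝ × ℝ => φ p.2 * w p.1 p.2).continuousOn
    · intro p x _ hx
      simp [hφK x hx]
  have hccont : Continuous c := by
    rw [← continuousOn_univ]
    refine continuousOn_integral_of_compact_support (k := tsupport φ) hφc ?_ ?_
    · exact (by fun_prop : Continuous fun p : ℝ × ℝ => 1 / 2 * (deriv φ p.2 * w p.1 p.2 +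
        φ p.2 * deriv (w p.1) p.2) * deriv (w p.1) p.2).continuousOn
    · intro p x _ hx
      simp [hφK x hx, hφK' x hx]
  have i1 : ∀ t, Integrable fun x => φ x * w t x := fun t =>
    (hφ.continuous.mul (hcx t)).integrable_of_hasCompactSupport hφc.mul_right
  have i2 : ∀ t, Integrable fun x =>
      1 / 2 * (deriv φ x * w t x + φ x * deriv (w t) x) * deriv (w t) x := by
    intro t
    have := hcx t
    have := hcd' t
    refine Continuous.integrable_of_hasCompactSupport (by fun_prop) ?_
    exact ((hφc.deriv.mul_right.add hφc.mul_right).mul_left).mul_right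
  have hweak : ∀ θ : ℝ → ℝ, ContDiff ℝ ∞ θ → HasCompactSupport θ → tsupport θ ⊆ Ioo 0 τ →
      ∫ t, (deriv θ t * a t - θ t * c t) = 0 := by
    intro θ hθ hθc hθs
    have hθ0 : ∀ t, t ∉ Ioo 0 τ → θ t = 0 := fun t ht =>
      image_eq_zero_of_notMem_tsupport fun h => ht (hθs h)
    have hθ0' : ∀ t, t ∉ Ioo 0 τ → deriv θ t = 0 := fun t ht =>
      image_eq_zero_of_notMem_tsupport fun h => ht (hθs (tsupport_deriv_subset h))
    have hsupp : Function.support (Function.uncurry fun t x => θ t * φ x) ⊆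
        tsupport θ ×ˢ tsupport φ := by
      rintro ⟨t, x⟩ h
      have h' : θ t * φ x ≠ 0 := h
      exact ⟨subset_tsupport _ (left_ne_zero_of_mul h'), subset_tsupport _ (right_ne_zero_of_mul h')⟩
    have hcomp : IsCompact (tsupport θ ×ˢ tsupport φ) := IsCompact.prod hθc hφc
    have h := hu.1.2.2 (fun t x => θ t * φ x)
      ((hθ.comp contDiff_fst).mul (hφ.comp contDiff_snd))
      (HasCompactSupport.of_support_subset_isCompact hcomp hsupp)
      ((closure_minimal hsupp hcomp.isClosed).trans
        (prod_mono (hθs.trans fun t ht => ht.2.trans hτT) (subset_univ _)))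
    have h00 : θ 0 = 0 := hθ0 0 (by simp)
    simp only [h00, zero_mul, mul_zero, integral_zero, zero_add] at h
    rw [← h, ← setIntegral_eq_integral_of_forall_compl_eq_zero (s := Ico 0 T)]
    · refine setIntegral_congr_fun measurableSet_Ico fun t ht => ?_
      by_cases htτ : t ∈ Ioo 0 τ
      · simp only [← hwu t ⟨htτ.1.le, htτ.2.le⟩]
        have e : ∀ x, w t x * deriv (fun s => θ s * φ x) t -
            1 / 2 * deriv (fun y => θ t * φ y * w t y) x * deriv (w t) x =
            deriv θ t * (φ x * w t x) - θ t *
              (1 / 2 * (deriv φ x * w t x + φ x * deriv (w t) x) * deriv (w t) x) := by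
          intro x
          have e1 : deriv (fun s => θ s * φ x) t = deriv θ t * φ x :=
            ((hθ.differentiable (by simp) t).hasDerivAt.mul_const _).deriv
          have e2 : deriv (fun y => θ t * φ y * w t y) x =
              θ t * deriv φ x * w t x + θ t * φ x * deriv (w t) x :=
            (((hφ.differentiable (by simp) x).hasDerivAt.const_mul (θ t)).mul
              (hd t x).hasDerivAt).deriv
          rw [e1, e2]
          ring
        simp only [e]
        rw [integral_sub ((i1 t).const_mul _) ((i2 t).const_mul _), integral_const_mul,
          integral_const_mul]
      · have e1 : ∀ x, deriv (fun s => θ s * φ x) t = 0 := fun x => by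
          rw [((hθ.differentiable (by simp) t).hasDerivAt.mul_const _).deriv, hθ0' t htτ, zero_mul]
        simp [hθ0 t htτ, hθ0' t htτ, e1]
    · intro t ht
      have : t ∉ Ioo 0 τ := fun h => ht ⟨h.1.le, h.2.trans hτT⟩
      simp [hθ0 t this, hθ0' t this]
  have hfin := sub_eq_neg_integral_of_weak hτ hac hccont hweak ht
  simp only [mul_sub]
  rw [integral_sub (i1 t) (i1 0), show (∫ x, φ x * w t x) - ∫ x, φ x * w 0 x = a t - a 0 from rfl,
    hfin, ← intervalIntegral.integral_neg]
  refine intervalIntegral.integral_congr_ae ?_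
  filter_upwards [hsec] with r hr hrt
  rw [uIoc_of_le ht.1] at hrt
  have hr' := hr ⟨hrt.1.le, hrt.2.trans ht.2⟩
  simp only [hcc]
  rw [integral_deriv_mul_deriv_eq hφ hφc (hd r) (fun x => (hr' x).1) (fun x => (hr' x).2), neg_neg]

lemma IsStrongSolution.exists_isIntegratedSolution {T : ℝ} {u : ℝ → ℝ → ℝ}
    (hu : IsStrongSolution T u) {τ : ℝ} (hτ : 0 < τ) (hτT : τ < T) :
    ∃ (g : ℝ → ℝ) (w : ℝ → ℝ → ℝ), IsIntegratedSolution τ g w ∧ ∀ t ∈ Icc 0 τ, w t = u t := by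
  obtain ⟨⟨M, hM⟩, g, hg, hgs⟩ := hu.2 τ hτ hτT
  have hproj : ∀ t, (projIcc 0 τ hτ.le t : ℝ) ∈ Icc 0 τ := fun t => (projIcc 0 τ hτ.le t).2
  have hproj' : ∀ t, (projIcc 0 τ hτ.le t : ℝ) ∈ Ico 0 T := fun t =>
    ⟨(hproj t).1, (hproj t).2.trans_lt hτT⟩
  have hpc : Continuous fun s : ℝ => (projIcc 0 τ hτ.le s : ℝ) :=
    continuous_subtype_val.comp continuous_projIcc
  set w : ℝ → ℝ → ℝ := fun t => u (projIcc 0 τ hτ.le t) with hw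
  have hwu : ∀ t ∈ Icc 0 τ, w t = u t := fun t ht => by simp only [hw, projIcc_of_mem hτ.le ht]
  have hmap : Continuous fun p : ℝ × ℝ => ((projIcc 0 τ hτ.le p.1 : ℝ), p.2) :=
    (hpc.comp continuous_fst).prodMk continuous_snd
  have hc : Continuous (Function.uncurry w) :=
    hu.1.2.1.1.comp_continuous hmap fun p => ⟨hproj' p.1, mem_univ _⟩
  have hcd : Continuous fun p : ℝ × ℝ => deriv (w p.1) p.2 :=
    hu.continuousOn_deriv.comp_continuous hmap fun p => ⟨hproj' p.1, mem_univ _⟩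
  have hd : ∀ t, Differentiable ℝ (w t) := fun t => (hu.differentiable (hproj' t)).1
  have hn : ∀ t x, 0 ≤ w t x := fun t x => hu.1.1 _ (hproj' t) x
  have hMw : ∀ t x, w t x ≤ M * (x ^ 2 + 1) := fun t x => hM _ (hproj t) x
  have hM0 : 0 ≤ M := by simpa using (hn 0 0).trans (hMw 0 0)
  set g' : ℝ → ℝ := (Icc 0 τ).indicator fun t => |g t| with hg'
  have hg'i : Integrable g' := (integrable_indicator_iff measurableSet_Icc).2 hg.abs
  have hsec : ∀ᵐ t, t ∈ Icc 0 τ → ∀ x, DifferentiableAt ℝ (deriv (w t)) x ∧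
      |deriv (deriv (w t)) x| ≤ g' t := by
    rw [ae_restrict_iff' measurableSet_Ioc] at hgs
    filter_upwards [hgs, Measure.ae_ne volume (0:ℝ)] with t ht ht0 htI x
    rw [hwu t htI]
    have h := ht ⟨lt_of_le_of_ne htI.1 (Ne.symm ht0), htI.2⟩
    refine ⟨(h.1 x).2, ?_⟩
    simp only [hg', indicator_of_mem htI]
    exact (h.2 x).trans (le_abs_self _)
  refine ⟨g', w, ⟨hc, hd, hcd, hn, ⟨M, hM0, hMw⟩, hg'i, ?_, hsec, ?_⟩, hwu⟩
  · intro t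
    exact indicator_nonneg (fun _ _ => abs_nonneg _) t
  · refine evol_of_tested hτ hc hcd hn hMw hg'i ?_ ?_
    · filter_upwards [hsec] with t ht htI x using (ht htI x).2
    · intro φ hφ hφc t ht
      exact hu.tested hτ hτT hwu hc hd hcd hsec hφ hφc ht

lemma AbsolutelyContinuousOnInterval.of_abs_sub_le {f h : ℝ → ℝ} {a b L : ℝ}
    (hf : AbsolutelyContinuousOnInterval f a b)
    (hh : ∀ x ∈ uIcc a b, ∀ y ∈ uIcc a b, |h x - h y| ≤ L * |f x - f y|) :
    AbsolutelyContinuousOnInterval h a b := by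
  have h2 := hf.const_mul (|L|)
  rw [absolutelyContinuousOnInterval_iff] at h2 ⊢
  intro ε hε
  obtain ⟨δ, hδ, H⟩ := h2 ε hε
  refine ⟨δ, hδ, fun E hE hEδ => lt_of_le_of_lt (Finset.sum_le_sum fun i hi => ?_) (H E hE hEδ)⟩
  have := hE.1 i hi
  rw [Real.dist_eq, Real.dist_eq, ← mul_sub, abs_mul, abs_abs]
  exact (hh _ this.1 _ this.2).trans (mul_le_mul_of_nonneg_right (le_abs_self _) (abs_nonneg _))

lemma AbsolutelyContinuousOnInterval.sub_eq_integral {f f' : ℝ → ℝ} {a b : ℝ}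
    (hf : AbsolutelyContinuousOnInterval f a b)
    (hd : ∀ᵐ t, t ∈ uIcc a b → HasDerivAt f (f' t) t) : f b - f a = ∫ t in a..b, f' t := by
  rw [← hf.integral_deriv_eq_sub]
  refine intervalIntegral.integral_congr_ae ?_
  filter_upwards [hd] with t ht hts
  exact (ht (uIoc_subset_uIcc hts)).deriv

lemma absolutelyContinuous_of_integral {f k : ℝ → ℝ} {τ c : ℝ} (hτ : 0 ≤ τ)
    (hk : IntegrableOn k (Icc 0 τ)) (hf : ∀ t ∈ Icc 0 τ, f t = c + ∫ r in (0:ℝ)..t, k r) :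
    AbsolutelyContinuousOnInterval f 0 τ ∧ ∀ᵐ t, t ∈ Icc 0 τ → HasDerivAt f (k t) t := by
  have hki : IntervalIntegrable k volume 0 τ := by
    rw [intervalIntegrable_iff_integrableOn_Icc_of_le hτ]
    exact hk
  have hac := hki.absolutelyContinuousOnInterval_intervalIntegral (c := 0) (by simp)
  constructor
  · refine hac.of_abs_sub_le (L := 1) ?_
    intro x hx y hy
    rw [uIcc_of_le hτ] at hx hy
    rw [hf x hx, hf y hy]
    simp
  · filter_upwards [hki.ae_hasDerivAt_integral, Measure.ae_ne volume (0:ℝ),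
      Measure.ae_ne volume τ] with t ht h0 h1 htI
    have h2 := (ht (by rwa [uIcc_of_le hτ]) 0 (by simp)).const_add c
    refine h2.congr_of_eventuallyEq ?_
    filter_upwards [Icc_mem_nhds (lt_of_le_of_ne htI.1 (Ne.symm h0)) (lt_of_le_of_ne htI.2 h1)]
      with s hs using hf s hs

namespace IsIntegratedSolution

variable {τ : ℝ} {g : ℝ → ℝ} {u : ℝ → ℝ → ℝ}

lemma measurable_second (hu : IsIntegratedSolution τ g u) :
    Measurable fun p : ℝ × ℝ => deriv (deriv (u p.1)) p.2 :=
  measurable_deriv_deriv hu.continuous_deriv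

lemma integrableOn_second (hu : IsIntegratedSolution τ g u) (x : ℝ) :
    IntegrableOn (fun r => deriv (deriv (u r)) x) (Icc 0 τ) := by
  refine Integrable.mono (g := g) hu.integrable.restrict ?_ ?_
  · exact (hu.measurable_second.comp measurable_prodMk_right).aestronglyMeasurable
  · rw [ae_restrict_iff' measurableSet_Icc]
    filter_upwards [hu.second] with t ht htI
    exact ((ht htI x).2.trans (le_abs_self _))

lemma integrableOn_rhs (hu : IsIntegratedSolution τ g u) (x : ℝ) :
    IntegrableOn (fun r => 1 / 2 * u r x * deriv (deriv (u r)) x) (Icc 0 τ) := by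
  obtain ⟨M, hM0, hM⟩ := hu.quad
  have hc : Continuous fun r => u r x := hu.continuous.comp (Continuous.prodMk_left x)
  refine Integrable.bdd_mul (c := 1 / 2 * (M * (x ^ 2 + 1))) (hu.integrableOn_second x)
    (by fun_prop) (Eventually.of_forall fun r => ?_)
  rw [Real.norm_eq_abs, abs_of_nonneg (mul_nonneg (by norm_num) (hu.nonneg _ _))]
  exact mul_le_mul_of_nonneg_left (hM _ _) (by norm_num)

lemma intervalIntegrable_second (hu : IsIntegratedSolution τ g u) (x : ℝ) {s t : ℝ}
    (hs : s ∈ Icc 0 τ) (ht : t ∈ Icc 0 τ) :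
    IntervalIntegrable (fun r => 1 / 2 * deriv (deriv (u r)) x) volume s t :=
  (IntegrableOn.mono_set (Integrable.const_mul (hu.integrableOn_second x) (1 / 2))
    (uIcc_subset_Icc hs ht)).intervalIntegrable

lemma ae_ac (hu : IsIntegratedSolution τ g u) (hτ : 0 ≤ τ) :
    ∀ᵐ x, AbsolutelyContinuousOnInterval (fun s => u s x) 0 τ ∧
      ∀ᵐ t, t ∈ Icc 0 τ → HasDerivAt (fun s => u s x)
        (1 / 2 * u t x * deriv (deriv (u t)) x) t := by
  filter_upwards [hu.evol] with x hx
  exact absolutelyContinuous_of_integral hτ (hu.integrableOn_rhs x) hx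

lemma ae_hasDerivAt (hu : IsIntegratedSolution τ g u) (hτ : 0 ≤ τ) :
    ∀ᵐ p : ℝ × ℝ, p.1 ∈ Icc 0 τ → HasDerivAt (fun s => u s p.2)
        (1 / 2 * u p.1 p.2 * deriv (deriv (u p.1)) p.2) p.1 := by
  have h1 : ∀ᵐ x, ∀ᵐ t, t ∈ Icc 0 τ → (DifferentiableAt ℝ (fun s => u s x) t ∧
      deriv (fun s => u s x) t = 1 / 2 * u t x * deriv (deriv (u t)) x) := by
    filter_upwards [hu.ae_ac hτ] with x hx
    filter_upwards [hx.2] with t ht htI using ⟨(ht htI).differentiableAt, (ht htI).deriv⟩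
  have hsw : Continuous (Function.uncurry fun x s => u s x) :=
    hu.continuous.comp continuous_swap
  have hcm : Measurable fun p : ℝ × ℝ => u p.2 p.1 := hsw.measurable
  have hm : MeasurableSet {p : ℝ × ℝ | p.2 ∈ Icc 0 τ →
      (DifferentiableAt ℝ (fun s => u s p.1) p.2 ∧
      deriv (fun s => u s p.1) p.2 = 1 / 2 * u p.2 p.1 * deriv (deriv (u p.2)) p.1)} := by
    refine MeasurableSet.imp (measurable_snd measurableSet_Icc) (MeasurableSet.inter ?_ ?_)
    · exact measurableSet_of_differentiableAt_with_param ℝ hsw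
    · exact measurableSet_eq_fun (measurable_deriv_with_param hsw)
        ((hcm.const_mul _).mul (hu.measurable_second.comp measurable_swap))
  have h2 := (Measure.ae_prod_iff_ae_ae (μ := volume) (ν := volume) hm).2 h1
  have h3 := (Measure.measurePreserving_swap (μ := (volume : Measure ℝ))
    (ν := (volume : Measure ℝ))).quasiMeasurePreserving.ae h2
  filter_upwards [h3] with p hp hpI
  have := hp hpI
  exact this.2 ▸ this.1.hasDerivAt

lemma ae_eq_mul_exp (hu : IsIntegratedSolution τ g u) (hτ : 0 ≤ τ) :
    ∀ᵐ x, ∀ s ∈ Icc 0 τ, ∀ t ∈ Icc 0 τ,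
      u t x = u s x * Real.exp (∫ r in s..t, 1 / 2 * deriv (deriv (u r)) x) := by
  filter_upwards [hu.ae_ac hτ] with x hx
  set A : ℝ → ℝ := fun t => ∫ r in (0:ℝ)..t, 1 / 2 * deriv (deriv (u r)) x with hA
  obtain ⟨hA1, hA2⟩ := absolutelyContinuous_of_integral (f := A) (c := 0) hτ
    ((hu.integrableOn_second x).const_mul (1 / 2)) (fun t _ => by simp [hA])
  obtain ⟨B, hB⟩ := hA1.exists_bound
  have hE : AbsolutelyContinuousOnInterval (fun t => Real.exp (-A t)) 0 τ := by
    refine hA1.of_abs_sub_le (L := Real.exp B) fun s hs t ht => ?_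
    have hconv : Convex ℝ (Iic B) := convex_Iic B
    have h := hconv.norm_image_sub_le_of_norm_deriv_le (f := Real.exp) (C := Real.exp B)
      (x := - A t) (y := - A s) (fun y _ => Real.differentiable_exp y) (fun y hy => by
        rw [Real.deriv_exp, Real.norm_eq_abs, Real.abs_exp]; exact Real.exp_le_exp.2 hy)
      ((neg_le_abs _).trans (hB t ht)) ((neg_le_abs _).trans (hB s hs))
    rw [Real.norm_eq_abs, Real.norm_eq_abs] at h
    rwa [show - A s - - A t = -(A s - A t) by ring, abs_neg] at h
  obtain ⟨C, hC⟩ := (hx.1.fun_mul hE).const_of_ae_hasDerivAt_zero (by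
    filter_upwards [hx.2, hA2] with t h1 h2 htI
    rw [uIcc_of_le hτ] at htI
    exact ((h1 htI).fun_mul (h2 htI).fun_neg.exp).congr_deriv (by ring))
  rw [uIcc_of_le hτ] at hC
  intro s hs t ht
  have e1 := hC s hs
  have e2 := hC t ht
  have h0 : (0:ℝ) ∈ Icc 0 τ := ⟨le_rfl, hτ⟩
  have e3 : ∫ r in s..t, 1 / 2 * deriv (deriv (u r)) x = A t - A s :=
    (intervalIntegral.integral_interval_sub_left (hu.intervalIntegrable_second x h0 ht)
      (hu.intervalIntegrable_second x h0 hs)).symm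
  rw [e3, Real.exp_sub]
  have e4 : u t x * Real.exp (- A t) = u s x * Real.exp (- A s) := by rw [e1, e2]
  rw [Real.exp_neg, Real.exp_neg] at e4
  have := Real.exp_pos (A t)
  have := Real.exp_pos (A s)
  field_simp at e4 ⊢
  linarith

lemma abs_integral_second_le (hu : IsIntegratedSolution τ g u) (x : ℝ) {s t : ℝ}
    (hs : s ∈ Icc 0 τ) (ht : t ∈ Icc 0 τ) (hst : s ≤ t) :
    |∫ r in s..t, 1 / 2 * deriv (deriv (u r)) x| ≤ 1 / 2 * ∫ r in s..t, g r := by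
  rw [← intervalIntegral.integral_const_mul, ← Real.norm_eq_abs]
  refine intervalIntegral.norm_integral_le_of_norm_le hst ?_
    (hu.integrable.const_mul _).intervalIntegrable
  filter_upwards [hu.second] with r hr hrI
  rw [norm_mul, Real.norm_eq_abs, Real.norm_eq_abs, abs_of_pos (by norm_num : (0:ℝ) < 1 / 2)]
  exact mul_le_mul_of_nonneg_left (hr ⟨hs.1.trans hrI.1.le, hrI.2.trans ht.2⟩ x).2 (by norm_num)

lemma le_mul_exp (hu : IsIntegratedSolution τ g u) {s t : ℝ}
    (hs : s ∈ Icc 0 τ) (ht : t ∈ Icc 0 τ) (hst : s ≤ t) (x : ℝ) :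
    u t x ≤ u s x * Real.exp (1 / 2 * ∫ r in s..t, g r) ∧
    u s x ≤ u t x * Real.exp (1 / 2 * ∫ r in s..t, g r) := by
  have hτ : 0 ≤ τ := hs.1.trans hs.2
  have hd := Measure.dense_of_ae (hu.ae_eq_mul_exp hτ)
  have hcx := fun t => (hu.differentiable t).continuous
  have hcl : IsClosed {x | u t x ≤ u s x * Real.exp (1 / 2 * ∫ r in s..t, g r) ∧
      u s x ≤ u t x * Real.exp (1 / 2 * ∫ r in s..t, g r)} :=
    (isClosed_le (hcx t) ((hcx s).mul_const _)).inter
      (isClosed_le (hcx s) ((hcx t).mul_const _))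
  refine (closure_minimal ?_ hcl) (hd x)
  intro y hy
  have h := hu.abs_integral_second_le y hs ht hst
  constructor
  · rw [hy s hs t ht]
    exact mul_le_mul_of_nonneg_left (Real.exp_le_exp.2 ((le_abs_self _).trans h)) (hu.nonneg _ _)
  · rw [hy t ht s hs]
    refine mul_le_mul_of_nonneg_left (Real.exp_le_exp.2 ?_) (hu.nonneg _ _)
    rw [intervalIntegral.integral_symm]
    exact (neg_le_abs _).trans h

lemma pos_of_pos (hu : IsIntegratedSolution τ g u) {s t x : ℝ}
    (hs : s ∈ Icc 0 τ) (ht : t ∈ Icc 0 τ) (h : 0 < u s x) : 0 < u t x := by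
  rcases le_total s t with hst | hst
  · have := (hu.le_mul_exp hs ht hst x).2
    exact pos_of_mul_pos_left (h.trans_le this) (Real.exp_pos _).le
  · have := (hu.le_mul_exp ht hs hst x).1
    exact pos_of_mul_pos_left (h.trans_le this) (Real.exp_pos _).le

/-- Time shift and scaling `u ↦ μ u(s + μ t, x)` of a solution. -/
lemma scale (hu : IsIntegratedSolution τ g u) {s μ τ' : ℝ} (hs : 0 ≤ s) (hμ : 0 < μ)
    (hτ' : 0 ≤ τ') (h : s + μ * τ' ≤ τ) :
    IsIntegratedSolution τ' (fun t => μ * g (s + μ * t)) (fun t x => μ * u (s + μ * t) x) := by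
  have hderiv : ∀ t, deriv (fun x => μ * u (s + μ * t) x) =
      fun x => μ * deriv (u (s + μ * t)) x := fun t => by
    ext x; exact deriv_const_mul _ (hu.differentiable _ x)
  have hderiv2 : ∀ t x, deriv (fun x => μ * deriv (u (s + μ * t)) x) x =
      μ * deriv (deriv (u (s + μ * t))) x := fun t x => deriv_const_mul_field μ
  have hmap : Continuous fun p : ℝ × ℝ => (s + μ * p.1, p.2) := by fun_prop
  have hmem : ∀ t ∈ Icc 0 τ', s + μ * t ∈ Icc 0 τ := fun t ht =>
    ⟨by have := ht.1; positivity,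
      (add_le_add_right (mul_le_mul_of_nonneg_left ht.2 hμ.le) s).trans h⟩
  have hq : Measure.QuasiMeasurePreserving (fun t : ℝ => s + μ * t) := by
    have := ((measurePreserving_add_left volume s).quasiMeasurePreserving).comp
      (Measure.quasiMeasurePreserving_smul (volume : Measure ℝ) hμ.ne')
    exact this
  obtain ⟨M, hM0, hM⟩ := hu.quad
  refine ⟨continuous_const.mul (hu.continuous.comp hmap), fun t => ?_, ?_, fun t x => ?_,
    ⟨μ * M, by positivity, fun t x => ?_⟩, ?_, fun t => ?_, ?_, ?_⟩
  · exact (hu.differentiable _).const_mul _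
  · simp only [hderiv]
    exact continuous_const.mul (hu.continuous_deriv.comp hmap)
  · exact mul_nonneg hμ.le (hu.nonneg _ _)
  · rw [mul_assoc]
    exact mul_le_mul_of_nonneg_left (hM _ _) hμ.le
  · exact ((hu.integrable.comp_add_left s).comp_mul_left' hμ.ne').const_mul _
  · exact mul_nonneg hμ.le (hu.g_nonneg _)
  · filter_upwards [hq.ae hu.second] with t ht htI x
    have := ht (hmem t htI) x
    simp only [hderiv, hderiv2]
    refine ⟨this.1.const_mul _, ?_⟩
    rw [abs_mul, abs_of_pos hμ]
    exact mul_le_mul_of_nonneg_left this.2 hμ.le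
  · filter_upwards [hu.evol] with x hx t ht
    have h0 : (0:ℝ) ∈ Icc 0 τ' := ⟨le_rfl, hτ'⟩
    have e1 := hx _ (hmem t ht)
    have e2 := hx _ (hmem 0 h0)
    simp only [hderiv, hderiv2]
    set q := fun r => 1 / 2 * u r x * deriv (deriv (u r)) x with hqd
    have hi : ∀ a ∈ Icc 0 τ, ∀ b ∈ Icc 0 τ, IntervalIntegrable q volume a b := fun a ha b hb =>
      ((hu.integrableOn_rhs x).mono_set (uIcc_subset_Icc ha hb)).intervalIntegrable
    have hτ0 : (0:ℝ) ∈ Icc 0 τ := ⟨le_rfl, (hmem 0 h0).1.trans (hmem 0 h0).2⟩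
    have e3 : ∫ r in (0:ℝ)..t, 1 / 2 * (μ * u (s + μ * r) x) *
        (μ * deriv (deriv (u (s + μ * r))) x) = ∫ r in (0:ℝ)..t, (μ * μ) * q (s + μ * r) := by
      congr 1; ext r; simp only [hqd]; ring
    rw [e3, intervalIntegral.integral_const_mul,
      intervalIntegral.integral_comp_add_mul q hμ.ne', e1, e2,
      ← intervalIntegral.integral_interval_sub_left (hi 0 hτ0 _ (hmem t ht))
        (hi 0 hτ0 _ (hmem 0 h0)), smul_eq_mul]
    field_simp
    ring

end IsIntegratedSolution

lemma integrable_of_abs_le_inv_one_add_sq {h : ℝ → ℝ} {C : ℝ}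
    (hm : AEStronglyMeasurable h volume) (hb : ∀ x, |h x| ≤ C * (1 + x ^ 2)⁻¹) :
    Integrable h :=
  (integrable_inv_one_add_sq.const_mul C).mono' hm (Eventually.of_forall hb)

lemma sq_deriv_le_of_abs_deriv_le {v : ℝ → ℝ} {B : ℝ} (hv : Differentiable ℝ v)
    (hB : ∀ x, |deriv v x| ≤ B) :
    ∃ D, 0 ≤ D ∧ ∀ x, v x ^ 2 ≤ D * (1 + x ^ 2) := by
  have hB0 : 0 ≤ B := (abs_nonneg _).trans (hB 0)
  refine ⟨2 * ((v 0) ^ 2 + B ^ 2), by positivity, fun x => ?_⟩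
  have h := convex_univ.norm_image_sub_le_of_norm_deriv_le (f := v) (C := B)
    (fun y _ => hv y) (fun y _ => hB y) (mem_univ 0) (mem_univ x)
  rw [sub_zero, Real.norm_eq_abs, Real.norm_eq_abs] at h
  have h2 : (v x - v 0) ^ 2 ≤ B ^ 2 * x ^ 2 := by
    rw [← sq_abs (v x - v 0), ← sq_abs x, ← mul_pow]
    exact pow_le_pow_left₀ (abs_nonneg _) h 2
  nlinarith [sq_nonneg (v x - 2 * v 0), sq_nonneg (B), sq_nonneg (v 0 * x)]

lemma hasDerivAt_inv_one_add_sq (x : ℝ) :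
    HasDerivAt (fun x : ℝ => (1 + x ^ 2)⁻¹) (-2 * x * ((1 + x ^ 2)⁻¹) ^ 2) x := by
  have h : HasDerivAt (fun x : ℝ => 1 + x ^ 2) (2 * x) x := by
    simpa using (hasDerivAt_pow 2 x).const_add 1
  refine (h.fun_inv (by positivity)).congr_deriv ?_
  rw [inv_pow, div_eq_mul_inv]
  ring

lemma integral_step_mul_second_le {f ρ : ℝ → ℝ} {B M C : ℝ} (hf : Differentiable ℝ f)
    (hf' : Differentiable ℝ (deriv f)) (hB : ∀ x, |deriv (deriv f) x| ≤ B)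
    (hM : ∀ x, |f x| ≤ M * (1 + x ^ 2)) (hρ : ContDiff ℝ 1 ρ) (h0 : ∀ s, 0 ≤ ρ s)
    (h1 : ∀ s, ρ s ≤ 1) (hneg : ∀ s ≤ 0, ρ s = 0) (hd0 : ∀ s, 0 ≤ deriv ρ s)
    (hdC : ∀ s, deriv ρ s ≤ C) :
    ∫ x, ρ (f x) * ((1 + x ^ 2)⁻¹) ^ 2 * deriv (deriv f) x ≤
      20 * ∫ x, ((1 + x ^ 2)⁻¹) ^ 3 * max (f x) 0 := by
  have hC0 : 0 ≤ C := (hd0 0).trans (hdC 0)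
  obtain ⟨D, hD0, hD⟩ := sq_deriv_le_of_abs_deriv_le hf' hB
  have hM0 : 0 ≤ M := by simpa using (abs_nonneg _).trans (hM 0)
  have hB0 : 0 ≤ B := (abs_nonneg _).trans (hB 0)
  set w : ℝ → ℝ := fun x => (1 + x ^ 2)⁻¹ with hw
  have hwd : ∀ x, HasDerivAt w (-2 * x * w x ^ 2) x := hasDerivAt_inv_one_add_sq
  have hw0 : ∀ x, 0 < w x := fun x => by simp only [hw]; positivity
  have hwy : ∀ x, (1 + x ^ 2) * w x = 1 := fun x => by
    simp only [hw]; exact mul_inv_cancel₀ (by positivity)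
  have hw1 : ∀ x, w x ≤ 1 := fun x => by nlinarith [hwy x, hw0 x, mul_nonneg (sq_nonneg x) (hw0 x).le]
  have hxw : ∀ x, x ^ 2 * w x ≤ 1 := fun x => by nlinarith [hwy x, hw0 x]
  have hxw1 : ∀ x, |x| * w x ≤ 1 := fun x => by
    nlinarith [hwy x, hw0 x, mul_nonneg (sq_nonneg (|x| - 1)) (hw0 x).le, sq_abs x,
      mul_nonneg (abs_nonneg x) (hw0 x).le]
  have a1 : ∀ x, deriv f x ^ 2 * w x ≤ D := fun x => by
    have := mul_le_mul_of_nonneg_right (hD x) (hw0 x).le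
    rwa [mul_assoc, hwy, mul_one] at this
  have a2 : ∀ x, |x| * |deriv f x| * w x ≤ D + 1 := fun x => by
    have h2 : |x| * |deriv f x| ≤ x ^ 2 + deriv f x ^ 2 := by
      rw [← sq_abs x, ← sq_abs (deriv f x)]
      nlinarith [sq_nonneg (|x| - |deriv f x|), sq_nonneg (|x|), sq_nonneg (|deriv f x|)]
    nlinarith [mul_le_mul_of_nonneg_right h2 (hw0 x).le, a1 x, hxw x]
  have a3 : ∀ x, |deriv f x| * w x ≤ D + 1 := fun x => by
    have h2 : |deriv f x| ≤ 1 + deriv f x ^ 2 := by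
      rw [← sq_abs (deriv f x)]; nlinarith [sq_nonneg (|deriv f x| - 1)]
    nlinarith [mul_le_mul_of_nonneg_right h2 (hw0 x).le, a1 x, hw1 x]
  have a4 : ∀ x, |f x| * w x ≤ M := fun x => by
    have := mul_le_mul_of_nonneg_right (hM x) (hw0 x).le
    rwa [mul_assoc, hwy, mul_one] at this
  have cw : Continuous w := continuous_iff_continuousAt.2 fun x => (hwd x).continuousAt
  have cf := hf.continuous
  have cf' := hf'.continuous
  have cρ := hρ.continuous
  have cρ' : Continuous (deriv ρ) := hρ.continuous_deriv le_rfl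
  have hρd : ∀ s, HasDerivAt ρ (deriv ρ s) s := fun s =>
    (hρ.differentiable (by simp) s).hasDerivAt
  set R : ℝ → ℝ := fun s => ∫ y in (0:ℝ)..s, ρ y with hR
  have hRd : ∀ s, HasDerivAt R (ρ s) s := fun s =>
    intervalIntegral.integral_hasDerivAt_right (cρ.intervalIntegrable _ _)
      (cρ.stronglyMeasurableAtFilter _ _) cρ.continuousAt
  have cR : Continuous R := continuous_iff_continuousAt.2 fun x => (hRd x).continuousAt
  have hRle : ∀ s, 0 ≤ R s ∧ R s ≤ max s 0 := by
    intro s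
    rcases le_total 0 s with hs | hs
    · constructor
      · exact intervalIntegral.integral_nonneg hs fun y _ => h0 y
      · have := intervalIntegral.integral_mono_on (μ := volume) hs (cρ.intervalIntegrable 0 s)
          (continuous_const.intervalIntegrable (μ := volume) (0:ℝ) s) (fun y _ => h1 y)
        simp only [intervalIntegral.integral_const, sub_zero, smul_eq_mul, mul_one] at this
        exact this.trans (le_max_left _ _)
    · have : R s = 0 := by
        simp only [hR]
        rw [intervalIntegral.integral_symm, neg_eq_zero]
        refine intervalIntegral.integral_zero_ae (Eventually.of_forall fun y hy => ?_)
        rw [uIoc_of_le hs] at hy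
        exact hneg y hy.2
      rw [this]
      exact ⟨le_rfl, le_max_right _ _⟩
  have hRabs : ∀ s, |R s| ≤ |s| := fun s => by
    rw [abs_of_nonneg (hRle s).1]
    exact (hRle s).2.trans (max_le (le_abs_self _) (abs_nonneg _))
  have hρabs : ∀ s, |ρ s| ≤ 1 := fun s => by rw [abs_of_nonneg (h0 s)]; exact h1 s
  have m2 : AEStronglyMeasurable (deriv (deriv f)) volume :=
    (measurable_deriv (deriv f)).aestronglyMeasurable
  have habsw : ∀ x, |w x| = w x := fun x => abs_of_pos (hw0 x)
  have k1 : Integrable fun x => ρ (f x) * w x ^ 2 * deriv (deriv f) x := by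
    refine integrable_of_abs_le_inv_one_add_sq (C := B)
      ((by fun_prop : Continuous fun x => ρ (f x) * w x ^ 2).aestronglyMeasurable.mul m2)
      fun x => ?_
    rw [abs_mul, abs_mul, abs_pow, habsw]
    calc |ρ (f x)| * w x ^ 2 * |deriv (deriv f) x| ≤ 1 * w x ^ 2 * B := by
          gcongr
          · exact hρabs _
          · exact hB x
      _ ≤ B * w x := by nlinarith [mul_le_mul_of_nonneg_left (hw1 x) (mul_nonneg hB0 (hw0 x).le)]
  have k2 : Integrable fun x => deriv ρ (f x) * deriv f x * w x ^ 2 * deriv f x := by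
    refine integrable_of_abs_le_inv_one_add_sq (C := C * D)
      (by fun_prop : Continuous fun x => deriv ρ (f x) * deriv f x * w x ^ 2 *
        deriv f x).aestronglyMeasurable fun x => ?_
    rw [show deriv ρ (f x) * deriv f x * w x ^ 2 * deriv f x =
      deriv ρ (f x) * (deriv f x ^ 2 * w x) * w x by ring, abs_of_nonneg (by
        have := hd0 (f x); have := (hw0 x).le; positivity)]
    refine mul_le_mul_of_nonneg_right ?_ (hw0 x).le
    exact mul_le_mul (hdC _) (a1 x) (mul_nonneg (sq_nonneg _) (hw0 x).le) hC0
  have k3 : Integrable fun x => ρ (f x) * (-4 * x * w x ^ 3) * deriv f x := by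
    refine integrable_of_abs_le_inv_one_add_sq (C := 4 * (D + 1))
      (by fun_prop : Continuous fun x => ρ (f x) * (-4 * x * w x ^ 3) *
        deriv f x).aestronglyMeasurable fun x => ?_
    have e : |ρ (f x) * (-4 * x * w x ^ 3) * deriv f x| =
        4 * |ρ (f x)| * (|x| * |deriv f x| * w x) * w x * w x := by
      simp only [abs_mul, abs_pow, habsw, abs_neg]
      rw [abs_of_pos (by norm_num : (0:ℝ) < 4)]
      ring
    rw [e]
    have hp : 0 ≤ |x| * |deriv f x| * w x :=
      mul_nonneg (mul_nonneg (abs_nonneg _) (abs_nonneg _)) (hw0 x).le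
    have hww := hw0 x
    calc _ ≤ 4 * 1 * (D + 1) * 1 * w x := by
          gcongr
          · exact hρabs _
          · exact a2 x
          · exact hw1 x
      _ = _ := by ring
  have k4 : Integrable fun x => ρ (f x) * w x ^ 2 * deriv f x := by
    refine integrable_of_abs_le_inv_one_add_sq (C := D + 1)
      (by fun_prop : Continuous fun x => ρ (f x) * w x ^ 2 *
        deriv f x).aestronglyMeasurable fun x => ?_
    have e : |ρ (f x) * w x ^ 2 * deriv f x| = |ρ (f x)| * (|deriv f x| * w x) * w x := by
      simp only [abs_mul, abs_pow, habsw]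
      ring
    rw [e]
    have hww := hw0 x
    calc _ ≤ 1 * (D + 1) * w x := by
          gcongr
          · exact hρabs _
          · exact a3 x
      _ = _ := by ring
  have k5 : Integrable fun x => (-4 * w x ^ 3 + 24 * x ^ 2 * w x ^ 4) * R (f x) := by
    refine integrable_of_abs_le_inv_one_add_sq (C := 28 * M)
      (by fun_prop : Continuous fun x => (-4 * w x ^ 3 + 24 * x ^ 2 * w x ^ 4) *
        R (f x)).aestronglyMeasurable fun x => ?_
    have hww := hw0 x
    have hww1 := hw1 x
    have e : |-4 * w x ^ 3 + 24 * x ^ 2 * w x ^ 4| ≤ 28 * w x ^ 3 := by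
      have := mul_le_mul_of_nonneg_right (hxw x) (pow_pos hww 3).le
      have := mul_nonneg (sq_nonneg x) (pow_pos hww 4).le
      have := pow_pos hww 3
      rw [abs_le]
      constructor <;> nlinarith
    rw [abs_mul]
    calc _ ≤ 28 * w x ^ 3 * |f x| := by
          exact mul_le_mul e (hRabs _) (abs_nonneg _) (by positivity)
      _ = 28 * (|f x| * w x) * w x * w x := by ring
      _ ≤ 28 * M * 1 * w x := by
          gcongr
          exact a4 x
      _ = _ := by ring
  have k6 : Integrable fun x => (-4 * x * w x ^ 3) * R (f x) := by
    refine integrable_of_abs_le_inv_one_add_sq (C := 4 * M)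
      (by fun_prop : Continuous fun x => (-4 * x * w x ^ 3) *
        R (f x)).aestronglyMeasurable fun x => ?_
    have hww := hw0 x
    have e : |(-4 * x * w x ^ 3) * R (f x)| = 4 * (|x| * w x) * |R (f x)| * w x * w x := by
      simp only [abs_mul, abs_pow, habsw, abs_neg]
      rw [abs_of_pos (by norm_num : (0:ℝ) < 4)]
      ring
    rw [e]
    calc _ ≤ 4 * 1 * |f x| * w x * w x := by
          refine mul_le_mul_of_nonneg_right (mul_le_mul_of_nonneg_right (mul_le_mul
            (mul_le_mul_of_nonneg_left (hxw1 x) (by norm_num)) (hRabs _) (abs_nonneg _)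
            (by norm_num)) hww.le) hww.le
      _ = 4 * (|f x| * w x) * w x := by ring
      _ ≤ 4 * M * w x := by
          gcongr
          exact a4 x
      _ = _ := by ring
  have k7 : Integrable fun x => w x ^ 3 * max (f x) 0 := by
    refine integrable_of_abs_le_inv_one_add_sq (C := M)
      (by fun_prop : Continuous fun x => w x ^ 3 * max (f x) 0).aestronglyMeasurable fun x => ?_
    have hww := hw0 x
    have hww1 := hw1 x
    have e : |max (f x) 0| ≤ |f x| := by
      rw [abs_of_nonneg (le_max_right _ _)]
      exact max_le (le_abs_self _) (abs_nonneg _)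
    rw [abs_mul, abs_pow, habsw]
    calc _ ≤ w x ^ 3 * |f x| := by gcongr
      _ = (|f x| * w x) * w x * w x := by ring
      _ ≤ M * 1 * w x := by
          gcongr
          exact a4 x
      _ = _ := by ring
  have i1 := integral_mul_deriv_eq_deriv_mul_of_integrable
    (u := fun x => ρ (f x) * w x ^ 2) (v := deriv f)
    (u' := fun x => deriv ρ (f x) * deriv f x * w x ^ 2 + ρ (f x) * (-4 * x * w x ^ 3))
    (v' := deriv (deriv f))
    (fun x _ => by
      have := ((hρd (f x)).comp x (hf x).hasDerivAt).mul ((hwd x).pow 2)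
      refine this.congr_deriv ?_
      simp only [Function.comp, Pi.pow_apply]
      push_cast
      ring)
    (fun x _ => (hf' x).hasDerivAt) k1
    (by
      refine (k2.add k3).congr (Eventually.of_forall fun x => ?_)
      simp only [Pi.add_apply, Pi.mul_apply]
      ring) k4
  have i2 := integral_mul_deriv_eq_deriv_mul_of_integrable
    (u := fun x => -4 * x * w x ^ 3) (v := fun x => R (f x))
    (u' := fun x => -4 * w x ^ 3 + 24 * x ^ 2 * w x ^ 4)
    (v' := fun x => ρ (f x) * deriv f x)
    (fun x _ => by
      have := ((hasDerivAt_id x).const_mul (-4)).mul ((hwd x).pow 3)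
      refine this.congr_deriv ?_
      simp only [id, Pi.pow_apply]
      push_cast
      ring)
    (fun x _ => (hRd (f x)).comp x (hf x).hasDerivAt)
    (by
      refine k3.congr (Eventually.of_forall fun x => ?_)
      simp only [Pi.mul_apply]
      ring) k5 k6
  rw [i1, ← integral_const_mul]
  have i3 : ∫ x, (deriv ρ (f x) * deriv f x * w x ^ 2 + ρ (f x) * (-4 * x * w x ^ 3)) * deriv f x
      = (∫ x, deriv ρ (f x) * deriv f x * w x ^ 2 * deriv f x) +
        ∫ x, -4 * x * w x ^ 3 * (ρ (f x) * deriv f x) := by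
    rw [← integral_add k2 (k3.congr (Eventually.of_forall fun x => by simp only []; ring))]
    congr 1
    ext x
    ring
  rw [i3, i2, neg_add, neg_neg]
  have i4 : 0 ≤ ∫ x, deriv ρ (f x) * deriv f x * w x ^ 2 * deriv f x := by
    refine integral_nonneg fun x => ?_
    have : deriv ρ (f x) * deriv f x * w x ^ 2 * deriv f x =
      deriv ρ (f x) * (deriv f x * w x) ^ 2 := by ring
    simp only [this]
    exact mul_nonneg (hd0 _) (sq_nonneg _)
  have i5 : ∫ x, (-4 * w x ^ 3 + 24 * x ^ 2 * w x ^ 4) * R (f x) ≤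
      ∫ x, 20 * (w x ^ 3 * max (f x) 0) := by
    refine integral_mono k5 (k7.const_mul _) fun x => ?_
    have hww := hw0 x
    have e : -4 * w x ^ 3 + 24 * x ^ 2 * w x ^ 4 ≤ 20 * w x ^ 3 := by
      nlinarith [mul_le_mul_of_nonneg_right (hxw x) (pow_pos hww 3).le]
    calc _ ≤ 20 * w x ^ 3 * R (f x) := mul_le_mul_of_nonneg_right e (hRle _).1
      _ ≤ 20 * w x ^ 3 * max (f x) 0 := by
          gcongr
          exact (hRle _).2
      _ = _ := by ring
  linarith

lemma exists_deriv_smoothTransition_le : ∃ C, ∀ s, deriv Real.smoothTransition s ≤ C := by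
  have hc : Continuous (deriv Real.smoothTransition) :=
    (Real.smoothTransition.contDiff (n := 1)).continuous_deriv le_rfl
  have hs : HasCompactSupport (deriv Real.smoothTransition) := by
    refine HasCompactSupport.of_support_subset_isCompact (isCompact_Icc (a := (0:ℝ)) (b := 1)) ?_
    intro s hs
    by_contra h
    apply hs
    rw [mem_Icc, not_and_or, not_le, not_le] at h
    rcases h with h | h
    · have : Real.smoothTransition =ᶠ[𝓝 s] fun _ => (0:ℝ) := by
        filter_upwards [Iio_mem_nhds h] with y hy
          using Real.smoothTransition.zero_of_nonpos (le_of_lt hy)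
      rw [this.deriv_eq, deriv_const]
    · have : Real.smoothTransition =ᶠ[𝓝 s] fun _ => (1:ℝ) := by
        filter_upwards [Ioi_mem_nhds h] with y hy
          using Real.smoothTransition.one_of_one_le (le_of_lt hy)
      rw [this.deriv_eq, deriv_const]
  obtain ⟨C, hC⟩ := hc.bounded_above_of_compact_support hs
  exact ⟨C, fun s => (le_abs_self _).trans (hC s)⟩

/-- The Kato inequality for the weight `(1 + x²)⁻²`. -/
lemma integral_indicator_pos_mul_second_le {f : ℝ → ℝ} {B M : ℝ} (hf : Differentiable ℝ f)
    (hf' : Differentiable ℝ (deriv f)) (hB : ∀ x, |deriv (deriv f) x| ≤ B)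
    (hM : ∀ x, |f x| ≤ M * (1 + x ^ 2)) :
    ∫ x, ((1 + x ^ 2)⁻¹) ^ 2 * (if 0 < f x then deriv (deriv f) x else 0) ≤
      20 * ∫ x, ((1 + x ^ 2)⁻¹) ^ 3 * max (f x) 0 := by
  obtain ⟨C, hC⟩ := exists_deriv_smoothTransition_le
  have hB0 : 0 ≤ B := (abs_nonneg _).trans (hB 0)
  set ρ : ℕ → ℝ → ℝ := fun n s => Real.smoothTransition (n * s) with hρ
  have hsd : ∀ s, HasDerivAt Real.smoothTransition (deriv Real.smoothTransition s) s := fun s =>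
    ((Real.smoothTransition.contDiff (n := 1)).differentiable (by simp) s).hasDerivAt
  have hρd : ∀ n s, deriv (ρ n) s = deriv Real.smoothTransition (n * s) * n := fun n s => by
    have h1 : HasDerivAt (fun s : ℝ => (n:ℝ) * s) n s := by
      simpa using (hasDerivAt_id s).const_mul (n:ℝ)
    exact ((hsd _).comp s h1).deriv
  have hcw : Continuous fun x : ℝ => ((1 + x ^ 2)⁻¹) := by
    refine Continuous.inv₀ (by fun_prop) fun x => by positivity
  have hle : ∀ n, ∫ x, ρ n (f x) * ((1 + x ^ 2)⁻¹) ^ 2 * deriv (deriv f) x ≤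
      20 * ∫ x, ((1 + x ^ 2)⁻¹) ^ 3 * max (f x) 0 := by
    intro n
    have hn : (0:ℝ) ≤ n := Nat.cast_nonneg n
    refine integral_step_mul_second_le (C := C * n) hf hf' hB hM
      ((Real.smoothTransition.contDiff (n := 1)).comp (contDiff_const.mul contDiff_id))
      (fun s => Real.smoothTransition.nonneg _) (fun s => Real.smoothTransition.le_one _)
      (fun s hs => Real.smoothTransition.zero_of_nonpos (mul_nonpos_of_nonneg_of_nonpos hn hs))
      (fun s => ?_) (fun s => ?_)
    · rw [hρd]
      exact mul_nonneg Real.smoothTransition.monotone.deriv_nonneg hn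
    · rw [hρd]
      exact mul_le_mul_of_nonneg_right (hC _) hn
  refine le_of_tendsto' (f := fun n => ∫ x, ρ n (f x) * ((1 + x ^ 2)⁻¹) ^ 2 * deriv (deriv f) x)
    (x := atTop) ?_ hle
  refine tendsto_integral_of_dominated_convergence (fun x => B * (1 + x ^ 2)⁻¹) ?_
    (integrable_inv_one_add_sq.const_mul B) ?_ ?_
  · intro n
    have h1 : Continuous fun x => ρ n (f x) * ((1 + x ^ 2)⁻¹) ^ 2 :=
      (Real.smoothTransition.continuous.comp (continuous_const.mul hf.continuous)).mul (hcw.pow 2)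
    exact h1.aestronglyMeasurable.mul (measurable_deriv (deriv f)).aestronglyMeasurable
  · intro n
    refine Eventually.of_forall fun x => ?_
    have hw0 : 0 < (1 + x ^ 2)⁻¹ := by positivity
    have hw1 : (1 + x ^ 2)⁻¹ ≤ 1 := inv_le_one_of_one_le₀ (by nlinarith [sq_nonneg x])
    rw [Real.norm_eq_abs, abs_mul, abs_mul, abs_pow, abs_of_pos hw0,
      abs_of_nonneg (Real.smoothTransition.nonneg _)]
    calc _ ≤ 1 * ((1 + x ^ 2)⁻¹) ^ 2 * B := by
          gcongr
          · exact Real.smoothTransition.le_one _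
          · exact hB x
      _ ≤ _ := by nlinarith [mul_le_mul_of_nonneg_left hw1 (mul_nonneg hB0 hw0.le)]
  · refine Eventually.of_forall fun x => ?_
    rcases le_or_gt (f x) 0 with h | h
    · have : ∀ n, ρ n (f x) = 0 := fun n => Real.smoothTransition.zero_of_nonpos
        (mul_nonpos_of_nonneg_of_nonpos (Nat.cast_nonneg n) h)
      simp [this, h.not_gt]
    · rw [if_pos h]
      have : ∀ᶠ n : ℕ in atTop, ρ n (f x) = 1 := by
        obtain ⟨N, hN⟩ := exists_nat_ge (1 / f x)
        filter_upwards [eventually_ge_atTop N] with n hn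
        refine Real.smoothTransition.one_of_one_le ?_
        have : 1 / f x ≤ n := hN.trans (Nat.cast_le.2 hn)
        rwa [div_le_iff₀ h] at this
      refine tendsto_const_nhds.congr' ?_
      filter_upwards [this] with n hn
      rw [hn, one_mul]

lemma nonpos_of_le_mul_integral {τ L : ℝ} {E : ℝ → ℝ} (hL : 0 < L)
    (hE : ContinuousOn E (Icc 0 τ)) (h : ∀ t ∈ Icc 0 τ, E t ≤ L * ∫ r in (0:ℝ)..t, E r) :
    ∀ t ∈ Icc 0 τ, E t ≤ 0 := by
  intro t ht
  have hc : ContinuousOn (fun t => E t * Real.exp (-(2 * L * t))) (Icc 0 τ) := by fun_prop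
  obtain ⟨s, hs, hmax⟩ := isCompact_Icc.exists_isMaxOn ⟨t, ht⟩ hc
  set m := E s * Real.exp (-(2 * L * s)) with hm
  have hle : ∀ r ∈ Icc 0 τ, E r ≤ m * Real.exp (2 * L * r) := fun r hr => by
    have : E r * Real.exp (-(2 * L * r)) ≤ m := hmax hr
    rw [Real.exp_neg] at this
    rwa [← div_eq_mul_inv, div_le_iff₀ (Real.exp_pos _)] at this
  rcases le_or_gt m 0 with hm0 | hm0
  · exact (hle t ht).trans (mul_nonpos_of_nonpos_of_nonneg hm0 (Real.exp_pos _).le)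
  exfalso
  have h1 : ∫ r in (0:ℝ)..s, E r ≤ ∫ r in (0:ℝ)..s, m * Real.exp (2 * L * r) := by
    refine intervalIntegral.integral_mono_on hs.1 ?_ ?_ fun r hr => hle r ⟨hr.1, hr.2.trans hs.2⟩
    · refine ContinuousOn.intervalIntegrable (hE.mono ?_)
      rw [uIcc_of_le hs.1]
      exact Icc_subset_Icc_right hs.2
    · exact (by fun_prop : Continuous fun r => m * Real.exp (2 * L * r)).intervalIntegrable _ _
  have h2 : ∫ r in (0:ℝ)..s, m * Real.exp (2 * L * r) =
      m / (2 * L) * Real.exp (2 * L * s) - m / (2 * L) * Real.exp (2 * L * 0) := by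
    refine intervalIntegral.integral_eq_sub_of_hasDerivAt
      (f := fun r => m / (2 * L) * Real.exp (2 * L * r)) (fun r _ => ?_) ?_
    · have h3 : HasDerivAt (fun r : ℝ => 2 * L * r) (2 * L) r := by
        simpa using (hasDerivAt_id r).const_mul (2 * L)
      refine (h3.exp.const_mul (m / (2 * L))).congr_deriv ?_
      field_simp
    · exact (by fun_prop : Continuous fun r => m * Real.exp (2 * L * r)).intervalIntegrable _ _
  have h3 := (h s hs).trans (mul_le_mul_of_nonneg_left h1 hL.le)
  rw [h2] at h3
  have h4 : L * (m / (2 * L) * Real.exp (2 * L * s) - m / (2 * L) * Real.exp (2 * L * 0)) =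
      m / 2 * Real.exp (2 * L * s) - m / 2 := by
    rw [mul_zero, Real.exp_zero]; field_simp
  rw [h4] at h3
  have h5 : E s = m * Real.exp (2 * L * s) := by
    rw [hm, mul_assoc, ← Real.exp_add]; simp
  have := Real.exp_pos (2 * L * s)
  nlinarith

namespace IsIntegratedSolution

variable {τ : ℝ} {g₁ g₂ : ℝ → ℝ} {u₁ u₂ : ℝ → ℝ → ℝ}

lemma ae_max_sub_le (h₁ : IsIntegratedSolution τ g₁ u₁) (h₂ : IsIntegratedSolution τ g₂ u₂)
    (hτ : 0 ≤ τ) (h0 : ∀ x, u₁ 0 x ≤ u₂ 0 x) :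
    ∀ᵐ x, ∀ t ∈ Icc 0 τ,
      0 ≤ (∫ r in (0:ℝ)..t, if 0 < u₁ r x - u₂ r x then
        1 / 2 * (deriv (deriv (u₁ r)) x - deriv (deriv (u₂ r)) x) else 0) ∧
      max (u₁ t x - u₂ t x) 0 ≤ u₁ t x * ∫ r in (0:ℝ)..t, if 0 < u₁ r x - u₂ r x then
        1 / 2 * (deriv (deriv (u₁ r)) x - deriv (deriv (u₂ r)) x) else 0 := by
  filter_upwards [h₁.ae_eq_mul_exp hτ, h₂.ae_eq_mul_exp hτ] with x e₁ e₂
  have m0 : (0:ℝ) ∈ Icc 0 τ := ⟨le_rfl, hτ⟩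
  rcases (h₁.nonneg 0 x).eq_or_lt with hz | hpos
  · have hu0 : ∀ t ∈ Icc 0 τ, u₁ t x = 0 := fun t ht => by
      rw [e₁ 0 m0 t ht, ← hz, zero_mul]
    intro t ht
    have hint : ∫ r in (0:ℝ)..t, (if 0 < u₁ r x - u₂ r x then
        1 / 2 * (deriv (deriv (u₁ r)) x - deriv (deriv (u₂ r)) x) else 0) = 0 := by
      refine intervalIntegral.integral_zero_ae (Eventually.of_forall fun r hr => ?_)
      rw [uIoc_of_le ht.1] at hr
      rw [if_neg]
      rw [hu0 r ⟨hr.1.le, hr.2.trans ht.2⟩]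
      simpa using h₂.nonneg r x
    rw [hint, hu0 t ht]
    simpa using h₂.nonneg t x
  · have hpos₂ : 0 < u₂ 0 x := hpos.trans_le (h0 x)
    set k : ℝ → ℝ := fun r => 1 / 2 * deriv (deriv (u₁ r)) x - 1 / 2 * deriv (deriv (u₂ r)) x
      with hk
    set W : ℝ → ℝ := fun t => (Real.log (u₁ 0 x) - Real.log (u₂ 0 x)) +
      ∫ r in (0:ℝ)..t, k r with hW
    have hki : IntegrableOn k (Icc 0 τ) :=
      Integrable.sub (Integrable.const_mul (h₁.integrableOn_second x) (1 / 2))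
        (Integrable.const_mul (h₂.integrableOn_second x) (1 / 2))
    obtain ⟨hac, hder⟩ := absolutelyContinuous_of_integral (f := W) hτ hki fun t _ => rfl
    have hWe : ∀ t ∈ Icc 0 τ, u₁ t x = u₂ t x * Real.exp (W t) := by
      intro t ht
      simp only [hW, hk]
      rw [intervalIntegral.integral_sub (h₁.intervalIntegrable_second x m0 ht)
        (h₂.intervalIntegrable_second x m0 ht), e₁ 0 m0 t ht, e₂ 0 m0 t ht,
        Real.exp_add, Real.exp_sub, Real.exp_sub, Real.exp_log hpos, Real.exp_log hpos₂]
      have := Real.exp_pos (∫ r in (0:ℝ)..t, 1 / 2 * deriv (deriv (u₂ r)) x)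
      field_simp
    have hp₂ : ∀ t ∈ Icc 0 τ, 0 < u₂ t x := fun t ht => h₂.pos_of_pos m0 ht hpos₂
    have hiff : ∀ t ∈ Icc 0 τ, (0 < u₁ t x - u₂ t x ↔ 0 < W t) := by
      intro t ht
      rw [sub_pos, hWe t ht, lt_mul_iff_one_lt_right (hp₂ t ht), Real.one_lt_exp_iff]
    have hW0 : W 0 ≤ 0 := by
      simp only [hW, intervalIntegral.integral_same, add_zero, sub_nonpos]
      exact Real.log_le_log hpos (h0 x)
    have hacp : AbsolutelyContinuousOnInterval (fun t => max (W t) 0) 0 τ :=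
      hac.of_abs_sub_le (L := 1) fun s _ t _ => by
        rw [one_mul]
        exact abs_max_sub_max_le_abs _ _ _
    have hderp : ∀ᵐ t, t ∈ Icc 0 τ → HasDerivAt (fun t => max (W t) 0)
        (if 0 < u₁ t x - u₂ t x then
        1 / 2 * (deriv (deriv (u₁ t)) x - deriv (deriv (u₂ t)) x) else 0) t := by
      filter_upwards [hder, hacp.ae_differentiableAt] with t h1 h2 ht
      have hd := (h2 (by rwa [uIcc_of_le hτ])).hasDerivAt
      by_cases hWt : 0 < W t
      · rw [if_pos ((hiff t ht).2 hWt), mul_sub]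
        refine (h1 ht).congr_of_eventuallyEq ?_
        filter_upwards [(h1 ht).continuousAt.eventually (lt_mem_nhds hWt)] with s hs
        exact max_eq_left (le_of_lt hs)
      · rw [if_neg (mt (hiff t ht).1 hWt)]
        have hmin : IsLocalMin (fun t => max (W t) 0) t := by
          refine Eventually.of_forall fun s => ?_
          simp only [max_eq_right (not_lt.1 hWt)]
          exact le_max_right _ _
        rwa [hmin.hasDerivAt_eq_zero hd] at hd
    intro t ht
    have hV := (hacp.mono (by rw [uIcc_of_le hτ, uIcc_of_le ht.1]; exact Icc_subset_Icc_right ht.2 :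
      uIcc 0 t ⊆ uIcc 0 τ)).sub_eq_integral (by
        filter_upwards [hderp] with r hr hrt
        rw [uIcc_of_le ht.1] at hrt
        exact hr ⟨hrt.1, hrt.2.trans ht.2⟩)
    rw [max_eq_right hW0, sub_zero] at hV
    rw [← hV]
    refine ⟨le_max_right _ _, max_le ?_ (mul_nonneg (h₁.nonneg _ _) (le_max_right _ _))⟩
    have h3 : u₁ t x - u₂ t x ≤ u₁ t x * W t := by
      have h4 : u₂ t x = u₁ t x * Real.exp (- W t) := by
        rw [hWe t ht, mul_assoc, ← Real.exp_add]; simp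
      have h5 := Real.add_one_le_exp (- W t)
      have h6 := h₁.nonneg t x
      rw [h4]
      nlinarith
    exact h3.trans (mul_le_mul_of_nonneg_left (le_max_left _ _) (h₁.nonneg _ _))

theorem comparison (h₁ : IsIntegratedSolution τ g₁ u₁) (h₂ : IsIntegratedSolution τ g₂ u₂)
    (h0 : ∀ x, u₁ 0 x ≤ u₂ 0 x) : ∀ t ∈ Icc 0 τ, ∀ x, u₁ t x ≤ u₂ t x := by
  intro t₀ ht₀
  have hτ : 0 ≤ τ := ht₀.1.trans ht₀.2
  obtain ⟨M₁, hM₁, hq₁⟩ := h₁.quad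
  obtain ⟨M₂, hM₂, hq₂⟩ := h₂.quad
  set w : ℝ → ℝ := fun x => (1 + x ^ 2)⁻¹ with hw
  have hw0 : ∀ x, 0 < w x := fun x => by simp only [hw]; positivity
  have hw1 : ∀ x, w x ≤ 1 := fun x => inv_le_one_of_one_le₀ (by nlinarith [sq_nonneg x])
  have hwy : ∀ x, (x ^ 2 + 1) * w x = 1 := fun x => by
    simp only [hw]; rw [add_comm]; exact mul_inv_cancel₀ (by positivity)
  have hcw : Continuous w := by
    refine Continuous.inv₀ (by fun_prop) fun x => by positivity
  have hw2i : Integrable fun x => w x ^ 2 := by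
    refine integrable_of_abs_le_inv_one_add_sq (C := 1) (hcw.pow 2).aestronglyMeasurable fun x => ?_
    rw [abs_of_nonneg (sq_nonneg _)]
    have := hw0 x
    have := hw1 x
    change w x ^ 2 ≤ 1 * w x
    nlinarith
  set k : ℝ → ℝ → ℝ := fun r x => if 0 < u₁ r x - u₂ r x then
        1 / 2 * (deriv (deriv (u₁ r)) x - deriv (deriv (u₂ r)) x) else 0 with hk
  set V : ℝ → ℝ → ℝ := fun t x => ∫ r in (0:ℝ)..t, k r x with hV
  have hkm : Measurable fun p : ℝ × ℝ => k p.1 p.2 := by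
    have m1 : Measurable fun p : ℝ × ℝ => u₁ p.1 p.2 := h₁.continuous.measurable
    have m2 : Measurable fun p : ℝ × ℝ => u₂ p.1 p.2 := h₂.continuous.measurable
    exact Measurable.ite (measurableSet_lt measurable_const (m1.sub m2))
      ((h₁.measurable_second.sub h₂.measurable_second).const_mul _) measurable_const
  have hkb : ∀ᵐ r, r ∈ Icc 0 τ → ∀ x, |k r x| ≤ g₁ r + g₂ r := by
    filter_upwards [h₁.second, h₂.second] with r a b hr x
    have a' := (a hr x).2
    have b' := (b hr x).2
    have := h₁.g_nonneg r
    have := h₂.g_nonneg r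
    simp only [hk]
    split_ifs
    · rw [abs_le] at *
      constructor <;> linarith
    · rw [abs_zero]; positivity
  have hKi : Integrable (fun p : ℝ × ℝ => w p.2 ^ 2 * k p.1 p.2)
      ((volume.restrict (Icc 0 τ)).prod volume) := by
    have hb := ((h₁.integrable.add h₂.integrable).restrict (s := Icc 0 τ)).mul_prod hw2i
    refine hb.mono ((((hcw.comp continuous_snd).pow 2).measurable.mul hkm).aestronglyMeasurable) ?_
    have h1 : ∀ᵐ p : ℝ × ℝ ∂((volume.restrict (Icc 0 τ)).prod volume),
        ∀ x, |k p.1 x| ≤ g₁ p.1 + g₂ p.1 := by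
      refine Measure.quasiMeasurePreserving_fst.ae
        (p := fun t => ∀ x, |k t x| ≤ g₁ t + g₂ t) ?_
      rwa [ae_restrict_iff' measurableSet_Icc]
    filter_upwards [h1] with p hp
    simp only [Pi.add_apply, norm_mul, Real.norm_eq_abs]
    rw [mul_comm]
    exact mul_le_mul_of_nonneg_right ((hp p.2).trans (le_abs_self _)) (abs_nonneg _)
  have hKt : ∀ t ∈ Icc 0 τ, Integrable (fun p : ℝ × ℝ => w p.2 ^ 2 * k p.1 p.2)
      ((volume.restrict (Ioc 0 t)).prod volume) := fun t ht => by
    have hsub : Ioc 0 t ⊆ Icc 0 τ := fun r hr => ⟨hr.1.le, hr.2.trans ht.2⟩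
    exact hKi.mono_measure (Measure.prod_mono (Measure.restrict_mono hsub le_rfl) le_rfl)
  have hVi : ∀ t ∈ Icc 0 τ, Integrable fun x => w x ^ 2 * V t x := fun t ht => by
    have := (hKt t ht).integral_prod_right
    simp only [integral_const_mul] at this
    simpa only [hV, intervalIntegral.integral_of_le ht.1] using this
  set e : ℝ → ℝ := fun r => ∫ x, w x ^ 2 * k r x with he
  set E : ℝ → ℝ := fun t => ∫ x, w x ^ 2 * V t x with hE
  have hei : IntegrableOn e (Icc 0 τ) := hKi.integral_prod_left
  have hEe : ∀ t ∈ Icc 0 τ, E t = ∫ r in (0:ℝ)..t, e r := by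
    intro t ht
    simp only [hE, hV, he, intervalIntegral.integral_of_le ht.1, ← integral_const_mul]
    exact (integral_integral_swap (hKt t ht)).symm
  have hEc : ContinuousOn E (Icc 0 τ) := by
    have := intervalIntegral.continuousOn_primitive_interval (a := 0) (b := τ) (f := e)
      (by rwa [uIcc_of_le hτ])
    rw [uIcc_of_le hτ] at this
    exact this.congr hEe
  have hA := h₁.ae_max_sub_le h₂ hτ h0
  have hE0 : ∀ t ∈ Icc 0 τ, 0 ≤ E t := fun t ht => by
    refine integral_nonneg_of_ae ?_
    filter_upwards [hA] with x hx
    exact mul_nonneg (sq_nonneg _) (hx t ht).1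
  have heE : ∀ᵐ r, r ∈ Icc 0 τ → e r ≤ 10 * (M₁ + 1) * E r := by
    filter_upwards [h₁.second, h₂.second] with r a b hr
    have hd1 : deriv (fun x => u₁ r x - u₂ r x) = fun x => deriv (u₁ r) x - deriv (u₂ r) x := by
      ext x
      exact deriv_fun_sub (h₁.differentiable r x) (h₂.differentiable r x)
    have hd2 : deriv (deriv (fun x => u₁ r x - u₂ r x)) = fun x =>
        deriv (deriv (u₁ r)) x - deriv (deriv (u₂ r)) x := by
      ext x
      rw [hd1]
      exact deriv_fun_sub (a hr x).1 (b hr x).1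
    have hkato := integral_indicator_pos_mul_second_le (f := fun x => u₁ r x - u₂ r x)
      (B := g₁ r + g₂ r) (M := M₁ + M₂)
      (fun x => (h₁.differentiable r x).fun_sub (h₂.differentiable r x))
      (by rw [hd1]; exact fun x => (a hr x).1.fun_sub (b hr x).1)
      (fun x => by
        rw [hd2]
        exact (abs_sub _ _).trans (add_le_add (a hr x).2 (b hr x).2))
      (fun x => by
        have := h₁.nonneg r x
        have := h₂.nonneg r x
        have := hq₁ r x
        have := hq₂ r x
        rw [abs_le]
        constructor <;> nlinarith [mul_nonneg hM₁ (sq_nonneg x), mul_nonneg hM₂ (sq_nonneg x)])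
    rw [hd2] at hkato
    have h3 : e r = 1 / 2 * ∫ x, w x ^ 2 * (if 0 < u₁ r x - u₂ r x then
        deriv (deriv (u₁ r)) x - deriv (deriv (u₂ r)) x else 0) := by
      rw [← integral_const_mul]
      simp only [he, hk]
      congr 1
      ext x
      split_ifs <;> ring
    have h4 : ∫ x, w x ^ 3 * max (u₁ r x - u₂ r x) 0 ≤ ∫ x, M₁ * (w x ^ 2 * V r x) := by
      refine integral_mono_of_nonneg (Eventually.of_forall fun x =>
        mul_nonneg (pow_pos (hw0 x) 3).le (le_max_right _ _)) ((hVi r hr).const_mul _) ?_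
      filter_upwards [hA] with x hx
      have hx' := hx r hr
      have hww := hw0 x
      calc w x ^ 3 * max (u₁ r x - u₂ r x) 0 ≤ w x ^ 3 * (M₁ * (x ^ 2 + 1) * V r x) := by
            refine mul_le_mul_of_nonneg_left (hx'.2.trans ?_) (pow_pos hww 3).le
            exact mul_le_mul_of_nonneg_right (hq₁ r x) hx'.1
        _ = M₁ * (w x ^ 2 * V r x) * ((x ^ 2 + 1) * w x) := by ring
        _ = _ := by rw [hwy, mul_one]
    rw [integral_const_mul] at h4
    have h5 := hE0 r hr
    change _ ≤ M₁ * E r at h4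
    rw [h3]
    change ∫ x, w x ^ 2 * _ ≤ 20 * ∫ x, w x ^ 3 * _ at hkato
    linarith
  have hgr := nonpos_of_le_mul_integral (L := 10 * (M₁ + 1)) (by positivity) hEc (fun t ht => by
    rw [hEe t ht, ← intervalIntegral.integral_const_mul]
    have hsub : uIcc 0 t ⊆ Icc 0 τ := by
      rw [uIcc_of_le ht.1]; exact Icc_subset_Icc_right ht.2
    refine intervalIntegral.integral_mono_ae_restrict ht.1 (hei.mono_set hsub).intervalIntegrable
      ((hEc.mono hsub).intervalIntegrable.const_mul _) ?_
    rw [EventuallyLE, ae_restrict_iff' measurableSet_Icc]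
    filter_upwards [heE] with r hr hrt using hr ⟨hrt.1, hrt.2.trans ht.2⟩)
  have hEz : E t₀ = 0 := le_antisymm (hgr t₀ ht₀) (hE0 t₀ ht₀)
  have hae : (fun x => w x ^ 2 * V t₀ x) =ᵐ[volume] 0 := by
    refine (integral_eq_zero_iff_of_nonneg_ae ?_ (hVi t₀ ht₀)).1 hEz
    filter_upwards [hA] with x hx
    exact mul_nonneg (sq_nonneg _) (hx t₀ ht₀).1
  have hle : ∀ᵐ x, u₁ t₀ x ≤ u₂ t₀ x := by
    filter_upwards [hA, hae] with x hx hz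
    have hVz : V t₀ x = 0 := (mul_eq_zero.1 hz).resolve_left (pow_pos (hw0 x) 2).ne'
    have := (hx t₀ ht₀).2
    change _ ≤ u₁ t₀ x * V t₀ x at this
    rw [hVz, mul_zero] at this
    have := (le_max_left _ _).trans this
    linarith
  have hcl : IsClosed {x | u₁ t₀ x ≤ u₂ t₀ x} :=
    isClosed_le (h₁.differentiable t₀).continuous (h₂.differentiable t₀).continuous
  intro x
  exact (closure_minimal (fun y hy => hy) hcl) (Measure.dense_of_ae hle x)

end IsIntegratedSolution

namespace IsIntegratedSolution

variable {τ : ℝ} {g : ℝ → ℝ} {u : ℝ → ℝ → ℝ}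

/-- The time-monotonicity formula: `t u(t, x)` is nondecreasing in `t`. -/
lemma mul_le_mul_time (hu : IsIntegratedSolution τ g u) {s t : ℝ} (hs : 0 < s) (hst : s ≤ t)
    (ht : t ≤ τ) (x : ℝ) : s * u s x ≤ t * u t x := by
  have hμ : 1 ≤ t / s := (one_le_div hs).2 hst
  have hμ0 : 0 < t / s := by linarith
  have hτ' : 0 ≤ τ / (t / s) := by
    have : 0 ≤ τ := by linarith
    positivity
  have hmul : t / s * (τ / (t / s)) = τ := mul_div_cancel₀ _ hμ0.ne'
  have hv := hu.scale (s := 0) le_rfl hμ0 hτ' (by rw [hmul, zero_add])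
  have hle : τ / (t / s) ≤ τ := div_le_self (by linarith) hμ
  have hu' := hu.scale (s := 0) (μ := 1) (τ' := τ / (t / s)) le_rfl one_pos hτ' (by linarith)
  have := hu'.comparison hv (fun x => by
    simp only [mul_zero, add_zero, one_mul]
    exact le_mul_of_one_le_left (hu.nonneg _ _) hμ) s ⟨hs.le, by
      rw [le_div_iff₀ hμ0, mul_div_cancel₀ _ hs.ne']; exact ht⟩ x
  simp only [one_mul, zero_add] at this
  rw [div_mul_cancel₀ _ hs.ne', div_mul_eq_mul_div, le_div_iff₀ hs] at this
  linarith

lemma le_mul_of_shift (hu : IsIntegratedSolution τ g u) {s h μ t : ℝ} (hs : 0 ≤ s) (hh : 0 ≤ h)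
    (hsh : s + h + t ≤ τ) (ht : 0 ≤ t) (hμ : 0 < μ) (hsμ : s + μ * t ≤ τ)
    (h0 : ∀ x, u (s + h) x ≤ μ * u s x) (x : ℝ) : u (s + h + t) x ≤ μ * u (s + μ * t) x := by
  have h1 := hu.scale (s := s + h) (μ := 1) (τ' := t) (by positivity) one_pos ht (by linarith)
  have h2 := hu.scale (s := s) hs hμ ht hsμ
  simpa using h1.comparison h2 (by simpa using h0) t ⟨ht, le_rfl⟩ x

/-- There are times `s < t₀` at which the bound on the second derivative is small compared
with `1 / (t₀ - s)`. -/
lemma exists_good_time (hu : IsIntegratedSolution τ g u) {t₀ : ℝ} (ht₀ : 0 < t₀) :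
    ∃ s ∈ Ioo 0 t₀, g s * (t₀ - s) < 1 / 2 ∧
      HasDerivAt (fun t => ∫ r in (0:ℝ)..t, g r) (g s) s := by
  by_contra! hcon
  have hd : ∀ᵐ s, HasDerivAt (fun t => ∫ r in (0:ℝ)..t, g r) (g s) s := by
    filter_upwards [LocallyIntegrable.ae_hasDerivAt_integral hu.integrable.locallyIntegrable]
      with s h using h 0
  have hge : ∀ᵐ s, s ∈ Ioo 0 t₀ → 1 / 2 * (t₀ - s)⁻¹ ≤ g s := by
    filter_upwards [hd] with s hs hst
    have : 1 / 2 ≤ g s * (t₀ - s) := by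
      by_contra! hlt
      exact hcon s hst hlt hs
    rw [← div_eq_mul_inv, div_le_iff₀ (by linarith [hst.2])]
    exact this
  have hint : IntervalIntegrable (fun s => (s - t₀)⁻¹) volume 0 t₀ := by
    rw [intervalIntegrable_iff_integrableOn_Ioo_of_le ht₀.le]
    have hg2 : IntegrableOn (fun s => 2 * g s) (Ioo 0 t₀) := (hu.integrable.const_mul 2).integrableOn
    refine Integrable.mono hg2 ((measurable_id.sub_const t₀).inv).aestronglyMeasurable ?_
    rw [ae_restrict_iff' measurableSet_Ioo]
    filter_upwards [hge] with s hs hst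
    have h1 := hs hst
    have h2 : 0 < (t₀ - s)⁻¹ := inv_pos.2 (by linarith [hst.2])
    rw [← neg_sub t₀ s, inv_neg, norm_neg, Real.norm_eq_abs, Real.norm_eq_abs, abs_of_pos h2,
      abs_of_nonneg (by linarith)]
    linarith
  rw [intervalIntegrable_sub_inv_iff] at hint
  rcases hint with h | h
  · exact ht₀.ne h
  · exact h right_mem_uIcc

/-- Locally in time, `log u` is bounded above by a linear function, uniformly in space. -/
lemma exists_le_exp_mul (hu : IsIntegratedSolution τ g u) {t₀ : ℝ} (ht₀ : t₀ ∈ Ioo 0 τ) :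
    ∃ a ∈ Ioo 0 t₀, ∃ b ∈ Ioo t₀ τ, ∃ K, 0 ≤ K ∧ ∀ t ∈ Icc a b, ∀ t' ∈ Icc a b, t ≤ t' →
      ∀ x, u t' x ≤ u t x * Real.exp (K * (t' - t)) := by
  obtain ⟨s, hs, hgs, hGd⟩ := hu.exists_good_time ht₀.1
  have hδ : 0 < t₀ - s := sub_pos.2 hs.2
  set A : ℝ := 1 / (4 * (t₀ - s)) with hA
  have hA0 : 0 < A := by positivity
  have hgA : 1 / 2 * g s < A := by
    rw [hA, lt_div_iff₀ (by positivity)]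
    linarith
  set μ : ℝ → ℝ := fun h => Real.exp (1 / 2 * ∫ r in s..(s + h), g r) with hμ
  have hμ0 : μ 0 = 1 := by simp [hμ]
  have hii : ∀ a b, IntervalIntegrable g volume a b := fun a b => hu.integrable.intervalIntegrable
  have hμd : HasDerivAt μ (1 / 2 * g s) 0 := by
    have h1 : HasDerivAt (fun h => ∫ r in s..(s + h), g r) (g s) 0 := by
      have h2 : HasDerivAt (fun h => (∫ r in (0:ℝ)..(s + h), g r) - ∫ r in (0:ℝ)..s, g r) (g s) 0 := by
        refine HasDerivAt.sub_const _ ?_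
        have h3 : HasDerivAt (fun t => ∫ r in (0:ℝ)..t, g r) (g s) (s + 0) := by rwa [add_zero]
        exact h3.comp_const_add s 0
      refine h2.congr_of_eventuallyEq (Eventually.of_forall fun h => ?_)
      exact (intervalIntegral.integral_interval_sub_left (hii _ _) (hii _ _)).symm
    refine ((h1.const_mul (1 / 2)).exp).congr_deriv ?_
    simp
  have hev : ∀ᶠ h in 𝓝[>] (0:ℝ), μ h - 1 < A * h := by
    have := (hμd.hasDerivWithinAt (s := Ioi 0)).limsup_slope_le' (by simp) hgA
    filter_upwards [this, self_mem_nhdsWithin] with h h1 h2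
    rw [slope_def_field, hμ0, sub_zero, div_lt_iff₀ h2] at h1
    exact h1
  have hμ1 : ∀ h, 0 ≤ h → 1 ≤ μ h := fun h hh => by
    refine Real.one_le_exp (mul_nonneg (by norm_num) ?_)
    exact intervalIntegral.integral_nonneg (by linarith) fun r _ => hu.g_nonneg r
  set b := min (2 * t₀ - s) τ with hb
  have key : ∀ t ∈ Ioo s b, ∀ x, ∃ᶠ t' in 𝓝[>] t, u t' x ≤ u t x * Real.exp (2 * A * (t' - t)) := by
    intro t ht x
    have ht1 : t < 2 * t₀ - s := ht.2.trans_le (min_le_left _ _)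
    have ht2 : t < τ := ht.2.trans_le (min_le_right _ _)
    have hAt : A * (t - s) ≤ 1 / 2 := by
      rw [hA, div_mul_eq_mul_div, div_le_iff₀ (by positivity)]
      linarith
    set d : ℝ → ℝ := fun h => h - (μ h - 1) * ((t - s) / μ h) with hd
    have hdc : Tendsto (fun h => t + d h) (𝓝[>] 0) (𝓝[>] t) := by
      refine tendsto_nhdsWithin_iff.2 ⟨?_, ?_⟩
      · have hc : ContinuousAt (fun h => t + d h) 0 := by
          have := hμd.continuousAt
          refine continuousAt_const.add (continuousAt_id.sub ((this.sub continuousAt_const).mul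
            (continuousAt_const.div this (Real.exp_pos _).ne')))
        have := hc.tendsto
        simp only [hd, hμ0] at this
        simp only [sub_self, zero_mul, add_zero] at this
        exact this.mono_left nhdsWithin_le_nhds
      · filter_upwards [hev, self_mem_nhdsWithin] with h h1 (h2 : 0 < h)
        have h3 := hμ1 h h2.le
        have h4 : (t - s) / μ h ≤ t - s := div_le_self (by linarith [ht.1]) h3
        have h5 : (μ h - 1) * ((t - s) / μ h) ≤ A * h * (t - s) := 
          mul_le_mul h1.le h4 (div_nonneg (by linarith [ht.1]) (by linarith)) (by positivity)
        simp only [mem_Ioi, hd]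
        nlinarith
    refine hdc.frequently (Eventually.frequently ?_)
    have hlt : ∀ᶠ h in 𝓝[>] (0:ℝ), t + h < τ :=
      ((continuous_const.add continuous_id).tendsto' 0 t (by simp)).mono_left nhdsWithin_le_nhds
        |>.eventually (gt_mem_nhds ht2)
    filter_upwards [hev, self_mem_nhdsWithin, hlt] with h h1 (h2 : 0 < h) h6
    have h3 := hμ1 h h2.le
    have hμp : 0 < μ h := Real.exp_pos _
    have h4 : (t - s) / μ h ≤ t - s := div_le_self (by linarith [ht.1]) h3
    have h40 : 0 ≤ (t - s) / μ h := div_nonneg (by linarith [ht.1]) (by linarith)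
    have h5 : (μ h - 1) * ((t - s) / μ h) ≤ A * h * (t - s) :=
      mul_le_mul h1.le h4 h40 (by positivity)
    have hdh : h / 2 ≤ d h := by simp only [hd]; nlinarith
    have e1 : s + μ h * ((t - s) / μ h) = t := by rw [mul_div_cancel₀ _ hμp.ne']; ring
    have e2 : s + h + (t - s) / μ h = t + d h := by
      have := mul_div_cancel₀ (t - s) hμp.ne'
      simp only [hd]
      linarith
    have h7 := hu.le_mul_of_shift (s := s) (h := h) (μ := μ h) (t := (t - s) / μ h) hs.1.le h2.le
      (by linarith) h40 hμp (by linarith) (fun y => by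
        rw [mul_comm]
        exact (hu.le_mul_exp ⟨hs.1.le, by linarith [ht.1]⟩ ⟨by linarith [hs.1], by linarith [ht.1]⟩
          (by linarith) y).1) x
    rw [e1, e2] at h7
    refine h7.trans ?_
    rw [mul_comm]
    refine mul_le_mul_of_nonneg_left ?_ (hu.nonneg _ _)
    have h8 := Real.add_one_le_exp (2 * A * (t + d h - t))
    nlinarith
  have hsb : t₀ < b := lt_min (by linarith) ht₀.2
  have hbτ : b ≤ τ := min_le_right _ _
  refine ⟨(s + t₀) / 2, ⟨by linarith [hs.1], by linarith⟩, (t₀ + b) / 2, ⟨by linarith, by linarith⟩,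
    2 * A, by positivity, fun t ht t' ht' htt x => ?_⟩
  have hmem : ∀ r ∈ Icc t t', r ∈ Ioo s b := fun r hr =>
    ⟨by linarith [ht.1, hr.1], by linarith [ht'.2, hr.2]⟩
  have hmem' : ∀ r ∈ Icc t t', r ∈ Icc 0 τ := fun r hr =>
    ⟨by linarith [(hmem r hr).1, hs.1], by linarith [(hmem r hr).2]⟩
  rcases (hu.nonneg t x).eq_or_lt with h0 | hpos
  · rw [← h0, zero_mul]
    by_contra! hlt
    have := hu.pos_of_pos (hmem' t' ⟨htt, le_rfl⟩) (hmem' t ⟨le_rfl, htt⟩) hlt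
    rw [← h0] at this
    exact this.false
  · have hp : ∀ r ∈ Icc t t', 0 < u r x := fun r hr =>
      hu.pos_of_pos (hmem' t ⟨le_rfl, htt⟩) (hmem' r hr) hpos
    have hlog : ∀ ε > 0, Real.log (u t' x) ≤ Real.log (u t x) + (2 * A + ε) * (t' - t) := by
      intro ε hε
      refine image_le_of_liminf_slope_right_lt_deriv_boundary' (f := fun r => Real.log (u r x))
        (f' := fun _ => 2 * A) (B := fun r => Real.log (u t x) + (2 * A + ε) * (r - t))
        (B' := fun _ => 2 * A + ε) (a := t) (b := t') ?_ ?_ ?_ ?_ ?_ ?_ ⟨htt, le_rfl⟩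
      · exact ContinuousOn.log ((hu.continuous.comp (Continuous.prodMk_left x)).continuousOn)
          fun r hr => (hp r hr).ne'
      · intro r hr ρ hρ
        have hr' : r ∈ Icc t t' := ⟨hr.1, hr.2.le⟩
        have hI : ∀ᶠ z in 𝓝[>] r, z ∈ Ioc r t' := Ioc_mem_nhdsGT hr.2
        refine ((key r (hmem r hr') x).and_eventually hI).mono fun z hz => ?_
        refine lt_of_le_of_lt ?_ hρ
        rw [slope_def_field, div_le_iff₀ (sub_pos.2 hz.2.1), sub_le_iff_le_add]
        have := Real.log_le_log (hp z ⟨hr.1.trans hz.2.1.le, hz.2.2⟩) hz.1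
        rw [Real.log_mul (hp r hr').ne' (Real.exp_pos _).ne', Real.log_exp] at this
        linarith
      · simp
      · fun_prop
      · intro r _
        have : HasDerivAt (fun r => Real.log (u t x) + (2 * A + ε) * (r - t)) ((2 * A + ε) * 1) r :=
          (((hasDerivAt_id r).sub_const t).const_mul _).const_add _
        rw [mul_one] at this
        exact this.hasDerivWithinAt
      · intro r _ _
        linarith
    have hlog' : Real.log (u t' x) ≤ Real.log (u t x) + 2 * A * (t' - t) := by
      have hlim : Tendsto (fun ε => Real.log (u t x) + (2 * A + ε) * (t' - t)) (𝓝[>] 0)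
          (𝓝 (Real.log (u t x) + 2 * A * (t' - t))) := by
        refine Tendsto.mono_left ?_ nhdsWithin_le_nhds
        exact Continuous.tendsto' (by fun_prop) _ _ (by simp)
      exact ge_of_tendsto hlim (by filter_upwards [self_mem_nhdsWithin] with ε hε using hlog ε hε)
    have := Real.exp_le_exp.2 hlog'
    rwa [Real.exp_add, Real.exp_log (hp t' ⟨htt, le_rfl⟩), Real.exp_log hpos] at this

/-- Locally in time, `log u` is Lipschitz in time, uniformly in space. -/
theorem exists_le_exp_mul_abs (hu : IsIntegratedSolution τ g u) {t₀ : ℝ} (ht₀ : t₀ ∈ Ioo 0 τ) :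
    ∃ a ∈ Ioo 0 t₀, ∃ b ∈ Ioo t₀ τ, ∃ K, 0 ≤ K ∧ ∀ t ∈ Icc a b, ∀ t' ∈ Icc a b,
      ∀ x, u t' x ≤ u t x * Real.exp (K * |t' - t|) := by
  obtain ⟨a, ha, b, hb, K, hK, h⟩ := hu.exists_le_exp_mul ht₀
  refine ⟨a, ha, b, hb, max K a⁻¹, hK.trans (le_max_left _ _), fun t ht t' ht' x => ?_⟩
  rcases le_total t t' with htt | htt
  · refine (h t ht t' ht' htt x).trans (mul_le_mul_of_nonneg_left ?_ (hu.nonneg _ _))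
    rw [abs_of_nonneg (sub_nonneg.2 htt)]
    exact Real.exp_le_exp.2 (mul_le_mul_of_nonneg_right (le_max_left _ _) (sub_nonneg.2 htt))
  · have h1 := hu.mul_le_mul_time (ha.1.trans_le ht'.1) htt (ht.2.trans hb.2.le) x
    have h0 : 0 < t' := ha.1.trans_le ht'.1
    have h2 : u t' x ≤ u t x * (t / t') := by
      rw [mul_div_assoc', le_div_iff₀ h0]
      linarith
    refine h2.trans (mul_le_mul_of_nonneg_left ?_ (hu.nonneg _ _))
    rw [abs_of_nonpos (sub_nonpos.2 htt), neg_sub]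
    have h3 : t / t' ≤ a⁻¹ * (t - t') + 1 := by
      have : t / t' = t'⁻¹ * (t - t') + 1 := by field_simp; ring
      rw [this]
      gcongr
      exacts [ha.1, ht'.1]
    refine h3.trans ((Real.add_one_le_exp _).trans (Real.exp_le_exp.2 ?_))
    exact mul_le_mul_of_nonneg_right (le_max_right _ _) (sub_nonneg.2 htt)

end IsIntegratedSolution

/-- Spatial form of the basic energy estimate. -/
lemma integral_rhs_mul_le {f P Q ζ : ℝ → ℝ} {α β c C Z B : ℝ} (hαβ : α ≤ β) (hc : 0 < c)
    (hf : Differentiable ℝ f)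
    (hf2 : ∀ x ∈ Icc α β, DifferentiableAt ℝ (deriv f) x)
    (hB : ∀ x ∈ Icc α β, |deriv (deriv f) x| ≤ B)
    (hP : Differentiable ℝ P) (hP' : Continuous (deriv P)) (hQm : Measurable Q)
    (hPc : ∀ x ∈ Icc α β, c ≤ P x) (hPC : ∀ x ∈ Icc α β, P x ≤ C)
    (hPd : ∀ x ∈ Icc α β, |deriv P x| ≤ C) (hQ : ∀ x ∈ Icc α β, |Q x| ≤ C)
    (hfC : ∀ x ∈ Icc α β, |f x| ≤ C) (hf1 : Continuous (deriv f))
    (hζ : ContDiff ℝ 1 ζ) (hζα : ζ α = 0) (hζβ : ζ β = 0)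
    (hZ : ∀ x ∈ Icc α β, |ζ x| ≤ Z) (hZ' : ∀ x ∈ Icc α β, |deriv ζ x| ≤ Z) :
    ∫ x in α..β, (P x * deriv (deriv f) x + Q x * f x) * f x * ζ x ^ 2 ≤
      ∫ x in α..β, (-(c / 2) * (deriv f x ^ 2 * ζ x ^ 2) +
        ((3 * C ^ 2 * Z) ^ 2 / (2 * c) + C ^ 3 * Z ^ 2)) := by
  have hζd := hζ.differentiable one_ne_zero
  have hζ' : Continuous (deriv ζ) := hζ.continuous_deriv le_rfl
  have hfc := hf.continuous
  have hPc' := hP.continuous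
  have hζc := hζ.continuous
  have hv : ∀ x, HasDerivAt (fun x => P x * f x * ζ x ^ 2)
      ((deriv P x * f x + P x * deriv f x) * ζ x ^ 2 + P x * f x * (2 * ζ x * deriv ζ x)) x := by
    intro x
    have := ((hP x).hasDerivAt.mul (hf x).hasDerivAt).mul ((hζd x).hasDerivAt.pow 2)
    refine this.congr_deriv ?_
    simp
  have hii : IntervalIntegrable (deriv (deriv f)) volume α β := by
    rw [intervalIntegrable_iff_integrableOn_Icc_of_le hαβ]
    refine Measure.integrableOn_of_bounded (M := B) isCompact_Icc.measure_lt_top.ne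
      (measurable_deriv _).aestronglyMeasurable ?_
    rw [ae_restrict_iff' measurableSet_Icc]
    exact Eventually.of_forall hB
  have hiQ : IntervalIntegrable (fun x => Q x * f x * f x * ζ x ^ 2) volume α β := by
    rw [intervalIntegrable_iff_integrableOn_Icc_of_le hαβ]
    refine Measure.integrableOn_of_bounded (M := C * C * C * Z ^ 2)
      isCompact_Icc.measure_lt_top.ne
      (((hQm.mul hfc.measurable).mul hfc.measurable).mul
        (hζc.measurable.pow_const 2)).aestronglyMeasurable ?_
    rw [ae_restrict_iff' measurableSet_Icc]
    refine Eventually.of_forall fun x hx => ?_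
    simp only [norm_mul, norm_pow, Real.norm_eq_abs]
    have := hQ x hx
    have := hfC x hx
    have := hZ x hx
    have : 0 ≤ C := (abs_nonneg _).trans (hfC x hx)
    gcongr
  have hparts := intervalIntegral.integral_deriv_mul_eq_sub (a := α) (b := β)
    (u := deriv f) (u' := deriv (deriv f))
    (v := fun x => P x * f x * ζ x ^ 2) (fun x hx => (hf2 x (by rwa [uIcc_of_le hαβ] at hx)).hasDerivAt)
    (fun x _ => hv x) hii (Continuous.intervalIntegrable (by fun_prop) _ _)
  simp only [hζα, hζβ] at hparts
  have hi1 : IntervalIntegrable (fun x => deriv (deriv f) x * (P x * f x * ζ x ^ 2)) volume α β :=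
    hii.mul_continuousOn (by fun_prop)
  have hi2 : IntervalIntegrable (fun x => deriv f x * ((deriv P x * f x + P x * deriv f x) * ζ x ^ 2
      + P x * f x * (2 * ζ x * deriv ζ x))) volume α β :=
    Continuous.intervalIntegrable (by fun_prop) _ _
  rw [intervalIntegral.integral_add hi1 hi2] at hparts
  have heq : ∫ x in α..β, (P x * deriv (deriv f) x + Q x * f x) * f x * ζ x ^ 2 =
      ∫ x in α..β, (Q x * f x * f x * ζ x ^ 2 -
        deriv f x * ((deriv P x * f x + P x * deriv f x) * ζ x ^ 2
      + P x * f x * (2 * ζ x * deriv ζ x))) := by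
    rw [intervalIntegral.integral_sub hiQ hi2]
    have : ∫ x in α..β, (P x * deriv (deriv f) x + Q x * f x) * f x * ζ x ^ 2 =
      ∫ x in α..β, (deriv (deriv f) x * (P x * f x * ζ x ^ 2) + Q x * f x * f x * ζ x ^ 2) := by
      congr 1; ext x; ring
    rw [this, intervalIntegral.integral_add hi1 hiQ]
    linarith
  rw [heq]
  refine intervalIntegral.integral_mono_on hαβ (hiQ.sub hi2)
    (Continuous.intervalIntegrable (by fun_prop) _ _) fun x hx => ?_
  have h1 := hQ x hx
  have h2 := hfC x hx
  have h3 := hZ x hx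
  have h4 := hZ' x hx
  have h5 := hPd x hx
  have h6 := hPC x hx
  have h7 := hPc x hx
  have hC : 0 ≤ C := (abs_nonneg _).trans h2
  have hZ0 : 0 ≤ Z := (abs_nonneg _).trans h3
  have h8 : |P x| ≤ C := by rw [abs_of_pos (hc.trans_le h7)]; exact h6
  set d := f x * (deriv P x * ζ x + 2 * P x * deriv ζ x) with hd
  have hdb : |d| ≤ 3 * C ^ 2 * Z := by
    rw [hd, abs_mul]
    have : |deriv P x * ζ x + 2 * P x * deriv ζ x| ≤ C * Z + 2 * C * Z := by
      refine (abs_add_le _ _).trans (add_le_add ?_ ?_)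
      · rw [abs_mul]; gcongr
      · rw [abs_mul, abs_mul, abs_two]; gcongr
    calc _ ≤ C * (C * Z + 2 * C * Z) := by gcongr
      _ = _ := by ring
  have hd2 : d ^ 2 ≤ (3 * C ^ 2 * Z) ^ 2 := sq_le_sq' (neg_le_of_abs_le hdb) (le_of_abs_le hdb)
  have hq : Q x * f x * f x * ζ x ^ 2 ≤ C ^ 3 * Z ^ 2 := by
    refine (le_abs_self _).trans ?_
    rw [abs_mul, abs_mul, abs_mul, abs_pow]
    calc _ ≤ C * C * C * Z ^ 2 := by gcongr
      _ = _ := by ring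
  have hy : - (deriv f x * ζ x * d) ≤ c / 2 * (deriv f x * ζ x) ^ 2 + d ^ 2 / (2 * c) := by
    rw [← sub_nonneg]
    have : c / 2 * (deriv f x * ζ x) ^ 2 + d ^ 2 / (2 * c) - -(deriv f x * ζ x * d) =
      (c * (deriv f x * ζ x) + d) ^ 2 / (2 * c) := by field_simp; ring
    rw [this]
    positivity
  have hy2 : d ^ 2 / (2 * c) ≤ (3 * C ^ 2 * Z) ^ 2 / (2 * c) := by gcongr
  have hy3 : c * (deriv f x * ζ x) ^ 2 ≤ P x * (deriv f x * ζ x) ^ 2 := by gcongr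
  have e1 : deriv f x * ((deriv P x * f x + P x * deriv f x) * ζ x ^ 2
      + P x * f x * (2 * ζ x * deriv ζ x)) = P x * (deriv f x * ζ x) ^ 2 + deriv f x * ζ x * d := by
    rw [hd]; ring
  rw [e1]
  nlinarith

/-- Spatial form of the second energy estimate, for a difference in time. -/
lemma integral_second_mul_sub_le {f k η : ℝ → ℝ} {α β B : ℝ} (hαβ : α ≤ β)
    (hf : Differentiable ℝ f) (hf1 : Continuous (deriv f))
    (hf2 : ∀ x ∈ Icc α β, DifferentiableAt ℝ (deriv f) x)
    (hB : ∀ x ∈ Icc α β, |deriv (deriv f) x| ≤ B)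
    (hk : Differentiable ℝ k) (hk1 : Continuous (deriv k))
    (hη : ContDiff ℝ 1 η) (hηα : η α = 0) (hηβ : η β = 0) (hη0 : ∀ x, 0 ≤ η x) :
    ∫ x in α..β, (deriv (deriv f) x * η x + deriv f x * deriv η x) * (f x - k x) ≤
      -(1 / 2) * ((∫ x in α..β, deriv f x ^ 2 * η x) - ∫ x in α..β, deriv k x ^ 2 * η x) := by
  have hηd := hη.differentiable one_ne_zero
  have hη' : Continuous (deriv η) := hη.continuous_deriv le_rfl
  have hfc := hf.continuous
  have hkc := hk.continuous
  have hηc := hη.continuous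
  have hii : IntervalIntegrable (deriv (deriv f)) volume α β := by
    rw [intervalIntegrable_iff_integrableOn_Icc_of_le hαβ]
    refine Measure.integrableOn_of_bounded (M := B) isCompact_Icc.measure_lt_top.ne
      (measurable_deriv _).aestronglyMeasurable ?_
    rw [ae_restrict_iff' measurableSet_Icc]
    exact Eventually.of_forall hB
  have hi0 : IntervalIntegrable (fun x => deriv (deriv f) x * η x + deriv f x * deriv η x)
      volume α β :=
    (hii.mul_continuousOn (by fun_prop)).add (Continuous.intervalIntegrable (by fun_prop) _ _)
  have hparts := intervalIntegral.integral_deriv_mul_eq_sub (a := α) (b := β)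
    (u := fun x => deriv f x * η x) (u' := fun x => deriv (deriv f) x * η x + deriv f x * deriv η x)
    (v := fun x => f x - k x) (v' := fun x => deriv f x - deriv k x)
    (fun x hx => (hf2 x (by rwa [uIcc_of_le hαβ] at hx)).hasDerivAt.mul (hηd x).hasDerivAt)
    (fun x _ => (hf x).hasDerivAt.sub (hk x).hasDerivAt) hi0
    (Continuous.intervalIntegrable (by fun_prop) _ _)
  simp only [hηα, hηβ] at hparts
  have hi1 : IntervalIntegrable (fun x => (deriv (deriv f) x * η x + deriv f x * deriv η x) *
      (f x - k x)) volume α β := hi0.mul_continuousOn (by fun_prop)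
  rw [intervalIntegral.integral_add hi1 (Continuous.intervalIntegrable (by fun_prop) _ _)] at hparts
  have hle : ∫ x in α..β, 1 / 2 * (deriv f x ^ 2 * η x - deriv k x ^ 2 * η x) ≤
      ∫ x in α..β, deriv f x * η x * (deriv f x - deriv k x) := by
    refine intervalIntegral.integral_mono_on hαβ (Continuous.intervalIntegrable (by fun_prop) _ _)
      (Continuous.intervalIntegrable (by fun_prop) _ _) fun x _ => ?_
    nlinarith [mul_nonneg (hη0 x) (sq_nonneg (deriv f x - deriv k x))]
  rw [intervalIntegral.integral_const_mul, intervalIntegral.integral_sub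
    (Continuous.intervalIntegrable (by fun_prop) _ _)
    (Continuous.intervalIntegrable (by fun_prop) _ _)] at hle
  linarith

/-- The linear equation `∂_t z = P ∂_x² z + Q z` on the rectangle `[a, b] × [α, β]`, with the bounds
on the coefficients (`c`, `C`) and the qualitative bound `B` which are used in energy estimates. -/
structure LinearEquation (a b α β c C B : ℝ) (P Q z : ℝ → ℝ → ℝ) : Prop where
  continuous : Continuous (Function.uncurry z)
  differentiable : ∀ t, Differentiable ℝ (z t)
  continuous_deriv : Continuous fun p : ℝ × ℝ => deriv (z p.1) p.2
  second : ∀ᵐ t, t ∈ Icc a b → ∀ x ∈ Icc α β,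
    DifferentiableAt ℝ (deriv (z t)) x ∧ |deriv (deriv (z t)) x| ≤ B
  lipschitz : ∀ x ∈ Icc α β, ∀ t ∈ Icc a b, ∀ t' ∈ Icc a b, |z t x - z t' x| ≤ B * |t - t'|
  evol : ∀ᵐ p : ℝ × ℝ, p.1 ∈ Icc a b → p.2 ∈ Icc α β → HasDerivAt (fun t => z t p.2)
    (P p.1 p.2 * deriv (deriv (z p.1)) p.2 + Q p.1 p.2 * z p.1 p.2) p.1
  differentiable_P : ∀ t, Differentiable ℝ (P t)
  continuous_deriv_P : ∀ t, Continuous (deriv (P t))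
  measurable_P : Measurable (Function.uncurry P)
  le_P : ∀ t ∈ Icc a b, ∀ x ∈ Icc α β, c ≤ P t x
  P_le : ∀ t ∈ Icc a b, ∀ x ∈ Icc α β, P t x ≤ C
  abs_deriv_P_le : ∀ t ∈ Icc a b, ∀ x ∈ Icc α β, |deriv (P t) x| ≤ C
  measurable_Q : Measurable (Function.uncurry Q)
  abs_Q_le : ∀ᵐ t, t ∈ Icc a b → ∀ x ∈ Icc α β, |Q t x| ≤ C
  abs_le : ∀ t ∈ Icc a b, ∀ x ∈ Icc α β, |z t x| ≤ C

namespace LinearEquation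

/-- Lebesgue measure on a rectangle. -/
def box (a b α β : ℝ) : Measure (ℝ × ℝ) :=
  (volume.restrict (Ioc a b)).prod (volume.restrict (Ioc α β))

instance (a b α β : ℝ) : IsFiniteMeasure (box a b α β) := by
  unfold box; infer_instance

lemma ae_box_mem (a b α β : ℝ) : ∀ᵐ p ∂box a b α β, p.1 ∈ Ioc a b ∧ p.2 ∈ Ioc α β := by
  rw [box, Measure.prod_restrict]
  exact ae_restrict_mem (measurableSet_Ioc.prod measurableSet_Ioc)

lemma integral_box {a b α β : ℝ} (hab : a ≤ b) (hαβ : α ≤ β) {f : ℝ × ℝ → ℝ}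
    (hf : Integrable f (box a b α β)) :
    ∫ p, f p ∂box a b α β = ∫ t in a..b, ∫ x in α..β, f (t, x) := by
  simp only [intervalIntegral.integral_of_le hab, intervalIntegral.integral_of_le hαβ]
  exact integral_prod _ hf

lemma integrable_box_of_continuous {a b α β : ℝ} {f : ℝ × ℝ → ℝ} (hf : Continuous f) :
    Integrable f (box a b α β) := by
  obtain ⟨D, hD⟩ := ((isCompact_Icc (a := a) (b := b)).prod
    (isCompact_Icc (a := α) (b := β))).exists_bound_of_continuousOn hf.continuousOn
  refine Integrable.of_bound hf.measurable.aestronglyMeasurable D ?_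
  filter_upwards [ae_box_mem a b α β] with p hp
  exact hD p ⟨Ioc_subset_Icc_self hp.1, Ioc_subset_Icc_self hp.2⟩

variable {a b α β c C B : ℝ} {P Q z : ℝ → ℝ → ℝ}

/-- The right-hand side of the equation. -/
def rhs (P Q z : ℝ → ℝ → ℝ) (p : ℝ × ℝ) : ℝ :=
  P p.1 p.2 * deriv (deriv (z p.1)) p.2 + Q p.1 p.2 * z p.1 p.2

lemma measurable_second (h : LinearEquation a b α β c C B P Q z) :
    Measurable fun p : ℝ × ℝ => deriv (deriv (z p.1)) p.2 :=
  measurable_deriv_deriv h.continuous_deriv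

lemma measurable_rhs (h : LinearEquation a b α β c C B P Q z) : Measurable (rhs P Q z) :=
  (h.measurable_P.mul h.measurable_second).add (h.measurable_Q.mul h.continuous.measurable)

lemma bound_nonneg (h : LinearEquation a b α β c C B P Q z) (hab : a < b) (hαβ : α ≤ β) :
    0 ≤ C ∧ 0 ≤ B := by
  have ha : a ∈ Icc a b := ⟨le_rfl, hab.le⟩
  have hb : b ∈ Icc a b := ⟨hab.le, le_rfl⟩
  have hα : α ∈ Icc α β := ⟨le_rfl, hαβ⟩
  refine ⟨(abs_nonneg _).trans (h.abs_le a ha α hα), ?_⟩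
  have := (abs_nonneg _).trans (h.lipschitz α hα b hb a ha)
  exact nonneg_of_mul_nonneg_left this (abs_pos.2 (sub_pos.2 hab).ne')

lemma ae_box (h : LinearEquation a b α β c C B P Q z) {s t : ℝ} (hs : a ≤ s) (ht : t ≤ b) :
    ∀ᵐ p ∂box s t α β, (p.1 ∈ Icc a b ∧ p.2 ∈ Icc α β) ∧ |deriv (deriv (z p.1)) p.2| ≤ B ∧
      |Q p.1 p.2| ≤ C ∧ HasDerivAt (fun t => z t p.2) (rhs P Q z p) p.1 := by
  have h1 : ∀ᵐ p ∂box s t α β, p.1 ∈ Icc a b → p.2 ∈ Icc α β →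
      HasDerivAt (fun t => z t p.2) (rhs P Q z p) p.1 := by
    rw [box, Measure.prod_restrict]
    exact ae_restrict_of_ae h.evol
  have h2 : ∀ᵐ p ∂box s t α β, p.1 ∈ Icc a b → ∀ x ∈ Icc α β,
      |deriv (deriv (z p.1)) x| ≤ B ∧ |Q p.1 x| ≤ C := by
    refine Measure.quasiMeasurePreserving_fst.ae (p := fun r => r ∈ Icc a b → ∀ x ∈ Icc α β,
      |deriv (deriv (z r)) x| ≤ B ∧ |Q r x| ≤ C) (ae_restrict_of_ae ?_)
    filter_upwards [h.second, h.abs_Q_le] with r h1 h2 hr x hx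
    exact ⟨(h1 hr x hx).2, h2 hr x hx⟩
  filter_upwards [h1, h2, ae_box_mem s t α β] with p h1 h2 h3
  have m1 : p.1 ∈ Icc a b := ⟨hs.trans h3.1.1.le, h3.1.2.trans ht⟩
  have m2 : p.2 ∈ Icc α β := Ioc_subset_Icc_self h3.2
  exact ⟨⟨m1, m2⟩, (h2 m1 _ m2).1, (h2 m1 _ m2).2, h1 m1 m2⟩

lemma abs_rhs_le (h : LinearEquation a b α β c C B P Q z) (hc : 0 < c) (hab : a < b)
    (hαβ : α ≤ β) {s t : ℝ} (hs : a ≤ s) (ht : t ≤ b) :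
    ∀ᵐ p ∂box s t α β, |rhs P Q z p| ≤ C * B + C * C := by
  obtain ⟨hC, hB⟩ := h.bound_nonneg hab hαβ
  filter_upwards [h.ae_box hs ht] with p hp
  have h1 := h.P_le _ hp.1.1 _ hp.1.2
  have h2 := h.le_P _ hp.1.1 _ hp.1.2
  have h3 := h.abs_le _ hp.1.1 _ hp.1.2
  have h4 : |P p.1 p.2| ≤ C := by rwa [abs_of_pos (hc.trans_le h2)]
  have h5 := hp.2.1
  have h6 := hp.2.2.1
  refine (abs_add_le _ _).trans (add_le_add ?_ ?_)
  · rw [abs_mul]; gcongr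
  · rw [abs_mul]; gcongr

lemma integrable_rhs_mul (h : LinearEquation a b α β c C B P Q z) (hc : 0 < c) (hab : a < b)
    (hαβ : α ≤ β) {s t : ℝ} (hs : a ≤ s) (ht : t ≤ b) {f : ℝ × ℝ → ℝ} (hf : Continuous f) :
    Integrable (fun p => rhs P Q z p * f p) (box s t α β) := by
  refine (integrable_box_of_continuous hf).bdd_mul (c := C * B + C * C)
    h.measurable_rhs.aestronglyMeasurable (h.abs_rhs_le hc hab hαβ hs ht)

/-- First energy estimate. -/
lemma integral_sq_deriv_le (h : LinearEquation a b α β c C B P Q z) (hc : 0 < c) (hab : a < b)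
    (hαβ : α ≤ β) {ζ : ℝ → ℝ} {Z : ℝ}
    (hζ : ContDiff ℝ 1 ζ) (hζα : ζ α = 0) (hζβ : ζ β = 0)
    (hZ : ∀ x ∈ Icc α β, |ζ x| ≤ Z) (hZ' : ∀ x ∈ Icc α β, |deriv ζ x| ≤ Z) :
    ∫ p, deriv (z p.1) p.2 ^ 2 * ζ p.2 ^ 2 ∂box a b α β ≤
      2 / c * (((3 * C ^ 2 * Z) ^ 2 / (2 * c) + C ^ 3 * Z ^ 2) * (b - a) + C ^ 2 * Z ^ 2 / 2) *
        (β - α) := by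
  obtain ⟨hC, hB⟩ := h.bound_nonneg hab hαβ
  set K := (3 * C ^ 2 * Z) ^ 2 / (2 * c) + C ^ 3 * Z ^ 2 with hK
  have hzc : Continuous fun p : ℝ × ℝ => z p.1 p.2 := h.continuous
  have hzx := h.continuous_deriv
  have hζc := hζ.continuous
  have hi : Integrable (fun p => rhs P Q z p * (z p.1 p.2 * ζ p.2 ^ 2)) (box a b α β) :=
    h.integrable_rhs_mul hc hab hαβ le_rfl le_rfl (by fun_prop)
  have hi2 : Integrable (fun p => -(c / 2) * (deriv (z p.1) p.2 ^ 2 * ζ p.2 ^ 2) + K)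
    (box a b α β) := integrable_box_of_continuous (by fun_prop)
  have hi3 : Integrable (fun p => (deriv (z p.1) p.2 ^ 2 * ζ p.2 ^ 2))
    (box a b α β) := integrable_box_of_continuous (by fun_prop)
  have upper : ∫ p, rhs P Q z p * (z p.1 p.2 * ζ p.2 ^ 2) ∂box a b α β ≤
      ∫ p, (-(c / 2) * (deriv (z p.1) p.2 ^ 2 * ζ p.2 ^ 2) + K) ∂box a b α β := by
    unfold box
    rw [integral_prod _ hi, integral_prod _ hi2]
    refine integral_mono_ae hi.integral_prod_left hi2.integral_prod_left ?_
    rw [EventuallyLE, ae_restrict_iff' measurableSet_Ioc]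
    filter_upwards [h.second, h.abs_Q_le] with t h1 h2 ht'
    have ht : t ∈ Icc a b := Ioc_subset_Icc_self ht'
    have := integral_rhs_mul_le hαβ hc (h.differentiable t) (fun x hx => (h1 ht x hx).1)
      (fun x hx => (h1 ht x hx).2) (h.differentiable_P t) (h.continuous_deriv_P t)
      (h.measurable_Q.comp measurable_prodMk_left) (h.le_P t ht) (h.P_le t ht)
      (h.abs_deriv_P_le t ht) (h2 ht) (h.abs_le t ht)
      (hzx.comp (Continuous.prodMk_right t)) hζ hζα hζβ hZ hZ'
    simp only [intervalIntegral.integral_of_le hαβ] at this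
    have e1 : ∀ x, rhs P Q z (t, x) * (z t x * ζ x ^ 2) =
        (P t x * deriv (deriv (z t)) x + Q t x * z t x) * z t x * ζ x ^ 2 := fun x => by
      simp only [rhs]; ring
    simp only [e1]
    exact this
  have lower : ∫ x in Ioc α β, -(C ^ 2 * Z ^ 2 / 2) ≤
      ∫ p, rhs P Q z p * (z p.1 p.2 * ζ p.2 ^ 2) ∂box a b α β := by
    unfold box
    rw [integral_prod_symm _ hi]
    refine integral_mono_ae (integrable_const _) hi.integral_prod_right ?_
    have hsw : ∀ᵐ x ∂(volume.restrict (Ioc α β)), ∀ᵐ t ∂(volume.restrict (Ioc a b)),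
        HasDerivAt (fun t => z t x) (rhs P Q z (t, x)) t := by
      have := (h.ae_box le_rfl le_rfl).mono fun p hp => hp.2.2.2
      unfold box at this
      rw [← Measure.prod_swap] at this
      exact Measure.ae_ae_of_ae_prod (ae_of_ae_map measurable_swap.aemeasurable this)
    filter_upwards [hsw, ae_restrict_mem measurableSet_Ioc] with x hx hxm
    have hxm' := Ioc_subset_Icc_self hxm
    have hac : AbsolutelyContinuousOnInterval (fun t => z t x ^ 2) a b := by
      refine LipschitzOnWith.absolutelyContinuousOnInterval (K := Real.toNNReal (2 * C * B)) ?_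
      refine LipschitzOnWith.of_dist_le_mul fun t ht t' ht' => ?_
      rw [uIcc_of_le hab.le] at ht ht'
      rw [Real.coe_toNNReal _ (by positivity), Real.dist_eq, Real.dist_eq]
      have e1 := h.abs_le t ht x hxm'
      have e2 := h.abs_le t' ht' x hxm'
      have e3 := h.lipschitz x hxm' t ht t' ht'
      have e4 : |z t x + z t' x| ≤ 2 * C := (abs_add_le _ _).trans (by linarith)
      rw [sq_sub_sq, abs_mul, mul_assoc]
      gcongr
    have hftc := hac.sub_eq_integral (f' := fun t => 2 * (rhs P Q z (t, x) * z t x)) (by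
      rw [Measure.restrict_congr_set Ioc_ae_eq_Icc, ae_restrict_iff' measurableSet_Icc] at hx
      rw [uIcc_of_le hab.le]
      filter_upwards [hx] with t ht htm
      refine ((ht htm).pow 2).congr_deriv ?_
      simp only [Nat.cast_ofNat, Nat.add_one_sub_one, pow_one]
      ring)
    rw [intervalIntegral.integral_const_mul, intervalIntegral.integral_of_le hab.le] at hftc
    simp only [← mul_assoc]
    rw [integral_mul_const]
    have e1 := h.abs_le a ⟨le_rfl, hab.le⟩ x hxm'
    have e2 : z a x ^ 2 ≤ C ^ 2 := sq_le_sq' (neg_le_of_abs_le e1) (le_of_abs_le e1)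
    have e3 : ζ x ^ 2 ≤ Z ^ 2 :=
      sq_le_sq' (neg_le_of_abs_le (hZ x hxm')) (le_of_abs_le (hZ x hxm'))
    have e4 : -C ^ 2 / 2 ≤ ∫ t in Ioc a b, rhs P Q z (t, x) * z t x := by
      nlinarith [sq_nonneg (z b x)]
    nlinarith [mul_le_mul_of_nonneg_right e4 (sq_nonneg (ζ x)), sq_nonneg C]
  rw [integral_add (hi3.const_mul _) (integrable_const _), integral_const_mul] at upper
  have hvol : (box a b α β).real univ = (b - a) * (β - α) := by
    have : (univ : Set (ℝ × ℝ)) = univ ×ˢ univ := univ_prod_univ.symm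
    rw [box, this, measureReal_prod_prod]
    simp [hab.le, hαβ]
  have hvol2 : ∫ x in Ioc α β, -(C ^ 2 * Z ^ 2 / 2) = -(C ^ 2 * Z ^ 2 / 2) * (β - α) := by
    simp [hαβ]
    ring
  rw [integral_const, hvol, smul_eq_mul] at upper
  rw [hvol2] at lower
  rw [div_mul_eq_mul_div, div_mul_eq_mul_div, le_div_iff₀ hc]
  linarith

end LinearEquation

/-- For continuous `e`, the averages of backward differences converge to the difference. -/
lemma tendsto_integral_sub_shift {e : ℝ → ℝ} (he : Continuous e) (s t : ℝ) :
    Tendsto (fun σ => σ⁻¹ * ∫ r in s..t, (e r - e (r - σ))) (𝓝[>] 0) (𝓝 (e t - e s)) := by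
  have hE : ∀ x, HasDerivAt (fun y => ∫ r in (0:ℝ)..y, e r) (e x) x := fun x =>
    (he.integral_hasStrictDerivAt 0 x).hasDerivAt
  have hd : HasDerivAt (fun σ => (∫ r in (0:ℝ)..(s - σ), e r) - ∫ r in (0:ℝ)..(t - σ), e r)
      (e t - e s) 0 := by
    have h1 : ∀ x, HasDerivAt (fun σ => ∫ r in (0:ℝ)..(x - σ), e r) (-e x) 0 := fun x => by
      have : HasDerivAt (fun y => ∫ r in (0:ℝ)..y, e r) (e x) (x - 0) := by
        rw [sub_zero]; exact hE x
      exact this.comp_const_sub x 0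
    refine ((h1 s).sub (h1 t)).congr_deriv (by ring)
  have hii : ∀ x y, IntervalIntegrable e volume x y := fun x y => he.intervalIntegrable _ _
  refine hd.tendsto_slope_zero_right.congr fun σ => ?_
  rw [smul_eq_mul, zero_add, sub_zero, sub_zero, intervalIntegral.integral_sub (hii _ _)
    (Continuous.intervalIntegrable (by fun_prop) _ _), intervalIntegral.integral_comp_sub_right,
    ← intervalIntegral.integral_interval_sub_left (hii 0 t) (hii 0 s),
    ← intervalIntegral.integral_interval_sub_left (hii 0 (t - σ)) (hii 0 (s - σ))]
  ring

namespace LinearEquation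

variable {a b α β c C B : ℝ} {P Q z : ℝ → ℝ → ℝ}

lemma continuous_energy (h : LinearEquation a b α β c C B P Q z) {η : ℝ → ℝ} (hη : Continuous η) :
    Continuous fun t => ∫ x in α..β, deriv (z t) x ^ 2 * η x := by
  have hzx := h.continuous_deriv
  refine intervalIntegral.continuous_parametric_intervalIntegral_of_continuous'
    (f := fun t x => deriv (z t) x ^ 2 * η x) ?_ α β
  change Continuous fun p : ℝ × ℝ => deriv (z p.1) p.2 ^ 2 * η p.2
  fun_prop

/-- The energy inequality for the spatial derivative. -/
lemma energy_add_integral_le (h : LinearEquation a b α β c C B P Q z) (hab : a < b)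
    (hαβ : α ≤ β) {η : ℝ → ℝ} (hη : ContDiff ℝ 1 η) (hηα : η α = 0) (hηβ : η β = 0)
    (hη0 : ∀ x, 0 ≤ η x) {s t : ℝ} (hs : a < s) (hst : s ≤ t) (ht : t ≤ b) :
    ∫ p, (deriv (deriv (z p.1)) p.2 * η p.2 + deriv (z p.1) p.2 * deriv η p.2) * rhs P Q z p
      ∂box s t α β ≤
    -(1 / 2) * ((∫ x in α..β, deriv (z t) x ^ 2 * η x) -
      ∫ x in α..β, deriv (z s) x ^ 2 * η x) := by
  obtain ⟨hC, hB⟩ := h.bound_nonneg hab hαβ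
  have hzc : Continuous fun p : ℝ × ℝ => z p.1 p.2 := h.continuous
  have hzx := h.continuous_deriv
  have hηc := hη.continuous
  have hη' : Continuous (deriv η) := hη.continuous_deriv le_rfl
  set A : ℝ × ℝ → ℝ := fun p =>
    deriv (deriv (z p.1)) p.2 * η p.2 + deriv (z p.1) p.2 * deriv η p.2 with hA
  set e : ℝ → ℝ := fun t => ∫ x in α..β, deriv (z t) x ^ 2 * η x with he
  have hec : Continuous e := h.continuous_energy hηc
  have hAi : Integrable A (box s t α β) := by
    refine Integrable.add ?_ (integrable_box_of_continuous (by fun_prop))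
    refine (integrable_box_of_continuous (f := fun p => η p.2) (by fun_prop)).bdd_mul (c := B)
      h.measurable_second.aestronglyMeasurable ?_
    exact (h.ae_box hs.le ht).mono fun p hp => hp.2.1
  have hAm : Measurable A := by
    refine (h.measurable_second.mul (by fun_prop)).add (hzx.measurable.mul (by fun_prop))
  set D : ℝ → ℝ × ℝ → ℝ := fun σ p => σ⁻¹ * (z p.1 p.2 - z (p.1 - σ) p.2) with hD
  have hDc : ∀ σ, Continuous (D σ) := fun σ => by
    have : Continuous fun p : ℝ × ℝ => z (p.1 - σ) p.2 :=
      hzc.comp (by fun_prop : Continuous fun p : ℝ × ℝ => (p.1 - σ, p.2))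
    simp only [hD]
    fun_prop
  have hσ : ∀ᶠ σ in 𝓝[>] (0:ℝ), 0 < σ ∧ σ < s - a := by
    filter_upwards [self_mem_nhdsWithin,
      mem_nhdsWithin_of_mem_nhds (Iio_mem_nhds (sub_pos.2 hs))] with σ h1 h2 using ⟨h1, h2⟩
  have hDb : ∀ σ, 0 < σ → σ < s - a → ∀ᵐ p ∂box s t α β, ‖D σ p‖ ≤ B := by
    intro σ h1 h2
    filter_upwards [ae_box_mem s t α β] with p hp
    have := h.lipschitz p.2 (Ioc_subset_Icc_self hp.2) p.1
      ⟨by linarith [hp.1.1], by linarith [hp.1.2]⟩ (p.1 - σ)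
      ⟨by linarith [hp.1.1], by linarith [hp.1.2]⟩
    rw [sub_sub_cancel, abs_of_pos h1] at this
    simp only [hD, Real.norm_eq_abs]
    rw [abs_mul, abs_inv, abs_of_pos h1, inv_mul_le_iff₀ h1, mul_comm σ]
    exact this
  have hlim1 : Tendsto (fun σ => ∫ p, A p * D σ p ∂box s t α β) (𝓝[>] 0)
      (𝓝 (∫ p, A p * rhs P Q z p ∂box s t α β)) := by
    refine tendsto_integral_filter_of_dominated_convergence (fun p => ‖A p‖ * B) ?_ ?_
      (hAi.norm.mul_const B) ?_
    · exact Eventually.of_forall fun σ => (hAm.mul (hDc σ).measurable).aestronglyMeasurable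
    · filter_upwards [hσ] with σ hσ
      filter_upwards [hDb σ hσ.1 hσ.2] with p hp
      rw [norm_mul]
      gcongr
    · filter_upwards [h.ae_box hs.le ht] with p hp
      refine Tendsto.const_mul _ ?_
      have hd : HasDerivAt (fun σ => - z (p.1 - σ) p.2) (rhs P Q z p) 0 := by
        have : HasDerivAt (fun t => z t p.2) (rhs P Q z p) (p.1 - 0) := by
          rw [sub_zero]; exact hp.2.2.2
        exact (this.comp_const_sub p.1 0).neg.congr_deriv (neg_neg _)
      refine hd.tendsto_slope_zero_right.congr fun σ => ?_
      simp only [hD, smul_eq_mul, zero_add, sub_zero]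
      ring
  have hlim2 := (tendsto_integral_sub_shift hec s t).const_mul (-(1 / 2))
  refine le_of_tendsto_of_tendsto hlim1 hlim2 ?_
  filter_upwards [hσ] with σ hσ
  have hADi : Integrable (fun p => A p * D σ p) (box s t α β) := by
    refine (hAi.norm.mul_const B).mono' (hAm.mul (hDc σ).measurable).aestronglyMeasurable ?_
    filter_upwards [hDb σ hσ.1 hσ.2] with p hp
    rw [norm_mul]
    gcongr
  have hei : Integrable (fun r => σ⁻¹ * (-(1 / 2) * (e r - e (r - σ))))
      (volume.restrict (Ioc s t)) := by
    have : Continuous fun r => σ⁻¹ * (-(1 / 2) * (e r - e (r - σ))) := by fun_prop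
    exact (this.intervalIntegrable s t).1
  have heq : -(1 / 2) * (σ⁻¹ * ∫ r in s..t, (e r - e (r - σ))) =
      ∫ r in Ioc s t, σ⁻¹ * (-(1 / 2) * (e r - e (r - σ))) := by
    rw [integral_const_mul, integral_const_mul, intervalIntegral.integral_of_le hst]
    ring
  rw [heq]
  unfold box at hADi ⊢
  rw [integral_prod _ hADi]
  refine integral_mono_ae hADi.integral_prod_left hei ?_
  rw [EventuallyLE, ae_restrict_iff' measurableSet_Ioc]
  filter_upwards [h.second] with r hr hrm
  have hrI : r ∈ Icc a b := ⟨by linarith [hrm.1], by linarith [hrm.2]⟩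
  have := integral_second_mul_sub_le hαβ (h.differentiable r)
    (hzx.comp (Continuous.prodMk_right r)) (fun x hx => (hr hrI x hx).1)
    (fun x hx => (hr hrI x hx).2) (h.differentiable (r - σ))
    (hzx.comp (Continuous.prodMk_right (r - σ))) hη hηα hηβ hη0
  rw [intervalIntegral.integral_of_le hαβ] at this
  have e1 : ∀ x, A (r, x) * D σ (r, x) = σ⁻¹ * ((deriv (deriv (z r)) x * η x +
      deriv (z r) x * deriv η x) * (z r x - z (r - σ) x)) := fun x => by
    simp only [hA, hD]; ring
  simp only [e1]
  rw [integral_const_mul]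
  exact mul_le_mul_of_nonneg_left this (inv_nonneg.2 hσ.1.le)

/-- Second energy estimate. -/
lemma energy_add_integral_sq_rhs_le (h : LinearEquation a b α β c C B P Q z) (hc : 0 < c)
    (hab : a < b) (hαβ : α ≤ β) {ζ : ℝ → ℝ} {Z : ℝ}
    (hζ : ContDiff ℝ 1 ζ) (hζα : ζ α = 0) (hζβ : ζ β = 0)
    (hZ : ∀ x ∈ Icc α β, |ζ x| ≤ Z) (hZ' : ∀ x ∈ Icc α β, |deriv ζ x| ≤ Z)
    {s t : ℝ} (hs : a < s) (hst : s ≤ t) (ht : t ≤ b) :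
    1 / 2 * (∫ x in α..β, deriv (z t) x ^ 2 * ζ x ^ 4) +
      1 / (2 * C) * ∫ p, rhs P Q z p ^ 2 * ζ p.2 ^ 4 ∂box s t α β ≤
    1 / 2 * (∫ x in α..β, deriv (z s) x ^ 2 * ζ x ^ 4) +
      16 * C * Z ^ 2 * (∫ p, deriv (z p.1) p.2 ^ 2 * ζ p.2 ^ 2 ∂box s t α β) +
      C ^ 5 / c ^ 2 * Z ^ 4 * ((t - s) * (β - α)) := by
  obtain ⟨hC, hB⟩ := h.bound_nonneg hab hαβ
  have hzc : Continuous fun p : ℝ × ℝ => z p.1 p.2 := h.continuous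
  have hzx := h.continuous_deriv
  have hζc := hζ.continuous
  have hζ' : Continuous (deriv ζ) := hζ.continuous_deriv le_rfl
  have hη : ContDiff ℝ 1 fun x => ζ x ^ 4 := hζ.pow 4
  have hηd : ∀ x, deriv (fun x => ζ x ^ 4) x = 4 * ζ x ^ 3 * deriv ζ x := fun x => by
    have := ((hζ.differentiable one_ne_zero x).hasDerivAt.fun_pow 4).deriv
    simpa using this
  have hmain := h.energy_add_integral_le hab hαβ hη (by simp [hζα]) (by simp [hζβ])
    (fun x => by positivity) hs hst ht
  simp only [hηd] at hmain
  have hi1 : Integrable (fun p => rhs P Q z p ^ 2 * ζ p.2 ^ 4) (box s t α β) := by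
    have := (h.integrable_rhs_mul hc hab hαβ hs.le ht (f := fun p => ζ p.2 ^ 4)
      (by fun_prop)).bdd_mul (c := C * B + C * C) h.measurable_rhs.aestronglyMeasurable
      (h.abs_rhs_le hc hab hαβ hs.le ht)
    refine this.congr (Eventually.of_forall fun p => ?_)
    simp only
    ring
  have hi2 : Integrable (fun p => deriv (z p.1) p.2 ^ 2 * ζ p.2 ^ 2) (box s t α β) :=
    integrable_box_of_continuous (by fun_prop)
  have hi3 : Integrable (fun p => (deriv (deriv (z p.1)) p.2 * ζ p.2 ^ 4 +
      deriv (z p.1) p.2 * (4 * ζ p.2 ^ 3 * deriv ζ p.2)) * rhs P Q z p) (box s t α β) := by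
    have h1 := (h.integrable_rhs_mul hc hab hαβ hs.le ht (f := fun p => ζ p.2 ^ 4)
      (by fun_prop)).bdd_mul (c := B) h.measurable_second.aestronglyMeasurable
      ((h.ae_box hs.le ht).mono fun p hp => hp.2.1)
    have h2 := h.integrable_rhs_mul hc hab hαβ hs.le ht
      (f := fun p => deriv (z p.1) p.2 * (4 * ζ p.2 ^ 3 * deriv ζ p.2)) (by fun_prop)
    refine (h1.add h2).congr (Eventually.of_forall fun p => ?_)
    simp only [Pi.add_apply]
    ring
  have hle : ∫ p, (1 / (2 * C) * (rhs P Q z p ^ 2 * ζ p.2 ^ 4) -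
      (16 * C * Z ^ 2 * (deriv (z p.1) p.2 ^ 2 * ζ p.2 ^ 2) + C ^ 5 / c ^ 2 * Z ^ 4))
      ∂box s t α β ≤ ∫ p, (deriv (deriv (z p.1)) p.2 * ζ p.2 ^ 4 +
      deriv (z p.1) p.2 * (4 * ζ p.2 ^ 3 * deriv ζ p.2)) * rhs P Q z p ∂box s t α β := by
    refine integral_mono_ae ((hi1.const_mul _).sub ((hi2.const_mul _).add (integrable_const _)))
      hi3 ?_
    filter_upwards [h.ae_box hs.le ht] with p hp
    have hP1 := h.le_P _ hp.1.1 _ hp.1.2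
    have hP2 := h.P_le _ hp.1.1 _ hp.1.2
    have hz := h.abs_le _ hp.1.1 _ hp.1.2
    have hq := hp.2.2.1
    have hζ1 := hZ _ hp.1.2
    have hζ2 := hZ' _ hp.1.2
    have hw : rhs P Q z p = P p.1 p.2 * deriv (deriv (z p.1)) p.2 + Q p.1 p.2 * z p.1 p.2 := rfl
    set w := rhs P Q z p
    generalize deriv (deriv (z p.1)) p.2 = f2 at *
    generalize deriv (z p.1) p.2 = f1 at *
    generalize P p.1 p.2 = P' at *
    generalize Q p.1 p.2 = Q' at *
    generalize z p.1 p.2 = z' at *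
    generalize ζ p.2 = y at *
    generalize deriv ζ p.2 = y' at *
    have hP0 : 0 < P' := hc.trans_le hP1
    have hC0 : 0 < C := hP0.trans_le hP2
    have hZ0 : 0 ≤ Z := (abs_nonneg _).trans hζ1
    have hf2 : f2 = (w - Q' * z') / P' := by rw [hw]; field_simp; ring
    have hy4 : y ^ 4 ≤ Z ^ 4 := by
      rw [← abs_of_nonneg (by positivity : 0 ≤ y ^ 4), abs_pow]; gcongr
    have hy2 : y' ^ 2 ≤ Z ^ 2 := by
      rw [← abs_of_nonneg (by positivity : 0 ≤ y' ^ 2), abs_pow]; gcongr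
    have hQz : (Q' * z' / P') ^ 2 ≤ C ^ 4 / c ^ 2 := by
      rw [div_pow]
      have : (Q' * z') ^ 2 ≤ C ^ 4 := by
        rw [← abs_of_nonneg (by positivity : 0 ≤ (Q' * z') ^ 2), abs_pow, abs_mul]
        calc _ ≤ (C * C) ^ 2 := by gcongr
          _ = _ := by ring
      gcongr
    have h1 : 1 / C * w ^ 2 ≤ 1 / P' * w ^ 2 := by gcongr
    have h2 : Q' * z' / P' * w ≤ 1 / (4 * C) * w ^ 2 + C * (Q' * z' / P') ^ 2 := by
      have : 1 / (4 * C) * w ^ 2 + C * (Q' * z' / P') ^ 2 - Q' * z' / P' * w =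
        (w - 2 * C * (Q' * z' / P')) ^ 2 / (4 * C) := by field_simp; ring
      have h0 : 0 ≤ (w - 2 * C * (Q' * z' / P')) ^ 2 / (4 * C) := by positivity
      linarith
    have h3 : -(f1 * (4 * y ^ 3 * y') * w) ≤
        1 / (4 * C) * (w ^ 2 * y ^ 4) + 16 * C * y' ^ 2 * (f1 ^ 2 * y ^ 2) := by
      have : 1 / (4 * C) * (w ^ 2 * y ^ 4) + 16 * C * y' ^ 2 * (f1 ^ 2 * y ^ 2) -
        (-(f1 * (4 * y ^ 3 * y') * w)) = (w * y ^ 2 + 8 * C * y' * f1 * y) ^ 2 / (4 * C) := by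
        field_simp; ring
      have h0 : 0 ≤ (w * y ^ 2 + 8 * C * y' * f1 * y) ^ 2 / (4 * C) := by positivity
      linarith
    have h4 : 16 * C * y' ^ 2 * (f1 ^ 2 * y ^ 2) ≤ 16 * C * Z ^ 2 * (f1 ^ 2 * y ^ 2) := by gcongr
    have h5 : C * (Q' * z' / P') ^ 2 * y ^ 4 ≤ C ^ 5 / c ^ 2 * Z ^ 4 := by
      calc _ ≤ C * (C ^ 4 / c ^ 2) * Z ^ 4 := by gcongr
        _ = _ := by ring
    have h6 : (1 / C * w ^ 2) * y ^ 4 - (1 / (4 * C) * w ^ 2 + C * (Q' * z' / P') ^ 2) * y ^ 4 ≤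
        f2 * w * y ^ 4 := by
      have : f2 * w = 1 / P' * w ^ 2 - Q' * z' / P' * w := by rw [hf2]; field_simp
      rw [this, sub_mul]
      gcongr
    have h7 : 1 / C * w ^ 2 = 1 / (2 * C) * w ^ 2 + 2 * (1 / (4 * C) * w ^ 2) := by
      field_simp; ring
    have h8 : 1 / (2 * C) * (w ^ 2 * y ^ 4) =
        (1 / C * w ^ 2) * y ^ 4 - 2 * (1 / (4 * C) * (w ^ 2 * y ^ 4)) := by
      rw [h7]; ring
    have h9 : (1 / (4 * C) * w ^ 2 + C * (Q' * z' / P') ^ 2) * y ^ 4 =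
        1 / (4 * C) * (w ^ 2 * y ^ 4) + C * (Q' * z' / P') ^ 2 * y ^ 4 := by ring
    have h10 : (f2 * y ^ 4 + f1 * (4 * y ^ 3 * y')) * w =
        f2 * w * y ^ 4 + f1 * (4 * y ^ 3 * y') * w := by ring
    rw [h8, h10]
    rw [h9] at h6
    linarith only [h3, h4, h5, h6]
  have hvol : (box s t α β).real univ = (t - s) * (β - α) := by
    have : (univ : Set (ℝ × ℝ)) = univ ×ˢ univ := univ_prod_univ.symm
    rw [box, this, measureReal_prod_prod]
    simp [hst, hαβ]
  have hi4 : Integrable (fun p => 16 * C * Z ^ 2 * (deriv (z p.1) p.2 ^ 2 * ζ p.2 ^ 2) +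
      C ^ 5 / c ^ 2 * Z ^ 4) (box s t α β) := (hi2.const_mul _).add (integrable_const _)
  rw [integral_sub (hi1.const_mul _) hi4,
    integral_add (hi2.const_mul _) (integrable_const _), integral_const_mul, integral_const_mul,
    integral_const, hvol, smul_eq_mul] at hle
  linarith

/-- Uniform local energy bound, at the final time and in the mean. -/
theorem exists_energy_bound (hc : 0 < c) {m : ℝ} (ham : a < m) (hmb : m < b)
    (hαβ : α ≤ β) {ζ : ℝ → ℝ} (hζ : ContDiff ℝ 1 ζ) (hζα : ζ α = 0) (hζβ : ζ β = 0) (C : ℝ) :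
    ∃ K, ∀ P Q z B, LinearEquation a b α β c C B P Q z →
      (∀ t ∈ Icc m b, ∫ x in α..β, deriv (z t) x ^ 2 * ζ x ^ 4 ≤ K) ∧
      ∫ p, rhs P Q z p ^ 2 * ζ p.2 ^ 4 ∂box m b α β ≤ K := by
  have hab := ham.trans hmb
  have hζ' : Continuous (deriv ζ) := hζ.continuous_deriv le_rfl
  have hζc := hζ.continuous
  obtain ⟨Z₁, hZ₁⟩ := (isCompact_Icc (a := α) (b := β)).exists_bound_of_continuousOn hζc.continuousOn
  obtain ⟨Z₂, hZ₂⟩ := (isCompact_Icc (a := α) (b := β)).exists_bound_of_continuousOn hζ'.continuousOn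
  set Z := max Z₁ Z₂ with hZdef
  have hZ : ∀ x ∈ Icc α β, |ζ x| ≤ Z := fun x hx => (hZ₁ x hx).trans (le_max_left _ _)
  have hZ' : ∀ x ∈ Icc α β, |deriv ζ x| ≤ Z := fun x hx => (hZ₂ x hx).trans (le_max_right _ _)
  set K₁ := 2 / c * (((3 * C ^ 2 * Z) ^ 2 / (2 * c) + C ^ 3 * Z ^ 2) * (b - a) +
    C ^ 2 * Z ^ 2 / 2) * (β - α) with hK₁
  set K₂ := 1 / 2 * ((m - a)⁻¹ * (Z ^ 2 * K₁)) + 16 * C * Z ^ 2 * K₁ +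
    C ^ 5 / c ^ 2 * Z ^ 4 * ((b - a) * (β - α)) with hK₂
  refine ⟨max (2 * K₂) (2 * C * K₂), fun P Q z B h => ?_⟩
  obtain ⟨hC, hB⟩ := h.bound_nonneg hab hαβ
  have hzx := h.continuous_deriv
  have hE1 := h.integral_sq_deriv_le hc hab hαβ hζ hζα hζβ hZ hZ'
  have hC0 : 0 < C := hc.trans_le ((h.le_P a ⟨le_rfl, hab.le⟩ α ⟨le_rfl, hαβ⟩).trans
    (h.P_le a ⟨le_rfl, hab.le⟩ α ⟨le_rfl, hαβ⟩))
  have hi2 : ∀ s t, Integrable (fun p => deriv (z p.1) p.2 ^ 2 * ζ p.2 ^ 2) (box s t α β) :=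
    fun s t => integrable_box_of_continuous (by fun_prop)
  have hmono : ∀ {s t s' t'}, s' ≤ s → t ≤ t' → box s t α β ≤ box s' t' α β :=
    fun h1 h2 => Measure.prod_mono (Measure.restrict_mono (Ioc_subset_Ioc h1 h2) le_rfl) le_rfl
  have hE1' : ∀ s t, a ≤ s → t ≤ b →
      ∫ p, deriv (z p.1) p.2 ^ 2 * ζ p.2 ^ 2 ∂box s t α β ≤ K₁ := fun s t hs ht =>
    (integral_mono_measure (hmono hs ht) (Eventually.of_forall fun p => by positivity)
      (hi2 a b)).trans hE1
  have hec := h.continuous_energy (η := fun x => ζ x ^ 4) (by fun_prop)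
  obtain ⟨s, hs, hes⟩ : ∃ s ∈ Ioo a m, ∫ x in α..β, deriv (z s) x ^ 2 * ζ x ^ 4 ≤
      (m - a)⁻¹ * (Z ^ 2 * K₁) := by
    obtain ⟨s, hs, hle⟩ := exists_le_setAverage (μ := volume) (s := Ioo a m)
      (f := fun t => ∫ x in α..β, deriv (z t) x ^ 2 * ζ x ^ 4) (by simp [ham]) (by simp)
      ((hec.integrableOn_Icc (a := a) (b := m)).mono_set Ioo_subset_Icc_self)
    refine ⟨s, hs, hle.trans ?_⟩
    rw [setAverage_eq, smul_eq_mul, measureReal_def, Real.volume_Ioo,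
      ENNReal.toReal_ofReal (sub_nonneg.2 ham.le), ← integral_Ioc_eq_integral_Ioo,
      ← intervalIntegral.integral_of_le ham.le]
    have hi4 : Integrable (fun p => deriv (z p.1) p.2 ^ 2 * ζ p.2 ^ 4) (box a m α β) :=
      integrable_box_of_continuous (by fun_prop)
    rw [← integral_box ham.le hαβ hi4]
    refine mul_le_mul_of_nonneg_left ?_ (inv_nonneg.2 (sub_nonneg.2 ham.le))
    refine le_trans ?_ (mul_le_mul_of_nonneg_left (hE1' a m le_rfl hmb.le) (sq_nonneg Z))
    rw [← integral_const_mul]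
    refine integral_mono_ae hi4 ((hi2 a m).const_mul _) ?_
    filter_upwards [ae_box_mem a m α β] with p hp
    have h1 := hZ p.2 (Ioc_subset_Icc_self hp.2)
    have h2 : ζ p.2 ^ 2 ≤ Z ^ 2 := sq_le_sq' (neg_le_of_abs_le h1) (le_of_abs_le h1)
    have : deriv (z p.1) p.2 ^ 2 * ζ p.2 ^ 4 =
      ζ p.2 ^ 2 * (deriv (z p.1) p.2 ^ 2 * ζ p.2 ^ 2) := by ring
    rw [this]
    gcongr
  have hfin : ∀ t ∈ Icc m b, 1 / 2 * (∫ x in α..β, deriv (z t) x ^ 2 * ζ x ^ 4) +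
      1 / (2 * C) * ∫ p, rhs P Q z p ^ 2 * ζ p.2 ^ 4 ∂box s t α β ≤ K₂ := by
    intro t ht
    have h1 := h.energy_add_integral_sq_rhs_le hc hab hαβ hζ hζα hζβ hZ hZ' hs.1
      (hs.2.le.trans ht.1) ht.2
    have h2 := hE1' s t hs.1.le ht.2
    refine h1.trans ?_
    rw [hK₂]
    have h3 : t - s ≤ b - a := by linarith [ht.2, hs.1]
    have h4 : 0 ≤ β - α := sub_nonneg.2 hαβ
    gcongr
  have hn1 : ∀ t, 0 ≤ ∫ x in α..β, deriv (z t) x ^ 2 * ζ x ^ 4 := fun t =>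
    intervalIntegral.integral_nonneg hαβ fun x _ => by positivity
  have hn2 : ∀ s t, 0 ≤ ∫ p, rhs P Q z p ^ 2 * ζ p.2 ^ 4 ∂box s t α β := fun s t =>
    integral_nonneg fun p => by positivity
  constructor
  · intro t ht
    have h1 := hfin t ht
    have h2 := mul_nonneg (by positivity : 0 ≤ 1 / (2 * C)) (hn2 s t)
    exact le_max_of_le_left (by linarith)
  · have h1 := hfin b ⟨hmb.le, le_rfl⟩
    have h2 := hn1 b
    have h3 : ∫ p, rhs P Q z p ^ 2 * ζ p.2 ^ 4 ∂box m b α β ≤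
        ∫ p, rhs P Q z p ^ 2 * ζ p.2 ^ 4 ∂box s b α β := by
      refine integral_mono_measure (hmono hs.2.le le_rfl)
        (Eventually.of_forall fun p => by positivity) ?_
      have := (h.integrable_rhs_mul hc hab hαβ hs.1.le le_rfl (f := fun p => ζ p.2 ^ 4)
        (by fun_prop)).bdd_mul (c := C * B + C * C) h.measurable_rhs.aestronglyMeasurable
        (h.abs_rhs_le hc hab hαβ hs.1.le le_rfl)
      refine this.congr (Eventually.of_forall fun p => ?_)
      simp only
      ring
    refine le_max_of_le_right (h3.trans ?_)
    have h4 : 1 / (2 * C) * ∫ p, rhs P Q z p ^ 2 * ζ p.2 ^ 4 ∂box s b α β ≤ K₂ := by linarith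
    rwa [one_div, inv_mul_le_iff₀ (by positivity)] at h4

end LinearEquation

lemma exists_young_le {K η : ℝ} (hK : 0 ≤ K) (hη : 0 < η) :
    ∃ l > 0, ∃ δ > 0, ∀ d ≤ δ, l * K / 2 + d / (2 * l) ≤ η := by
  refine ⟨η / (K + 1), by positivity, η * (η / (K + 1)), by positivity, fun d hd => ?_⟩
  have hl : 0 < η / (K + 1) := by positivity
  have h1 : η / (K + 1) * K ≤ η := by
    rw [div_mul_eq_mul_div, div_le_iff₀ (by positivity)]
    nlinarith
  have h2 : d / (2 * (η / (K + 1))) ≤ η / 2 := by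
    rw [div_le_iff₀ (by positivity)]
    linarith
  linarith

lemma abs_le_young {l : ℝ} (hl : 0 < l) (f : ℝ) : |f| ≤ l * f ^ 2 / 2 + 1 / (2 * l) := by
  have : l * f ^ 2 / 2 + 1 / (2 * l) - |f| = (l * |f| - 1) ^ 2 / (2 * l) := by
    rw [← sq_abs f]; field_simp; ring
  have h0 : 0 ≤ (l * |f| - 1) ^ 2 / (2 * l) := by positivity
  linarith

namespace LinearEquation

variable {a b α β c C B : ℝ} {P Q z : ℝ → ℝ → ℝ}

lemma box_real_univ {a b α β : ℝ} (hab : a ≤ b) (hαβ : α ≤ β) :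
    (box a b α β).real univ = (b - a) * (β - α) := by
  have : (univ : Set (ℝ × ℝ)) = univ ×ˢ univ := univ_prod_univ.symm
  rw [box, this, measureReal_prod_prod]
  simp [hab, hαβ]

lemma abs_sub_le_young {f : ℝ → ℝ} (hf : Differentiable ℝ f) (hf' : Continuous (deriv f))
    {α β K l x y : ℝ} (hK : ∫ x in α..β, deriv f x ^ 2 ≤ K) (hl : 0 < l) (hx : α ≤ x)
    (hxy : x ≤ y) (hy : y ≤ β) : |f y - f x| ≤ l * K / 2 + (y - x) / (2 * l) := by
  have h1 : f y - f x = ∫ v in x..y, deriv f v :=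
    (intervalIntegral.integral_deriv_eq_sub (fun v _ => hf v) (hf'.intervalIntegrable _ _)).symm
  have h2 : ∫ v in x..y, deriv f v ^ 2 ≤ K := by
    refine (intervalIntegral.integral_mono_interval hx hxy hy
      (Eventually.of_forall fun v => sq_nonneg (deriv f v))
      (Continuous.intervalIntegrable (by fun_prop) _ _)).trans hK
  rw [h1]
  calc |∫ v in x..y, deriv f v| ≤ ∫ v in x..y, |deriv f v| :=
        intervalIntegral.abs_integral_le_integral_abs hxy
    _ ≤ ∫ v in x..y, (l * deriv f v ^ 2 / 2 + 1 / (2 * l)) := by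
        refine intervalIntegral.integral_mono_on hxy (Continuous.intervalIntegrable (by fun_prop) _ _)
          (Continuous.intervalIntegrable (by fun_prop) _ _) fun v _ => abs_le_young hl _
    _ = l / 2 * (∫ v in x..y, deriv f v ^ 2) + (y - x) / (2 * l) := by
        rw [intervalIntegral.integral_add (Continuous.intervalIntegrable (by fun_prop) _ _)
          (Continuous.intervalIntegrable (by fun_prop) _ _), intervalIntegral.integral_const,
          ← intervalIntegral.integral_const_mul, smul_eq_mul, mul_one_div]
        simp only [mul_div_right_comm]
    _ ≤ l / 2 * K + (y - x) / (2 * l) := by gcongr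
    _ = _ := by ring

lemma integral_abs_sub_le_young (h : LinearEquation a b α β c C B P Q z) (hc : 0 < c) (hab : a < b)
    (hαβ : α ≤ β) {m α' β' K l s t : ℝ} (hm : a ≤ m) (hα : α ≤ α') (hαβ' : α' ≤ β') (hβ : β' ≤ β)
    (hK : ∫ p, rhs P Q z p ^ 2 ∂box m b α' β' ≤ K) (hl : 0 < l) (hs : m ≤ s) (hst : s ≤ t)
    (ht : t ≤ b) :
    ∫ y in α'..β', |z t y - z s y| ≤ l * K / 2 + (t - s) * (β' - α') / (2 * l) := by
  obtain ⟨hC, hB⟩ := h.bound_nonneg hab hαβ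
  have hzc : Continuous fun p : ℝ × ℝ => z p.1 p.2 := h.continuous
  have hle : ∀ {s t}, a ≤ s → t ≤ b → box s t α' β' ≤ box a b α β := fun h1 h2 =>
    Measure.prod_mono (Measure.restrict_mono (Ioc_subset_Ioc h1 h2) le_rfl)
      (Measure.restrict_mono (Ioc_subset_Ioc hα hβ) le_rfl)
  have hbd := h.abs_rhs_le hc hab hαβ le_rfl le_rfl
  have hi1 : ∀ {s t}, a ≤ s → t ≤ b → Integrable (fun p => |rhs P Q z p|) (box s t α' β') :=
    fun h1 h2 => (Integrable.of_bound h.measurable_rhs.aestronglyMeasurable _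
      (hbd.filter_mono (ae_mono (hle h1 h2)))).abs
  have hi2 : ∀ {s t}, a ≤ s → t ≤ b → Integrable (fun p => rhs P Q z p ^ 2) (box s t α' β') := by
    intro s t h1 h2
    refine (Integrable.of_bound (h.measurable_rhs.pow_const 2).aestronglyMeasurable
      ((C * B + C * C) ^ 2)
      ((hbd.filter_mono (ae_mono (hle h1 h2))).mono fun p hp => ?_))
    rw [norm_pow]
    exact pow_le_pow_left₀ (norm_nonneg _) hp 2
  have has : a ≤ s := hm.trans hs
  have h1 : ∫ y in α'..β', |z t y - z s y| ≤ ∫ p, |rhs P Q z p| ∂box s t α' β' := by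
    rw [intervalIntegral.integral_of_le hαβ']
    have hi := hi1 has ht
    unfold box at hi ⊢
    rw [integral_prod_symm _ hi]
    refine integral_mono_ae ?_ hi.integral_prod_right ?_
    · exact (Continuous.intervalIntegrable (by fun_prop) _ _ : IntervalIntegrable
        (fun y => |z t y - z s y|) volume α' β').1
    have hsw : ∀ᵐ x ∂(volume.restrict (Ioc α β)), ∀ᵐ t ∂(volume.restrict (Ioc a b)),
        HasDerivAt (fun t => z t x) (rhs P Q z (t, x)) t := by
      have := (h.ae_box le_rfl le_rfl).mono fun p hp => hp.2.2.2
      unfold box at this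
      rw [← Measure.prod_swap] at this
      exact Measure.ae_ae_of_ae_prod (ae_of_ae_map measurable_swap.aemeasurable this)
    have hsw' := ae_restrict_of_ae_restrict_of_subset (Ioc_subset_Ioc hα hβ) hsw
    filter_upwards [hsw', ae_restrict_mem measurableSet_Ioc] with x hx hxm
    have hxm' : x ∈ Icc α β := ⟨hα.trans hxm.1.le, hxm.2.trans hβ⟩
    have hac : AbsolutelyContinuousOnInterval (fun t => z t x) s t := by
      refine LipschitzOnWith.absolutelyContinuousOnInterval (K := Real.toNNReal B) ?_
      refine LipschitzOnWith.of_dist_le_mul fun t₁ ht₁ t₂ ht₂ => ?_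
      rw [uIcc_of_le hst] at ht₁ ht₂
      rw [Real.coe_toNNReal _ hB, Real.dist_eq, Real.dist_eq]
      exact h.lipschitz x hxm' t₁ ⟨has.trans ht₁.1, ht₁.2.trans ht⟩ t₂
        ⟨has.trans ht₂.1, ht₂.2.trans ht⟩
    have hftc := hac.sub_eq_integral (f' := fun t => rhs P Q z (t, x)) (by
      rw [Measure.restrict_congr_set Ioc_ae_eq_Icc, ae_restrict_iff' measurableSet_Icc] at hx
      rw [uIcc_of_le hst]
      filter_upwards [hx] with r hr hrm
      exact hr ⟨has.trans hrm.1, hrm.2.trans ht⟩)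
    rw [hftc, ← intervalIntegral.integral_of_le hst]
    exact intervalIntegral.abs_integral_le_integral_abs hst
  have h2 : ∫ p, rhs P Q z p ^ 2 ∂box s t α' β' ≤ K := by
    refine (integral_mono_measure (Measure.prod_mono (Measure.restrict_mono
      (Ioc_subset_Ioc hs ht) le_rfl) le_rfl) (Eventually.of_forall fun p => sq_nonneg _)
      (hi2 hm le_rfl)).trans hK
  have hi3 : Integrable (fun p => l / 2 * rhs P Q z p ^ 2) (box s t α' β') :=
    (hi2 has ht).const_mul _
  calc _ ≤ ∫ p, |rhs P Q z p| ∂box s t α' β' := h1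
    _ ≤ ∫ p, (l / 2 * rhs P Q z p ^ 2 + 1 / (2 * l)) ∂box s t α' β' := by
        refine integral_mono (hi1 has ht) (hi3.add (integrable_const _)) fun p => ?_
        refine (abs_le_young hl (rhs P Q z p)).trans (le_of_eq ?_)
        ring
    _ = l / 2 * (∫ p, rhs P Q z p ^ 2 ∂box s t α' β') + (t - s) * (β' - α') / (2 * l) := by
        rw [integral_add hi3 (integrable_const _), integral_const_mul, integral_const,
          box_real_univ hst hαβ', smul_eq_mul, mul_one_div]
    _ ≤ l / 2 * K + (t - s) * (β' - α') / (2 * l) := by gcongr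
    _ = _ := by ring

/-- Solutions of linear equations with uniformly bounded coefficients are locally
equicontinuous. -/
theorem exists_modulus (hc : 0 < c) {m x₀ r : ℝ} (ham : a < m) (hmb : m < b) (hr : 0 < r) (C : ℝ)
    {ε : ℝ} (hε : 0 < ε) :
    ∃ δ > 0, ∀ P Q z B, LinearEquation a b (x₀ - r) (x₀ + r) c C B P Q z →
      ∀ t ∈ Icc m b, ∀ s ∈ Icc m b, ∀ x ∈ Icc (x₀ - r / 2) (x₀ + r / 2),
      ∀ y ∈ Icc (x₀ - r / 2) (x₀ + r / 2), |t - s| < δ → |x - y| < δ → |z t x - z s y| ≤ ε := by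
  set ζ : ℝ → ℝ := fun x => r ^ 2 - (x - x₀) ^ 2 with hζ
  have hζc : ContDiff ℝ 1 ζ := by fun_prop
  have hab := ham.trans hmb
  have hαβ : x₀ - r ≤ x₀ + r := by linarith
  obtain ⟨K, hK⟩ := exists_energy_bound hc ham hmb hαβ hζc (by simp [hζ]) (by simp [hζ]) C
  set k := (3 * r ^ 2 / 4) ^ 4 with hk
  have hk0 : 0 < k := by positivity
  have hζk : ∀ x ∈ Icc (x₀ - r / 2) (x₀ + r / 2), k ≤ ζ x ^ 4 := fun x hx => by
    have : (x - x₀) ^ 2 ≤ (r / 2) ^ 2 := sq_le_sq' (by linarith [hx.1]) (by linarith [hx.2])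
    refine pow_le_pow_left₀ (by positivity) ?_ 4
    simp only [hζ]; linarith
  set K' := max K 0 / k with hK'
  have hK'0 : 0 ≤ K' := by positivity
  have hKK : K ≤ k * K' := by
    rw [hK', mul_div_cancel₀ _ hk0.ne']; exact le_max_left _ _
  obtain ⟨l₁, hl₁, δ₁, hδ₁, H₁⟩ := exists_young_le hK'0 (by positivity : 0 < ε / 4)
  set ρ := min δ₁ (r / 2) with hρ
  have hρ0 : 0 < ρ := by positivity
  obtain ⟨l₂, hl₂, δ₂, hδ₂, H₂⟩ := exists_young_le hK'0 (by positivity : 0 < ρ * (ε / 8))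
  refine ⟨min ρ (δ₂ / r), by positivity, fun P Q z B h t ht s hs x hx y hy hts hxy => ?_⟩
  have hzc : Continuous fun p : ℝ × ℝ => z p.1 p.2 := h.continuous
  have hzx := h.continuous_deriv
  obtain ⟨E1, E2⟩ := hK P Q z B h
  have hαα : x₀ - r ≤ x₀ - r / 2 := by linarith
  have hββ : x₀ + r / 2 ≤ x₀ + r := by linarith
  have hαβ' : x₀ - r / 2 ≤ x₀ + r / 2 := by linarith
  have F1 : ∀ t ∈ Icc m b, ∫ x in (x₀ - r / 2)..(x₀ + r / 2), deriv (z t) x ^ 2 ≤ K' := by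
    intro t ht
    have hct : Continuous (deriv (z t)) := hzx.comp (Continuous.prodMk_right t)
    have hζ0 := hζc.continuous
    refine le_of_mul_le_mul_left (le_trans ?_ ((E1 t ht).trans hKK)) hk0
    rw [← intervalIntegral.integral_const_mul]
    refine (intervalIntegral.integral_mono_on hαβ'
      (Continuous.intervalIntegrable (by fun_prop) _ _)
      (g := fun x => deriv (z t) x ^ 2 * ζ x ^ 4)
      (Continuous.intervalIntegrable (by fun_prop) _ _) fun x hx => ?_).trans
      (intervalIntegral.integral_mono_interval hαα hαβ' hββ
      (Eventually.of_forall fun v => by positivity)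
      (Continuous.intervalIntegrable (by fun_prop) _ _))
    rw [mul_comm]
    exact mul_le_mul_of_nonneg_left (hζk x hx) (sq_nonneg _)
  have F2 : ∫ p, rhs P Q z p ^ 2 ∂box m b (x₀ - r / 2) (x₀ + r / 2) ≤ K' := by
    have hi : Integrable (fun p => rhs P Q z p ^ 2 * ζ p.2 ^ 4)
        (box m b (x₀ - r) (x₀ + r)) := by
      have hζ0 := hζc.continuous
      have := (h.integrable_rhs_mul hc hab hαβ ham.le le_rfl (f := fun p => ζ p.2 ^ 4)
        (by fun_prop)).bdd_mul (c := C * B + C * C) h.measurable_rhs.aestronglyMeasurable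
        (h.abs_rhs_le hc hab hαβ ham.le le_rfl)
      refine this.congr (Eventually.of_forall fun p => ?_)
      simp only
      ring
    have hle : box m b (x₀ - r / 2) (x₀ + r / 2) ≤ box m b (x₀ - r) (x₀ + r) :=
      Measure.prod_mono le_rfl (Measure.restrict_mono (Ioc_subset_Ioc hαα hββ) le_rfl)
    have hi' := hi.mono_measure hle
    refine le_of_mul_le_mul_left (le_trans ?_ (E2.trans hKK)) hk0
    rw [← integral_const_mul]
    refine le_trans ?_ (integral_mono_measure hle
      (Eventually.of_forall fun p => by positivity) hi)
    refine integral_mono_of_nonneg (Eventually.of_forall fun p => by positivity) hi' ?_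
    filter_upwards [ae_box_mem m b (x₀ - r / 2) (x₀ + r / 2)] with p hp
    rw [mul_comm]
    exact mul_le_mul_of_nonneg_left (hζk _ (Ioc_subset_Icc_self hp.2)) (sq_nonneg _)
  have space : ∀ t ∈ Icc m b, ∀ x ∈ Icc (x₀ - r / 2) (x₀ + r / 2),
      ∀ y ∈ Icc (x₀ - r / 2) (x₀ + r / 2), |x - y| ≤ ρ → |z t x - z t y| ≤ ε / 4 := by
    intro t ht x hx y hy hxy
    wlog hle : y ≤ x generalizing x y
    · rw [abs_sub_comm]
      exact this y hy x hx (by rwa [abs_sub_comm]) (le_of_not_ge hle)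
    rw [abs_of_nonneg (sub_nonneg.2 hle)] at hxy
    exact (abs_sub_le_young (h.differentiable t) (hzx.comp (Continuous.prodMk_right t))
      (F1 t ht) hl₁ hy.1 hle hx.2).trans (H₁ _ (hxy.trans (min_le_left _ _)))
  have mean : ∫ y in (x₀ - r / 2)..(x₀ + r / 2), |z t y - z s y| ≤ ρ * (ε / 8) := by
    wlog hst : s ≤ t generalizing s t
    · simp only [abs_sub_comm (z t _)]
      exact this s hs t ht (by rwa [abs_sub_comm]) (le_of_not_ge hst)
    refine (h.integral_abs_sub_le_young hc hab hαβ ham.le hαα hαβ' hββ F2 hl₂ hs.1 hst ht.2).trans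
      (H₂ _ ?_)
    rw [abs_of_nonneg (sub_nonneg.2 hst)] at hts
    have : t - s < δ₂ / r := hts.trans_le (min_le_right _ _)
    rw [lt_div_iff₀ hr] at this
    linarith
  have time : |z t x - z s x| ≤ 3 * ε / 4 := by
    by_contra! hlt
    obtain ⟨x₁, hx₁, hx₁', hxx⟩ : ∃ x₁, x₀ - r / 2 ≤ x₁ ∧ x₁ + ρ ≤ x₀ + r / 2 ∧
        x ∈ Icc x₁ (x₁ + ρ) := by
      have hρr : ρ ≤ r / 2 := min_le_right _ _
      rcases le_total x x₀ with h1 | h1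
      · exact ⟨x, hx.1, by linarith, le_rfl, by linarith⟩
      · exact ⟨x - ρ, by linarith, by linarith [hx.2], by linarith, by linarith⟩
    have hlow : ∀ y ∈ Icc x₁ (x₁ + ρ), ε / 4 ≤ |z t y - z s y| := by
      intro y hy
      have hym : y ∈ Icc (x₀ - r / 2) (x₀ + r / 2) := ⟨hx₁.trans hy.1, hy.2.trans hx₁'⟩
      have hd : |x - y| ≤ ρ := _root_.abs_le.2 ⟨by linarith [hxx.1, hy.2], by linarith [hxx.2, hy.1]⟩
      have h1 := space t ht x hx y hym hd
      have h2 := space s hs x hx y hym hd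
      have h3 : |z t x - z s x| ≤ |z t x - z t y| + |z t y - z s y| + |z s x - z s y| := by
        have e : z t x - z s x = (z t x - z t y) + (z t y - z s y) - (z s x - z s y) := by ring
        rw [e]
        exact (abs_sub _ _).trans (by linarith [abs_add_le (z t x - z t y) (z t y - z s y)])
      linarith
    have h1 : ∫ y in x₁..(x₁ + ρ), ε / 4 ≤ ∫ y in x₁..(x₁ + ρ), |z t y - z s y| :=
      intervalIntegral.integral_mono_on (by linarith) (by simp)
        (Continuous.intervalIntegrable (by fun_prop) _ _) hlow
    have h2 : ∫ y in x₁..(x₁ + ρ), |z t y - z s y| ≤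
        ∫ y in (x₀ - r / 2)..(x₀ + r / 2), |z t y - z s y| :=
      intervalIntegral.integral_mono_interval hx₁ (by linarith) hx₁'
        (Eventually.of_forall fun v => abs_nonneg (z t v - z s v))
        (Continuous.intervalIntegrable (by fun_prop) _ _)
    rw [intervalIntegral.integral_const, smul_eq_mul, add_sub_cancel_left] at h1
    have : 0 < ρ * ε := by positivity
    linarith
  have h1 := space s hs x hx y hy (hxy.le.trans (min_le_left _ _))
  have e : z t x - z s y = (z t x - z s x) + (z s x - z s y) := by ring
  rw [e]
  exact (abs_add_le _ _).trans (by linarith)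

end LinearEquation

namespace IsIntegratedSolution

variable {τ : ℝ} {g : ℝ → ℝ} {u : ℝ → ℝ → ℝ}

/-- Local Lipschitz continuity in time. -/
lemma exists_lipschitz_time (hu : IsIntegratedSolution τ g u) {t₀ : ℝ} (ht₀ : t₀ ∈ Ioo 0 τ) :
    ∃ a ∈ Ioo 0 t₀, ∃ b ∈ Ioo t₀ τ, ∃ L, 0 ≤ L ∧ ∀ t ∈ Icc a b, ∀ t' ∈ Icc a b,
      ∀ x, |u t x - u t' x| ≤ L * u t x * |t - t'| := by
  obtain ⟨a, ha, b, hb, K, hK, h⟩ := hu.exists_le_exp_mul_abs ht₀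
  refine ⟨a, ha, b, hb, K * Real.exp (K * (b - a)), by positivity, fun t ht t' ht' x => ?_⟩
  have h0 := hu.nonneg t x
  have hd : |t - t'| ≤ b - a := abs_le.2 ⟨by linarith [ht.1, ht'.2], by linarith [ht.2, ht'.1]⟩
  have h1 := h t ht t' ht' x
  have h2 := h t' ht' t ht x
  rw [abs_sub_comm] at h1
  set d := |t - t'|
  have hd0 : 0 ≤ d := abs_nonneg _
  have hex : Real.exp (K * d) ≤ Real.exp (K * (b - a)) := by gcongr
  have hKd : 0 ≤ K * d := by positivity
  have h3 : Real.exp (K * d) - 1 ≤ K * d * Real.exp (K * d) := by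
    have := Real.add_one_le_exp (-(K * d))
    have h4 : Real.exp (-(K * d)) * Real.exp (K * d) = 1 := by rw [← Real.exp_add]; simp
    nlinarith [Real.exp_pos (K * d)]
  have h5 : 1 - Real.exp (-(K * d)) ≤ K * d * Real.exp (K * d) := by
    have := Real.add_one_le_exp (-(K * d))
    have := Real.one_le_exp hKd
    nlinarith
  have h6 : u t x * Real.exp (-(K * d)) ≤ u t' x := by
    rw [Real.exp_neg, ← div_eq_mul_inv, div_le_iff₀ (Real.exp_pos _)]
    exact h2
  have h7 : u t x * (K * d * Real.exp (K * d)) ≤ K * Real.exp (K * (b - a)) * u t x * d := by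
    calc _ = (K * d * u t x) * Real.exp (K * d) := by ring
      _ ≤ (K * d * u t x) * Real.exp (K * (b - a)) := by gcongr
      _ = _ := by ring
  rw [abs_le]
  constructor
  · nlinarith [mul_le_mul_of_nonneg_left h3 h0]
  · nlinarith [mul_le_mul_of_nonneg_left h5 h0]

/-- Where the solution is Lipschitz in time and bounded below, its second derivative is bounded. -/
lemma ae_abs_second_le (hu : IsIntegratedSolution τ g u) {a b α β L c : ℝ} (ha : 0 ≤ a)
    (hab : a ≤ b) (hb : b ≤ τ) (hc : 0 < c) (hL0 : 0 ≤ L)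
    (hL : ∀ t ∈ Icc a b, ∀ t' ∈ Icc a b, ∀ x ∈ Icc α β, |u t x - u t' x| ≤ L * |t - t'|)
    (hcu : ∀ t ∈ Icc a b, ∀ x ∈ Icc α β, c ≤ u t x) :
    ∀ᵐ t, t ∈ Icc a b → ∀ x ∈ Ioo α β,
      DifferentiableAt ℝ (deriv (u t)) x ∧ |deriv (deriv (u t)) x| ≤ 2 * L / c := by
  have hτ : 0 ≤ τ := ha.trans (hab.trans hb)
  have hae : ∀ᵐ t, ∀ᵐ x, t ∈ Icc 0 τ → HasDerivAt (fun s => u s x)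
      (1 / 2 * u t x * deriv (deriv (u t)) x) t := Measure.ae_ae_of_ae_prod (hu.ae_hasDerivAt hτ)
  have hIoo : ∀ᵐ t : ℝ, t ∈ Icc a b → t ∈ Ioo a b :=
    Ioo_ae_eq_Icc.mem_iff.mono fun t ht h => ht.2 h
  filter_upwards [hae, hu.second, hIoo] with t h1 h2 h3 ht x hx
  have ht' : t ∈ Icc 0 τ := ⟨ha.trans ht.1, ht.2.trans hb⟩
  have hd := h2 ht'
  refine ⟨(hd x).1, ?_⟩
  have hbd : ∀ᵐ y, y ∈ Icc α β → |deriv (deriv (u t)) y| ≤ 2 * L / c := by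
    filter_upwards [h1] with y hy hyI
    have h4 : ‖1 / 2 * u t y * deriv (deriv (u t)) y‖ ≤ L := by
      refine (hy ht').le_of_lip' hL0 ?_
      filter_upwards [Ioo_mem_nhds (h3 ht).1 (h3 ht).2] with s hs
      exact hL s (Ioo_subset_Icc_self hs) t ht y hyI
    have h5 := hcu t ht y hyI
    rw [norm_mul, Real.norm_eq_abs, Real.norm_eq_abs,
      abs_of_nonneg (by linarith : 0 ≤ 1 / 2 * u t y)] at h4
    rw [le_div_iff₀ hc]
    nlinarith [abs_nonneg (deriv (deriv (u t)) y)]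
  have hm : Measurable (deriv (deriv (u t))) := hu.measurable_second.comp measurable_prodMk_left
  have hii : ∀ y z, IntervalIntegrable (deriv (deriv (u t))) volume y z := fun y z => by
    rw [intervalIntegrable_iff]
    exact Measure.integrableOn_of_bounded (M := g t) (by simp) hm.aestronglyMeasurable
      (Eventually.of_forall fun v => (hd v).2)
  refine (hd x).1.hasDerivAt.le_of_lip' (by positivity) ?_
  filter_upwards [Ioo_mem_nhds hx.1 hx.2] with y hy
  rw [← intervalIntegral.integral_eq_sub_of_hasDerivAt (fun v _ => (hd v).1.hasDerivAt) (hii x y)]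
  refine intervalIntegral.norm_integral_le_of_norm_le_const_ae ?_
  filter_upwards [hbd] with v hv hvm
  refine hv ?_
  rcases le_total x y with hxy | hxy
  · rw [uIoc_of_le hxy] at hvm
    exact ⟨hx.1.le.trans hvm.1.le, hvm.2.trans hy.2.le⟩
  · rw [uIoc_of_ge hxy] at hvm
    exact ⟨hy.1.le.trans hvm.1.le, hvm.2.trans hx.2.le⟩

/-- Forward difference quotients solve a linear equation. -/
lemma linearEquation_slope (hu : IsIntegratedSolution τ g u) {a b α β c L C C' σ : ℝ} (ha : 0 ≤ a)
    (hσ : 0 < σ) (hb : b + σ ≤ τ) (hC' : 0 ≤ C') (hL0 : 0 ≤ L)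
    (hL : ∀ t ∈ Icc a (b + σ), ∀ t' ∈ Icc a (b + σ), ∀ x ∈ Icc α β,
      |u t x - u t' x| ≤ L * |t - t'|)
    (hcu : ∀ t ∈ Icc a (b + σ), ∀ x ∈ Icc α β, c ≤ u t x)
    (huC : ∀ t ∈ Icc a (b + σ), ∀ x ∈ Icc α β, u t x ≤ C)
    (hu'C : ∀ t ∈ Icc a (b + σ), ∀ x ∈ Icc α β, |deriv (u t) x| ≤ C)
    (hu2 : ∀ᵐ t, t ∈ Icc a (b + σ) → ∀ x ∈ Icc α β,
      DifferentiableAt ℝ (deriv (u t)) x ∧ |deriv (deriv (u t)) x| ≤ C')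
    (hCC : C' ≤ C) (hLC : L ≤ C) :
    LinearEquation a b α β (c / 2) C (2 * (C' + L) / σ) (fun t x => 1 / 2 * u (t + σ) x)
      (fun t x => 1 / 2 * deriv (deriv (u t)) x) (fun t x => (u (t + σ) x - u t x) / σ) := by
  have huc : Continuous fun p : ℝ × ℝ => u p.1 p.2 := hu.continuous
  have huσ : Continuous fun p : ℝ × ℝ => u (p.1 + σ) p.2 :=
    huc.comp (by fun_prop : Continuous fun p : ℝ × ℝ => (p.1 + σ, p.2))
  have hux := hu.continuous_deriv
  have huxσ : Continuous fun p : ℝ × ℝ => deriv (u (p.1 + σ)) p.2 :=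
    hux.comp (by fun_prop : Continuous fun p : ℝ × ℝ => (p.1 + σ, p.2))
  have hz' : ∀ t, deriv (fun x => (u (t + σ) x - u t x) / σ) =
      fun x => (deriv (u (t + σ)) x - deriv (u t) x) / σ := fun t => by
    ext x
    exact (((hu.differentiable (t + σ) x).hasDerivAt.fun_sub
      (hu.differentiable t x).hasDerivAt).div_const σ).deriv
  have hz'' : ∀ t x, DifferentiableAt ℝ (deriv (u (t + σ))) x → DifferentiableAt ℝ (deriv (u t)) x →
      HasDerivAt (deriv (fun x => (u (t + σ) x - u t x) / σ))
        ((deriv (deriv (u (t + σ))) x - deriv (deriv (u t)) x) / σ) x := fun t x h1 h2 => by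
    rw [hz']
    exact (h1.hasDerivAt.fun_sub h2.hasDerivAt).div_const σ
  have hP' : ∀ t, deriv (fun x => 1 / 2 * u (t + σ) x) = fun x => 1 / 2 * deriv (u (t + σ)) x :=
    fun t => by
      ext x
      exact ((hu.differentiable (t + σ) x).hasDerivAt.const_mul (1 / 2)).deriv
  have hmem : ∀ t ∈ Icc a b, t ∈ Icc a (b + σ) ∧ t + σ ∈ Icc a (b + σ) := fun t ht =>
    ⟨⟨ht.1, by linarith [ht.2]⟩, ⟨by linarith [ht.1], by linarith [ht.2]⟩⟩
  have hu2σ := (measurePreserving_add_right volume σ).quasiMeasurePreserving.ae hu2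
  have hB : C' ≤ 2 * (C' + L) := by linarith
  have hsecond : ∀ᵐ t, t ∈ Icc a b → ∀ x ∈ Icc α β,
      (DifferentiableAt ℝ (deriv (u (t + σ))) x ∧ DifferentiableAt ℝ (deriv (u t)) x) ∧
      |deriv (deriv (u (t + σ))) x| ≤ C' ∧ |deriv (deriv (u t)) x| ≤ C' := by
    filter_upwards [hu2, hu2σ] with t h1 h2 ht x hx
    have h3 := h1 (hmem t ht).1 x hx
    have h4 := h2 (hmem t ht).2 x hx
    exact ⟨⟨h4.1, h3.1⟩, h4.2, h3.2⟩
  constructor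
  · change Continuous fun p : ℝ × ℝ => (u (p.1 + σ) p.2 - u p.1 p.2) / σ
    fun_prop
  · exact fun t => ((hu.differentiable (t + σ)).sub (hu.differentiable t)).div_const σ
  · simp only [hz']
    fun_prop
  · filter_upwards [hsecond] with t h1 ht x hx
    obtain ⟨⟨h3, h4⟩, h5, h6⟩ := h1 ht x hx
    refine ⟨(hz'' t x h3 h4).differentiableAt, ?_⟩
    rw [(hz'' t x h3 h4).deriv, abs_div, abs_of_pos hσ]
    gcongr
    exact (abs_sub _ _).trans (by linarith)
  · intro x hx t ht t' ht'
    have h1 := hL _ (hmem t ht).2 _ (hmem t' ht').2 x hx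
    have h2 := hL _ (hmem t ht).1 _ (hmem t' ht').1 x hx
    rw [add_sub_add_right_eq_sub] at h1
    have e : (u (t + σ) x - u t x) / σ - (u (t' + σ) x - u t' x) / σ =
      ((u (t + σ) x - u (t' + σ) x) - (u t x - u t' x)) / σ := by ring
    rw [e, abs_div, abs_of_pos hσ, div_mul_eq_mul_div]
    gcongr
    refine (abs_sub _ _).trans ?_
    nlinarith [abs_nonneg (t - t')]
  · rcases le_or_gt a b with hab | hab
    swap
    · exact Eventually.of_forall fun p hp => absurd (hp.1.trans hp.2) (not_le.2 hab)
    have hτ : 0 ≤ τ := by linarith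
    have h1 := hu.ae_hasDerivAt hτ
    have h2 := (measurePreserving_add_right (volume : Measure (ℝ × ℝ))
      (σ, (0:ℝ))).quasiMeasurePreserving.ae h1
    have h3 : ∀ᵐ p : ℝ × ℝ, p.1 ∈ Icc a b → ∀ x ∈ Icc α β,
        DifferentiableAt ℝ (deriv (u (p.1 + σ))) x ∧ DifferentiableAt ℝ (deriv (u p.1)) x :=
      Measure.quasiMeasurePreserving_fst.ae (p := fun r => r ∈ Icc a b → ∀ x ∈ Icc α β,
        DifferentiableAt ℝ (deriv (u (r + σ))) x ∧ DifferentiableAt ℝ (deriv (u r)) x)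
        (hsecond.mono fun t h ht x hx => (h ht x hx).1)
    filter_upwards [h1, h2, h3] with p h1 h2 h3 hp hx
    obtain ⟨h3, h4⟩ := h3 hp p.2 hx
    have h5 := h1 ⟨by linarith [hp.1], by linarith [hp.2]⟩
    have h6 := h2 ⟨by simp only [Prod.fst_add]; linarith [hp.1],
      by simp only [Prod.fst_add]; linarith [hp.2]⟩
    simp only [Prod.fst_add, Prod.snd_add, add_zero] at h6
    have h7 := h6.comp_add_const p.1 σ
    rw [(hz'' p.1 p.2 h3 h4).deriv]
    refine ((h7.fun_sub h5).div_const σ).congr_deriv ?_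
    field_simp
    ring
  · exact fun t => (hu.differentiable (t + σ)).const_mul _
  · intro t
    rw [hP']
    have : Continuous (deriv (u (t + σ))) := hux.comp (Continuous.prodMk_right (t + σ))
    fun_prop
  · exact (huσ.const_mul (1 / 2)).measurable
  · intro t ht x hx
    have := hcu _ (hmem t ht).2 x hx
    linarith
  · intro t ht x hx
    have := huC _ (hmem t ht).2 x hx
    have := hu.nonneg (t + σ) x
    linarith
  · intro t ht x hx
    have := hu'C _ (hmem t ht).2 x hx
    rw [hP', abs_mul, abs_of_pos (by norm_num : (0:ℝ) < 1 / 2)]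
    linarith [abs_nonneg (deriv (u (t + σ)) x)]
  · exact hu.measurable_second.const_mul (1 / 2)
  · filter_upwards [hsecond] with t h1 ht x hx
    obtain ⟨-, -, h6⟩ := h1 ht x hx
    rw [abs_mul, abs_of_pos (by norm_num : (0:ℝ) < 1 / 2)]
    linarith
  · intro t ht x hx
    have h1 := hL _ (hmem t ht).2 _ (hmem t ht).1 x hx
    rw [add_sub_cancel_left, abs_of_pos hσ] at h1
    rw [abs_div, abs_of_pos hσ, div_le_iff₀ hσ]
    exact h1.trans (mul_le_mul_of_nonneg_right hLC hσ.le)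

end IsIntegratedSolution

/-- If the difference quotients `D σ`, `σ → 0+`, are equicontinuous and converge on a dense set,
then they converge everywhere to a continuous limit. -/
lemma exists_tendsto_of_equicontinuous {X : Type*} [PseudoMetricSpace X] {D : ℝ → X → ℝ}
    {U : Set X} (hU : IsOpen U) {η : ℝ} (hη : 0 < η)
    (hD : ∀ ε > 0, ∃ δ > 0, ∀ σ ∈ Ioc 0 η, ∀ p ∈ U, ∀ q ∈ U, dist p q < δ → |D σ p - D σ q| ≤ ε)
    {S : Set X} (hS : Dense S) (hSD : ∀ q ∈ S, q ∈ U → ∃ d, Tendsto (D · q) (𝓝[>] 0) (𝓝 d)) :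
    ∃ R : X → ℝ, ContinuousOn R U ∧ ∀ p ∈ U, Tendsto (D · p) (𝓝[>] 0) (𝓝 (R p)) := by
  have hη' : Ioc 0 η ∈ 𝓝[>] (0:ℝ) := Ioc_mem_nhdsGT hη
  have hlim : ∀ p ∈ U, ∃ d, Tendsto (D · p) (𝓝[>] 0) (𝓝 d) := by
    intro p hp
    refine cauchy_map_iff_exists_tendsto.1 (Metric.cauchy_iff.2 ⟨inferInstance, fun ε hε => ?_⟩)
    obtain ⟨δ, hδ, h⟩ := hD (ε / 5) (by positivity)
    obtain ⟨q, ⟨hqU, hqp⟩, hqS⟩ := hS.inter_open_nonempty (U ∩ Metric.ball p δ)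
      (hU.inter Metric.isOpen_ball) ⟨p, hp, Metric.mem_ball_self hδ⟩
    obtain ⟨d, hd⟩ := hSD q hqS hqU
    have h1 := inter_mem hη' (hd (Metric.ball_mem_nhds d (by positivity : 0 < ε / 5)))
    refine ⟨_, image_mem_map h1, ?_⟩
    rintro _ ⟨σ, ⟨hσ, hσd⟩, rfl⟩ _ ⟨σ', ⟨hσ', hσd'⟩, rfl⟩
    have e1 := abs_le.1 (h σ hσ q hqU p hp hqp)
    have e2 := abs_le.1 (h σ' hσ' q hqU p hp hqp)
    have e3 : |D σ q - d| < ε / 5 := hσd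
    have e4 : |D σ' q - d| < ε / 5 := hσd'
    rw [abs_lt] at e3 e4
    rw [Real.dist_eq, abs_lt]
    constructor <;> linarith
  choose! R hR using hlim
  refine ⟨R, ?_, hR⟩
  rw [Metric.continuousOn_iff]
  intro p hp ε hε
  obtain ⟨δ, hδ, h⟩ := hD (ε / 2) (by positivity)
  refine ⟨δ, hδ, fun q hq hqp => ?_⟩
  have := le_of_tendsto ((hR q hq).sub (hR p hp)).abs (Filter.mem_of_superset hη'
    fun σ hσ => h σ hσ q hq p hp hqp)
  rw [Real.dist_eq]
  linarith

/-- A continuous right derivative is a derivative. -/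
lemma hasDerivAt_of_continuousOn_right {f R : ℝ → ℝ} {s t₀ t₁ : ℝ} (hs : s ∈ Ioo t₀ t₁)
    (hf : ContinuousOn f (Ioo t₀ t₁)) (hR : ContinuousOn R (Ioo t₀ t₁))
    (hfR : ∀ t ∈ Ioo t₀ t₁, HasDerivWithinAt f (R t) (Ioi t) t) : HasDerivAt f (R s) s := by
  obtain ⟨a, ha⟩ := exists_between hs.1
  have haI : a ∈ Ioo t₀ t₁ := ⟨ha.1, ha.2.trans hs.2⟩
  have hsub : ∀ t ∈ Ioo t₀ t₁, uIcc a t ⊆ Ioo t₀ t₁ := fun t ht =>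
    ordConnected_Ioo.uIcc_subset haI ht
  have hint : ∀ t ∈ Ioo t₀ t₁, IntervalIntegrable R volume a t := fun t ht =>
    (hR.mono (hsub t ht)).intervalIntegrable
  have heq : ∀ t ∈ Ioo t₀ t₁, f t = f a + ∫ r in a..t, R r := fun t ht => by
    rw [intervalIntegral.integral_eq_sub_of_hasDeriv_right (hf.mono (hsub t ht))
      (fun r hr => hfR r (hsub t ht (Ioo_subset_Icc_self hr))) (hint t ht)]
    ring
  have hnhds : Ioo t₀ t₁ ∈ 𝓝 s := Ioo_mem_nhds hs.1 hs.2
  have h1 := (intervalIntegral.integral_hasDerivAt_right (hint s hs)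
    (hR.stronglyMeasurableAtFilter isOpen_Ioo s hs) (hR.continuousAt hnhds)).const_add (f a)
  exact h1.congr_of_eventuallyEq (by filter_upwards [hnhds] with t ht using heq t ht)

namespace IsIntegratedSolution

variable {τ : ℝ} {g : ℝ → ℝ} {u : ℝ → ℝ → ℝ}

/-- Near a point where the solution is positive, forward difference quotients are
equicontinuous. -/
lemma exists_slope_modulus (hu : IsIntegratedSolution τ g u) {t₀ x₀ : ℝ} (ht₀ : t₀ ∈ Ioo 0 τ)
    (hpos : 0 < u t₀ x₀) :
    ∃ η > 0, (∀ p ∈ Metric.ball (t₀, x₀) η, p.1 ∈ Icc 0 τ) ∧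
      ∀ ε > 0, ∃ δ > 0, ∀ σ ∈ Ioc 0 η, ∀ p ∈ Metric.ball (t₀, x₀) η,
      ∀ q ∈ Metric.ball (t₀, x₀) η, dist p q < δ →
        |(u (p.1 + σ) p.2 - u p.1 p.2) / σ - (u (q.1 + σ) q.2 - u q.1 q.2) / σ| ≤ ε := by
  have huc : Continuous fun p : ℝ × ℝ => u p.1 p.2 := hu.continuous
  have hux := hu.continuous_deriv
  obtain ⟨a, ha, b, hb, L', hL'0, hL'⟩ := hu.exists_lipschitz_time ht₀
  set c := u t₀ x₀ / 2 with hc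
  have hc0 : 0 < c := by positivity
  obtain ⟨η₁, hη₁, hball⟩ := Metric.isOpen_iff.1 (isOpen_lt continuous_const huc :
    IsOpen {p : ℝ × ℝ | c < u p.1 p.2}) (t₀, x₀) (by simp only [mem_setOf_eq, hc]; linarith)
  obtain ⟨η, hη, hη1, hη2, hη3⟩ : ∃ η > 0, 4 * η ≤ η₁ ∧ 4 * η ≤ t₀ - a ∧ 4 * η ≤ b - t₀ := by
    have h1 : 0 < t₀ - a := sub_pos.2 ha.2
    have h2 : 0 < b - t₀ := sub_pos.2 hb.1
    refine ⟨min (η₁ / 4) (min ((t₀ - a) / 4) ((b - t₀) / 4)), by positivity, ?_, ?_, ?_⟩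
    · linarith [min_le_left (η₁ / 4) (min ((t₀ - a) / 4) ((b - t₀) / 4))]
    · linarith [(min_le_right (η₁ / 4) (min ((t₀ - a) / 4) ((b - t₀) / 4))).trans
        (min_le_left _ _)]
    · linarith [(min_le_right (η₁ / 4) (min ((t₀ - a) / 4) ((b - t₀) / 4))).trans
        (min_le_right _ _)]
  have hcpt : IsCompact (Icc (t₀ - η) (t₀ + 2 * η) ×ˢ Icc (x₀ - 2 * η) (x₀ + 2 * η)) :=
    isCompact_Icc.prod isCompact_Icc
  obtain ⟨C₁, hC₁⟩ := hcpt.exists_bound_of_continuousOn huc.continuousOn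
  obtain ⟨C₂, hC₂⟩ := hcpt.exists_bound_of_continuousOn hux.continuousOn
  have hmem0 : ((t₀, x₀) : ℝ × ℝ) ∈
      Icc (t₀ - η) (t₀ + 2 * η) ×ˢ Icc (x₀ - 2 * η) (x₀ + 2 * η) := by
    refine ⟨⟨?_, ?_⟩, ?_, ?_⟩ <;> simp only <;> linarith
  have hC₁0 : 0 ≤ C₁ := (norm_nonneg _).trans (hC₁ _ hmem0)
  have hC₂0 : 0 ≤ C₂ := (norm_nonneg _).trans (hC₂ _ hmem0)
  set L := L' * C₁ with hLdef
  have hL0 : 0 ≤ L := by positivity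
  have hL : ∀ t ∈ Icc (t₀ - η) (t₀ + 2 * η), ∀ t' ∈ Icc (t₀ - η) (t₀ + 2 * η),
      ∀ x ∈ Icc (x₀ - 2 * η) (x₀ + 2 * η), |u t x - u t' x| ≤ L * |t - t'| := by
    intro t ht t' ht' x hx
    have h1 := hL' t ⟨by linarith [ht.1], by linarith [ht.2]⟩ t'
      ⟨by linarith [ht'.1], by linarith [ht'.2]⟩ x
    have h2 : u t x ≤ C₁ := (le_abs_self _).trans (hC₁ (t, x) ⟨ht, hx⟩)
    refine h1.trans ?_
    rw [hLdef]
    gcongr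
  have hcu : ∀ t ∈ Icc (t₀ - η) (t₀ + 2 * η), ∀ x ∈ Icc (x₀ - 2 * η) (x₀ + 2 * η),
      c ≤ u t x := by
    intro t ht x hx
    refine (show c < u t x from hball (a := (t, x)) ?_).le
    rw [Metric.mem_ball, Prod.dist_eq, max_lt_iff, Real.dist_eq, Real.dist_eq, abs_lt, abs_lt]
    refine ⟨⟨?_, ?_⟩, ?_, ?_⟩ <;> simp only <;> linarith [ht.1, ht.2, hx.1, hx.2]
  have hu2 := hu.ae_abs_second_le (by linarith [ha.1]) (by linarith) (by linarith [hb.2]) hc0 hL0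
    hL hcu
  set C' := 2 * L / c
  have hC'0 : 0 ≤ C' := by positivity
  set C := C₁ + C₂ + C' + L with hC
  refine ⟨η / 2, by positivity, fun p hp => ?_, fun ε hε => ?_⟩
  · rw [Metric.mem_ball, Prod.dist_eq, max_lt_iff, Real.dist_eq, Real.dist_eq, abs_lt, abs_lt] at hp
    simp only at hp
    exact ⟨by linarith [hp.1.1, ha.1], by linarith [hp.1.2, hb.2]⟩
  obtain ⟨δ, hδ, H⟩ := LinearEquation.exists_modulus (a := t₀ - η) (b := t₀ + η)
    (c := c / 2) (m := t₀ - η / 2) (x₀ := x₀) (r := η) (by positivity) (by linarith)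
    (by linarith) hη C hε
  refine ⟨δ, hδ, fun σ hσ p hp q hq hpq => ?_⟩
  have hle := hu.linearEquation_slope (a := t₀ - η) (b := t₀ + η) (α := x₀ - η) (β := x₀ + η)
    (c := c) (L := L) (C := C) (C' := C') (σ := σ) (by linarith [ha.1]) hσ.1
    (by linarith [hσ.2, hb.2]) hC'0 hL0
  have htm : ∀ t ∈ Icc (t₀ - η) (t₀ + η + σ), t ∈ Icc (t₀ - η) (t₀ + 2 * η) := fun t ht =>
    ⟨ht.1, by linarith [ht.2, hσ.2]⟩
  have hxm : ∀ x ∈ Icc (x₀ - η) (x₀ + η), x ∈ Icc (x₀ - 2 * η) (x₀ + 2 * η) := fun x hx =>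
    ⟨by linarith [hx.1], by linarith [hx.2]⟩
  have hle' := hle (fun t ht t' ht' x hx => hL t (htm t ht) t' (htm t' ht') x (hxm x hx))
    (fun t ht x hx => hcu t (htm t ht) x (hxm x hx))
    (fun t ht x hx => ((le_abs_self _).trans (hC₁ (t, x) ⟨htm t ht, hxm x hx⟩)).trans
      (by linarith))
    (fun t ht x hx => (hC₂ (t, x) ⟨htm t ht, hxm x hx⟩).trans (by linarith))
    (hu2.mono fun t h ht x hx => h (htm t ht) x ⟨by linarith [hx.1], by linarith [hx.2]⟩)
    (by linarith) (by linarith)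
  rw [Metric.mem_ball, Prod.dist_eq, max_lt_iff, Real.dist_eq, Real.dist_eq, abs_lt, abs_lt] at hp hq
  simp only at hp hq
  rw [Prod.dist_eq, max_lt_iff, Real.dist_eq, Real.dist_eq] at hpq
  exact H _ _ _ _ hle' p.1 ⟨by linarith, by linarith⟩ q.1 ⟨by linarith, by linarith⟩ p.2
    ⟨by linarith, by linarith⟩ q.2 ⟨by linarith, by linarith⟩ hpq.1 hpq.2

/-- Near a point where it is positive, the solution is continuously differentiable in time. -/
lemma exists_hasDerivAt_of_pos (hu : IsIntegratedSolution τ g u) {t₀ x₀ : ℝ} (ht₀ : t₀ ∈ Ioo 0 τ)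
    (hpos : 0 < u t₀ x₀) :
    ∃ η > 0, ∃ R : ℝ × ℝ → ℝ, ContinuousOn R (Metric.ball (t₀, x₀) η) ∧
      ∀ p ∈ Metric.ball (t₀, x₀) η, HasDerivAt (fun s => u s p.2) (R p) p.1 := by
  obtain ⟨η, hη, hτ, hD⟩ := hu.exists_slope_modulus ht₀ hpos
  have hd := Measure.dense_of_ae (hu.ae_hasDerivAt (ht₀.1.trans ht₀.2).le)
  obtain ⟨R, hRc, hR⟩ := exists_tendsto_of_equicontinuous
    (D := fun σ p => (u (p.1 + σ) p.2 - u p.1 p.2) / σ) Metric.isOpen_ball hη hD hd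
    (fun q hq hqU => ⟨_, by
      refine (hq (hτ q hqU)).tendsto_slope_zero_right.congr fun σ => ?_
      rw [smul_eq_mul, div_eq_inv_mul]⟩)
  refine ⟨η, hη, R, hRc, fun p hp => ?_⟩
  rw [← ball_prod_same] at hRc hR hp
  rw [Real.ball_eq_Ioo] at hRc hR hp
  refine hasDerivAt_of_continuousOn_right (R := fun s => R (s, p.2)) hp.1 ?_ ?_ fun t ht => ?_
  · exact (hu.continuous.comp (Continuous.prodMk_left p.2)).continuousOn
  · exact hRc.comp (Continuous.prodMk_left p.2).continuousOn fun t ht => ⟨ht, hp.2⟩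
  · have h1 := hR (t, p.2) ⟨ht, hp.2⟩
    rw [hasDerivWithinAt_iff_tendsto_slope' (notMem_Ioi.2 le_rfl)]
    have h2 : Tendsto (fun s => s - t) (𝓝[>] t) (𝓝[>] 0) := by
      refine tendsto_nhdsWithin_iff.2 ⟨?_, ?_⟩
      · have : Tendsto (fun s => s - t) (𝓝 t) (𝓝 (t - t)) := by
          exact (continuous_id.sub continuous_const).tendsto t
        rw [sub_self] at this
        exact this.mono_left nhdsWithin_le_nhds
      · filter_upwards [self_mem_nhdsWithin] with s hs using sub_pos.2 (mem_Ioi.1 hs)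
    refine (h1.comp h2).congr fun s => ?_
    simp only [Function.comp, slope_def_field, add_sub_cancel]

/-- The solution is continuously differentiable in time. -/
theorem hasDerivAt_time (hu : IsIntegratedSolution τ g u) :
    (∀ p : ℝ × ℝ, p.1 ∈ Ioo 0 τ → DifferentiableAt ℝ (fun s => u s p.2) p.1) ∧
    ∀ p : ℝ × ℝ, p.1 ∈ Ioo 0 τ → ContinuousAt (fun p : ℝ × ℝ => deriv (fun s => u s p.2) p.1) p := by
  have hzero : ∀ p : ℝ × ℝ, p.1 ∈ Ioo 0 τ → u p.1 p.2 = 0 →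
      HasDerivAt (fun s => u s p.2) 0 p.1 := by
    intro p hp h0
    refine (hasDerivAt_const p.1 (0:ℝ)).congr_of_eventuallyEq ?_
    filter_upwards [Ioo_mem_nhds hp.1 hp.2] with s hs
    refine le_antisymm (not_lt.1 fun h => ?_) (hu.nonneg s p.2)
    exact (hu.pos_of_pos (Ioo_subset_Icc_self hs) (Ioo_subset_Icc_self hp) h).ne' h0
  have hdiff : ∀ p : ℝ × ℝ, p.1 ∈ Ioo 0 τ → DifferentiableAt ℝ (fun s => u s p.2) p.1 := by
    intro p hp
    rcases (hu.nonneg p.1 p.2).eq_or_lt with h0 | h0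
    · exact (hzero p hp h0.symm).differentiableAt
    · obtain ⟨η, hη, R, -, hR⟩ := hu.exists_hasDerivAt_of_pos hp h0
      exact (hR _ (Metric.mem_ball_self hη)).differentiableAt
  refine ⟨hdiff, fun p hp => ?_⟩
  rcases (hu.nonneg p.1 p.2).eq_or_lt with h0 | h0
  swap
  · obtain ⟨η, hη, R, hRc, hR⟩ := hu.exists_hasDerivAt_of_pos hp h0
    have hb : Metric.ball (p.1, p.2) η ∈ 𝓝 p := Metric.ball_mem_nhds p hη
    refine (hRc.continuousAt hb).congr ?_
    filter_upwards [hb] with q hq using (hR q hq).deriv.symm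
  · obtain ⟨a, ha, b, hb, L, hL, h⟩ := hu.exists_lipschitz_time hp
    have huc : Continuous fun p : ℝ × ℝ => u p.1 p.2 := hu.continuous
    have hlim : Tendsto (fun q : ℝ × ℝ => L * u q.1 q.2) (𝓝 p) (𝓝 0) := by
      have := (huc.const_mul L).tendsto p
      simpa only [← h0, mul_zero] using this
    have h1 : Tendsto (fun q : ℝ × ℝ => deriv (fun s => u s q.2) q.1) (𝓝 p) (𝓝 0) := by
      refine squeeze_zero_norm' ?_ hlim
      have hn : ∀ᶠ q : ℝ × ℝ in 𝓝 p, q.1 ∈ Ioo a b :=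
        continuous_fst.continuousAt (Ioo_mem_nhds ha.2 hb.1)
      filter_upwards [hn] with q hq
      refine norm_deriv_le_of_lip' (mul_nonneg hL (hu.nonneg _ _)) ?_
      filter_upwards [Ioo_mem_nhds hq.1 hq.2] with s hs
      have := h q.1 (Ioo_subset_Icc_self hq) s (Ioo_subset_Icc_self hs) q.2
      rw [Real.norm_eq_abs, Real.norm_eq_abs, abs_sub_comm, abs_sub_comm s]
      exact this
    rw [ContinuousAt, (hzero p hp h0.symm).deriv]
    exact h1

end IsIntegratedSolution

/-- A strong solution on `[0,T)` is continuously differentiable on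
`(0,T) × ℝ` (both partial derivatives exist everywhere there and are continuous), and
the equation `∂ₜ u = (1/2) u ∂ₓ² u` holds at almost every point of `(0,T) × ℝ`. -/
theorem strong_solution_C1
    (T : ℝ) (u : ℝ → ℝ → ℝ) (hu : IsStrongSolution T u) :
    (∀ p : ℝ × ℝ, p.1 ∈ Ioo (0:ℝ) T →
      DifferentiableAt ℝ (fun s => u s p.2) p.1 ∧ DifferentiableAt ℝ (u p.1) p.2) ∧
    ContinuousOn (fun p : ℝ × ℝ => deriv (fun s => u s p.2) p.1)
      (Ioo (0:ℝ) T ×ˢ (univ : Set ℝ)) ∧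
    ContinuousOn (fun p : ℝ × ℝ => deriv (u p.1) p.2)
      (Ioo (0:ℝ) T ×ˢ (univ : Set ℝ)) ∧
    (∀ᵐ p : ℝ × ℝ ∂((volume : Measure (ℝ × ℝ)).restrict (Ioo (0:ℝ) T ×ˢ (univ : Set ℝ))),
      deriv (fun s => u s p.2) p.1 = (1/2) * u p.1 p.2 * deriv (deriv (u p.1)) p.2) := by
  have key : ∀ τ, 0 < τ → τ < T → ∃ g w, IsIntegratedSolution τ g w ∧
      (∀ p : ℝ × ℝ, p.1 ∈ Ioo 0 τ → (fun s => u s p.2) =ᶠ[𝓝 p.1] fun s => w s p.2) ∧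
      ∀ t ∈ Ioo 0 τ, w t = u t := by
    intro τ hτ hτT
    obtain ⟨g, w, hw, hwu⟩ := hu.exists_isIntegratedSolution hτ hτT
    refine ⟨g, w, hw, fun p hp => ?_, fun t ht => hwu t (Ioo_subset_Icc_self ht)⟩
    filter_upwards [Ioo_mem_nhds hp.1 hp.2] with s hs
    rw [hwu s (Ioo_subset_Icc_self hs)]
  refine ⟨fun p hp => ?_, ?_, ?_, ?_⟩
  · obtain ⟨τ, hpτ, hτT⟩ := exists_between hp.2
    obtain ⟨g, w, hw, hwu, -⟩ := key τ (hp.1.trans hpτ) hτT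
    exact ⟨(hwu p ⟨hp.1, hpτ⟩).differentiableAt_iff.2 (hw.hasDerivAt_time.1 p ⟨hp.1, hpτ⟩),
      (hu.differentiable (Ioo_subset_Ico_self hp)).1 _⟩
  · intro p hp
    obtain ⟨τ, hpτ, hτT⟩ := exists_between hp.1.2
    obtain ⟨g, w, hw, hwu, -⟩ := key τ (hp.1.1.trans hpτ) hτT
    refine ((hw.hasDerivAt_time.2 p ⟨hp.1.1, hpτ⟩).congr ?_).continuousWithinAt
    have hn : ∀ᶠ q : ℝ × ℝ in 𝓝 p, q.1 ∈ Ioo 0 τ :=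
      continuous_fst.continuousAt (Ioo_mem_nhds hp.1.1 hpτ)
    filter_upwards [hn] with q hq using (hwu q hq).deriv_eq.symm
  · exact hu.continuousOn_deriv.mono (prod_mono Ioo_subset_Ico_self subset_rfl)
  · rw [ae_restrict_iff' (measurableSet_Ioo.prod MeasurableSet.univ)]
    have hq : ∀ q : ℚ, ∀ᵐ p : ℝ × ℝ, (q : ℝ) < T → p.1 ∈ Ioo (0:ℝ) q →
        deriv (fun s => u s p.2) p.1 = (1/2) * u p.1 p.2 * deriv (deriv (u p.1)) p.2 := by
      intro q
      by_cases h0 : (0:ℝ) < q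
      swap
      · exact Eventually.of_forall fun p _ hp => absurd (hp.1.trans hp.2) h0
      by_cases h1 : (q : ℝ) < T
      swap
      · exact Eventually.of_forall fun p h => absurd h h1
      obtain ⟨g, w, hw, hwu, hwu'⟩ := key q h0 h1
      filter_upwards [hw.ae_hasDerivAt h0.le] with p hp _ hpq
      rw [(hwu p hpq).deriv_eq, (hp (Ioo_subset_Icc_self hpq)).deriv, hwu' p.1 hpq]
    filter_upwards [ae_all_iff.2 hq] with p hp hpm
    obtain ⟨q, h1, h2⟩ := exists_rat_btwn hpm.1.2
    exact hp q h2 ⟨hpm.1.1, h1⟩
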